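/- For all f ∈ C_c^∞(ℍ) one has ∫_{B^c} |f − m_f| p dm ≲ ∫_ℍ |∇f| p dm, where B^c is the complement of the Carnot–Carathéodory unit ball B, p = p_1 is the heat kernel at time 1, and the implied constant depends only on (𝒦,𝒜). -/

import Mathlib

open MeasureTheory Real Complex Finset Filter Topology

noncomputable section

/-- The underlying space of the nonisotropic Heisenberg group `ℍ(𝒦,𝒜)`, where the number of
blocks is `l + 1`, the block dimensions are `k 0, …, k l` and the parameters are
`a 0 < ⋯ < a l`. A point is a pair `(z, t)` with `z i : Fin (k i) → ℂ` and `t : ℝ`. -/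
abbrev Heis (l : ℕ) (k : Fin (l + 1) → ℕ) : Type :=
  ((i : Fin (l + 1)) → (Fin (k i) → ℂ)) × ℝ

variable (l : ℕ) (k : Fin (l + 1) → ℕ) (a : Fin (l + 1) → ℝ)

/-- The group multiplication of `ℍ(𝒦,𝒜)`:
`(z,t)·(z′,t′) = (z + z′, t + t′ + 2 ∑ᵢ aᵢ Im⟨zᵢ, zᵢ′⟩)`. -/
def hmul (g g' : Heis l k) : Heis l k :=
  (g.1 + g'.1,
    g.2 + g'.2 + 2 * ∑ i, a i * (∑ j, (starRingEnd ℂ) (g.1 i j) * g'.1 i j).im)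

/-- The group inversion of `ℍ(𝒦,𝒜)`: `(z,t)⁻¹ = (-z,-t)`. -/
def hinv (g : Heis l k) : Heis l k := (-g.1, -g.2)

/-- `|z i|²`, the squared Euclidean norm of the `i`-th block of `z`. -/
def zNormSq (z : (i : Fin (l + 1)) → Fin (k i) → ℂ) (i : Fin (l + 1)) : ℝ :=
  ∑ j, Complex.normSq (z i j)

/-- The left-invariant vector field `X_{i,j} = ∂_{x_{i,j}} + 2 aᵢ y_{i,j} ∂_t`, applied to a
function `f` at a point `g`, realized as a directional (line) derivative. -/
def Xvf (i : Fin (l + 1)) (j : Fin (k i)) (f : Heis l k → ℝ) (g : Heis l k) : ℝ :=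
  lineDeriv ℝ f g (Pi.single i (Pi.single j (1 : ℂ)), 2 * a i * (g.1 i j).im)

/-- The left-invariant vector field `Y_{i,j} = ∂_{y_{i,j}} - 2 aᵢ x_{i,j} ∂_t`. -/
def Yvf (i : Fin (l + 1)) (j : Fin (k i)) (f : Heis l k → ℝ) (g : Heis l k) : ℝ :=
  lineDeriv ℝ f g (Pi.single i (Pi.single j (Complex.I)), -(2 * a i * (g.1 i j).re))

/-- The right-invariant vector field `X̂_{i,j} = ∂_{x_{i,j}} - 2 aᵢ y_{i,j} ∂_t`. -/
def XvfR (i : Fin (l + 1)) (j : Fin (k i)) (f : Heis l k → ℝ) (g : Heis l k) : ℝ :=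
  lineDeriv ℝ f g (Pi.single i (Pi.single j (1 : ℂ)), -(2 * a i * (g.1 i j).im))

/-- The right-invariant vector field `Ŷ_{i,j} = ∂_{y_{i,j}} + 2 aᵢ x_{i,j} ∂_t`. -/
def YvfR (i : Fin (l + 1)) (j : Fin (k i)) (f : Heis l k → ℝ) (g : Heis l k) : ℝ :=
  lineDeriv ℝ f g (Pi.single i (Pi.single j (Complex.I)), 2 * a i * (g.1 i j).re)

/-- `|∇f|(g)`, the Euclidean length of the horizontal (left-invariant) gradient of `f` at `g`. -/
def gradNorm (f : Heis l k → ℝ) (g : Heis l k) : ℝ :=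
  Real.sqrt (∑ i, ∑ j, ((Xvf l k a i j f g) ^ 2 + (Yvf l k a i j f g) ^ 2))

/-- The heat kernel `p_h(z,t)` at time `h` of `ℍ(𝒦,𝒜)`, as a complex integral:
`p_h(z,t) = (2(4πh)^{n+1})⁻¹ ∫_ℝ ∏ⱼ (aⱼλ/sinh(aⱼλ))^{kⱼ}
  exp((4h)⁻¹(iλt − ∑ⱼ |zⱼ|² aⱼλ coth(aⱼλ))) dλ`. -/
def heatKernelC (h : ℝ) (g : Heis l k) : ℂ :=
  (2 * (4 * Real.pi * h) ^ ((∑ i, k i) + 1) : ℂ)⁻¹ *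
    ∫ lam : ℝ,
      ((∏ j, ((a j * lam) / Real.sinh (a j * lam)) ^ (k j) : ℝ) : ℂ) *
        Complex.exp ((4 * (h : ℂ))⁻¹ *
          (Complex.I * (lam : ℂ) * (g.2 : ℂ) -
            ∑ j, ((zNormSq l k g.1 j : ℝ) : ℂ) *
              ((a j * lam * (Real.cosh (a j * lam) / Real.sinh (a j * lam)) : ℝ) : ℂ)))

/-- The (real-valued) heat kernel `p_h` of `ℍ(𝒦,𝒜)`. -/
def heatKernel (h : ℝ) (g : Heis l k) : ℝ := (heatKernelC l k a h g).re

/-- The heat semigroup: `e^{hΔ} f (g) = ∫_ℍ f(g·g′) p_h(g′) dm(g′)`, with `m` the Lebesgue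
(Haar) measure on `ℍ(𝒦,𝒜)`. -/
def heatSemigroup (h : ℝ) (f : Heis l k → ℝ) (g : Heis l k) : ℝ :=
  ∫ g' : Heis l k, f (hmul l k a g g') * heatKernel l k a h g'

/-- `μ(ω) = (2ω − sin 2ω)/(2 sin²ω)`; note that at `ω = 0` Lean's convention `0/0 = 0`
gives exactly the continuous extension `μ(0) = 0`. -/
def muF (ω : ℝ) : ℝ := (2 * ω - Real.sin (2 * ω)) / (2 * Real.sin ω ^ 2)

/-- `x / sin x`, extended continuously by `1` at `x = 0`. -/
def sdiv (x : ℝ) : ℝ := if x = 0 then 1 else x / Real.sin x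

/-- The angle `θ(z,t) ∈ (−π,π)` solving `t = ∑ⱼ aⱼ μ(aⱼθ)|zⱼ|²`, chosen by the epsilon
operator (whenever a solution exists it is unique, and `thetaOf` is that solution). -/
def thetaOf (g : Heis l k) : ℝ :=
  Classical.epsilon fun θ : ℝ => θ ∈ Set.Ioo (-Real.pi) Real.pi ∧
    g.2 = ∑ j, a j * muF (a j * θ) * zNormSq l k g.1 j

/-- The squared Carnot–Carathéodory distance from `g = (z,t)` to the origin:
if `z_l ≠ 0`, or `z_l = 0` and `|t| < ∑_{j<l} aⱼ μ(aⱼπ)|zⱼ|²`, it is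
`∑ⱼ (aⱼθ/sin(aⱼθ))² |zⱼ|²` with `θ = θ(z,t)`; otherwise it is
`π(|t| + ∑_{j<l} aⱼ cot(aⱼπ)|zⱼ|²)`. -/
def ccDistSq (g : Heis l k) : ℝ :=
  if g.1 (Fin.last l) ≠ 0 ∨
      |g.2| < ∑ j ∈ Finset.univ.erase (Fin.last l),
        a j * muF (a j * Real.pi) * zNormSq l k g.1 j then
    ∑ j, (sdiv (a j * thetaOf l k a g)) ^ 2 * zNormSq l k g.1 j
  else
    Real.pi * (|g.2| + ∑ j ∈ Finset.univ.erase (Fin.last l),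
      a j * (Real.cos (a j * Real.pi) / Real.sin (a j * Real.pi)) * zNormSq l k g.1 j)

/-- The Carnot–Carathéodory distance from `g` to the origin. -/
def ccDist (g : Heis l k) : ℝ := Real.sqrt (ccDistSq l k a g)

/-- The Carnot–Carathéodory unit ball `B` of `ℍ(𝒦,𝒜)`. -/
def ballCC : Set (Heis l k) := {g | ccDist l k a g < 1}

/-- `m_f`, the mean of `f` over the Carnot–Carathéodory unit ball. -/
def meanB (f : Heis l k → ℝ) : ℝ :=
  (∫ g in ballCC l k a, f g) / (volume (ballCC l k a)).toReal

/-- The polar coordinates map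
`Ψ(u,η) = ((1−e^{−2ia₁η})u₁, …, (1−e^{−2ia_lη})u_l, ∑ⱼ 2aⱼ|uⱼ|²(2aⱼη − sin(2aⱼη)))`. -/
def Psi (u : (i : Fin (l + 1)) → Fin (k i) → ℂ) (η : ℝ) : Heis l k :=
  (fun i => fun j => (1 - Complex.exp (-(2 * Complex.I * (a i : ℂ) * (η : ℂ)))) * u i j,
    ∑ j, 2 * a j * zNormSq l k u j * (2 * a j * η - Real.sin (2 * a j * η)))

/-- `U = (4 ∑ⱼ aⱼ²|uⱼ|²)^{1/2}`. -/
def Ufun (u : (i : Fin (l + 1)) → Fin (k i) → ℂ) : ℝ :=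
  Real.sqrt (4 * ∑ j, (a j) ^ 2 * zNormSq l k u j)

/-- The Jacobian determinant `J(u,η)` of `Ψ` at `(u,η)` (the determinant of the total
derivative of `Ψ` as a map of the real vector space `ℍ ≅ ℝ^{2n+1}`). -/
def jacPsi (u : (i : Fin (l + 1)) → Fin (k i) → ℂ) (η : ℝ) : ℝ :=
  LinearMap.det
    ((fderiv ℝ (fun q : Heis l k => Psi l k a q.1 q.2) (u, η)) : Heis l k →ₗ[ℝ] Heis l k)


/-- Cosine transform. -/
def Fc (m : ℝ → ℝ) (τ : ℝ) : ℝ := ∫ x : ℝ, m x * Real.cos (x * τ)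

/-- Sine transform of `x m(x)`; this is minus the derivative of `Fc m`. -/
def Fs (m : ℝ → ℝ) (τ : ℝ) : ℝ := ∫ x : ℝ, (x * m x) * Real.sin (x * τ)

/-- The characteristic function of the Laplace law. -/
def lap (b x : ℝ) : ℝ := b ^ 2 / (b ^ 2 + x ^ 2)

lemma lap_pos {b : ℝ} (hb : 0 < b) (x : ℝ) : 0 < lap b x := by
  unfold lap; positivity

lemma lap_le_one {b : ℝ} (hb : 0 < b) (x : ℝ) : lap b x ≤ 1 := by
  unfold lap
  rw [div_le_one (by positivity)]
  nlinarith [sq_nonneg x]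

lemma lap_cont {b : ℝ} (hb : 0 < b) : Continuous (lap b) := by
  unfold lap
  exact continuous_const.div (by fun_prop) (fun x => by positivity)

lemma sq_mul_lap {b : ℝ} (hb : 0 < b) (x : ℝ) : x ^ 2 * lap b x = b ^ 2 * (1 - lap b x) := by
  unfold lap
  have : b ^ 2 + x ^ 2 ≠ 0 := by positivity
  field_simp
  ring

lemma Fc_integrable {m : ℝ → ℝ} (hm : Integrable m) (τ : ℝ) :
    Integrable (fun x : ℝ => m x * Real.cos (x * τ)) := by
  refine hm.mul_bdd (c := 1) (by fun_prop) ?_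
  exact Eventually.of_forall fun x => by simpa using Real.abs_cos_le_one _

lemma Fs_integrable {m : ℝ → ℝ} (hm : Integrable (fun x => x * m x)) (τ : ℝ) :
    Integrable (fun x : ℝ => (x * m x) * Real.sin (x * τ)) := by
  refine hm.mul_bdd (c := 1) (by fun_prop) ?_
  exact Eventually.of_forall fun x => by simpa using Real.abs_sin_le_one _

lemma integrable_mul_lap {m : ℝ → ℝ} (hm : Integrable m) {b : ℝ} (hb : 0 < b) :
    Integrable (fun x => m x * lap b x) := by
  refine hm.mul_bdd (c := 1) (lap_cont hb).aestronglyMeasurable ?_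
  exact Eventually.of_forall fun x => by
    rw [Real.norm_eq_abs, abs_of_pos (lap_pos hb x)]; exact lap_le_one hb x

lemma abs_mul_lap_le {b : ℝ} (hb : 0 < b) (x : ℝ) : |x * lap b x| ≤ b := by
  unfold lap
  rw [abs_mul, abs_of_pos (by positivity : 0 < b ^ 2 / (b ^ 2 + x ^ 2)), mul_div_assoc', div_le_iff₀ (by positivity)]
  nlinarith [sq_nonneg (|x| - b), sq_abs x, abs_nonneg x]

lemma integrable_mul_lap' {m : ℝ → ℝ} (hm : Integrable m) {b : ℝ} (hb : 0 < b) :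
    Integrable (fun x => x * (m x * lap b x)) := by
  have : Integrable (fun x => m x * (x * lap b x)) := by
    refine hm.mul_bdd (c := b) (continuous_id.mul (lap_cont hb)).aestronglyMeasurable ?_
    exact Eventually.of_forall fun x => abs_mul_lap_le hb x
  exact this.congr (Eventually.of_forall fun x => by ring)

lemma Fc_neg (m : ℝ → ℝ) (τ : ℝ) : Fc m (-τ) = Fc m τ := by
  simp [Fc]

lemma Fs_neg (m : ℝ → ℝ) (τ : ℝ) : Fs m (-τ) = -Fs m τ := by
  simp [Fs, integral_neg]

lemma Fc_abs_le {m : ℝ → ℝ} (hm : Integrable m) (τ : ℝ) : |Fc m τ| ≤ ∫ x, |m x| := by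
  unfold Fc
  rw [← Real.norm_eq_abs]
  refine (norm_integral_le_integral_norm _).trans ?_
  refine integral_mono (Fc_integrable hm τ).norm hm.norm fun x => ?_
  simp only [norm_mul, Real.norm_eq_abs]
  exact mul_le_of_le_one_right (abs_nonneg _) (Real.abs_cos_le_one _)

lemma Fc_continuous {m : ℝ → ℝ} (hm : Integrable m) : Continuous (Fc m) := by
  unfold Fc
  refine continuous_of_dominated (bound := fun x => |m x|) (fun τ => (Fc_integrable hm τ).1) ?_
    hm.norm ?_
  · intro τ
    refine Eventually.of_forall fun x => ?_
    simp only [norm_mul, Real.norm_eq_abs]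
    exact mul_le_of_le_one_right (abs_nonneg _) (Real.abs_cos_le_one _)
  · exact Eventually.of_forall fun x => by fun_prop

lemma Fc_hasDerivAt {m : ℝ → ℝ} (hm : Integrable m) (hm' : Integrable (fun x => x * m x)) (τ : ℝ) :
    HasDerivAt (Fc m) (-Fs m τ) τ := by
  have := hasDerivAt_integral_of_dominated_loc_of_deriv_le (μ := volume) (𝕜 := ℝ)
    (F := fun τ x => m x * Real.cos (x * τ)) (F' := fun τ x => -((x * m x) * Real.sin (x * τ)))
    (x₀ := τ) (s := Set.univ) (bound := fun x => |x * m x|) univ_mem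
    (Eventually.of_forall fun τ => (Fc_integrable hm τ).1) (Fc_integrable hm τ)
    (Fs_integrable hm' τ).neg.1 (Eventually.of_forall fun x τ _ => ?_) hm'.norm
    (Eventually.of_forall fun x τ _ => ?_)
  · have h := this.2
    rw [integral_neg] at h
    exact h
  · simp only [norm_neg, norm_mul, Real.norm_eq_abs]
    rw [abs_mul]
    exact mul_le_of_le_one_right (by positivity) (Real.abs_sin_le_one _)
  · have h1 : HasDerivAt (fun τ : ℝ => x * τ) x τ := by
      simpa using (hasDerivAt_id τ).const_mul x
    refine ((h1.cos).const_mul (m x)).congr_deriv ?_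
    ring

lemma exp_kernel_integrable {b : ℝ} (hb : 0 < b) :
    IntegrableOn (fun s : ℝ => b * Real.exp (-b * s)) (Set.Ioi 0) :=
  (exp_neg_integrableOn_Ioi 0 hb).const_mul b

lemma exp_kernel_integral {b : ℝ} (hb : 0 < b) :
    ∫ s in Set.Ioi (0 : ℝ), b * Real.exp (-b * s) = 1 := by
  rw [integral_const_mul, integral_exp_mul_Ioi (by linarith)]
  simp
  field_simp

lemma exp_kernel_mul_integrable {b : ℝ} (hb : 0 < b) {f : ℝ → ℝ} (hf : Continuous f) {C : ℝ}
    (hC : ∀ x, |f x| ≤ C) :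
    IntegrableOn (fun s : ℝ => b * Real.exp (-b * s) * f s) (Set.Ioi 0) :=
  (exp_kernel_integrable hb).mul_bdd (c := C) hf.aestronglyMeasurable
    (Eventually.of_forall fun x => hC x)

lemma exp_int_cos {b : ℝ} (hb : 0 < b) (x τ : ℝ) :
    ∫ s in Set.Ioi (0 : ℝ), b * Real.exp (-b * s) * Real.cos (x * (τ + s)) =
      lap b x * Real.cos (x * τ) - b⁻¹ * (x * lap b x * Real.sin (x * τ)) := by
  have hne : b ^ 2 + x ^ 2 ≠ 0 := by positivity
  have hd : ∀ s : ℝ, HasDerivAt (fun s : ℝ => b * Real.exp (-b * s) *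
      ((-b * Real.cos (x * (τ + s)) + x * Real.sin (x * (τ + s))) / (b ^ 2 + x ^ 2)))
      (b * Real.exp (-b * s) * Real.cos (x * (τ + s))) s := by
    intro s
    have h1 : HasDerivAt (fun s : ℝ => x * (τ + s)) x s := by
      simpa using ((hasDerivAt_id s).const_add τ).const_mul x
    have h2 : HasDerivAt (fun s : ℝ => -b * s) (-b) s := by
      simpa using (hasDerivAt_id s).const_mul (-b)
    have h3 := (h2.exp.const_mul b).mul (((h1.cos.const_mul (-b)).add (h1.sin.const_mul x)).div_const (b ^ 2 + x ^ 2))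
    refine h3.congr_deriv ?_
    simp only [Pi.add_apply]
    field_simp
    ring
  have hIntg : IntegrableOn (fun s => b * Real.exp (-b * s) * Real.cos (x * (τ + s))) (Set.Ioi 0) :=
    exp_kernel_mul_integrable hb (by fun_prop) (fun s => Real.abs_cos_le_one _)
  have hlim : Tendsto (fun s : ℝ => b * Real.exp (-b * s) *
      ((-b * Real.cos (x * (τ + s)) + x * Real.sin (x * (τ + s))) / (b ^ 2 + x ^ 2))) atTop (𝓝 0) := by
    have h0 : Tendsto (fun s : ℝ => b * Real.exp (-b * s)) atTop (𝓝 0) := by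
      have : Tendsto (fun s : ℝ => -b * s) atTop atBot := by
        simpa using tendsto_id.const_mul_atTop_of_neg (by linarith : -b < 0)
      simpa using (Real.tendsto_exp_atBot.comp this).const_mul b
    refine h0.zero_mul_isBoundedUnder_le ?_
    refine ⟨(b + |x|) / (b ^ 2 + x ^ 2), ?_⟩
    simp only [eventually_map]
    refine Eventually.of_forall fun s => ?_
    simp only [Function.comp, Real.norm_eq_abs]
    rw [abs_div, abs_of_pos (by positivity : 0 < b ^ 2 + x ^ 2)]
    gcongr
    refine (abs_add_le _ _).trans ?_
    rw [abs_mul, abs_mul, abs_neg, abs_of_pos hb]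
    gcongr
    · exact mul_le_of_le_one_right hb.le (Real.abs_cos_le_one _)
    · exact mul_le_of_le_one_right (abs_nonneg _) (Real.abs_sin_le_one _)
  rw [integral_Ioi_of_hasDerivAt_of_tendsto' (fun s _ => hd s) hIntg hlim]
  simp [lap]
  field_simp
  ring

lemma exp_avg {m : ℝ → ℝ} (hm : Integrable m) {b : ℝ} (hb : 0 < b) (τ : ℝ) :
    ∫ s in Set.Ioi (0 : ℝ), b * Real.exp (-b * s) * Fc m (τ + s) =
      Fc (fun x => m x * lap b x) τ - b⁻¹ * Fs (fun x => m x * lap b x) τ := by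
  unfold Fc Fs
  have e1 : ∀ s : ℝ, b * Real.exp (-b * s) * ∫ x, m x * Real.cos (x * (τ + s)) =
      ∫ x, (b * Real.exp (-b * s)) * (m x * Real.cos (x * (τ + s))) := fun s =>
    (integral_const_mul _ _).symm
  simp_rw [e1]
  rw [integral_integral_swap]
  · have e2 : ∀ x : ℝ, ∫ s in Set.Ioi (0 : ℝ), (b * Real.exp (-b * s)) * (m x * Real.cos (x * (τ + s)))
        = m x * lap b x * Real.cos (x * τ) - b⁻¹ * (x * (m x * lap b x) * Real.sin (x * τ)) := by
      intro x
      have : ∀ s : ℝ, (b * Real.exp (-b * s)) * (m x * Real.cos (x * (τ + s))) =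
        m x * (b * Real.exp (-b * s) * Real.cos (x * (τ + s))) := fun s => by ring
      simp_rw [this]
      rw [integral_const_mul, exp_int_cos hb]
      ring
    simp_rw [e2]
    rw [integral_sub (Fc_integrable (integrable_mul_lap hm hb) τ)
      ((Fs_integrable (integrable_mul_lap' hm hb) τ).const_mul _), integral_const_mul]
  · have h := (exp_kernel_integrable hb).mul_prod hm
    have h2 := h.mul_bdd (c := 1) (g := fun p : ℝ × ℝ => Real.cos (p.2 * (τ + p.1)))
      (by fun_prop) (Eventually.of_forall fun p => by simpa using Real.abs_cos_le_one _)
    exact h2.congr (Eventually.of_forall fun p => by simp [Function.uncurry]; ring)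

lemma exp_avg' {m : ℝ → ℝ} (hm : Integrable m) {b : ℝ} (hb : 0 < b) (τ : ℝ) :
    ∫ s in Set.Ioi (0 : ℝ), b * Real.exp (-b * s) * Fc m (τ - s) =
      Fc (fun x => m x * lap b x) τ + b⁻¹ * Fs (fun x => m x * lap b x) τ := by
  have := exp_avg hm hb (-τ)
  rw [Fc_neg, Fs_neg] at this
  rw [mul_neg, sub_neg_eq_add] at this
  rw [← this]
  congr 1
  ext s
  rw [← Fc_neg m (τ - s)]
  congr 2
  ring

lemma exp_avg_integrable {m : ℝ → ℝ} (hm : Integrable m) {b : ℝ} (hb : 0 < b) (τ : ℝ) :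
    IntegrableOn (fun s : ℝ => b * Real.exp (-b * s) * Fc m (τ + s)) (Set.Ioi 0) :=
  exp_kernel_mul_integrable hb ((Fc_continuous hm).comp (by fun_prop)) (fun _ => Fc_abs_le hm _)

lemma exp_avg_integrable' {m : ℝ → ℝ} (hm : Integrable m) {b : ℝ} (hb : 0 < b) (τ : ℝ) :
    IntegrableOn (fun s : ℝ => b * Real.exp (-b * s) * Fc m (τ - s)) (Set.Ioi 0) :=
  exp_kernel_mul_integrable hb ((Fc_continuous hm).comp (by fun_prop)) (fun _ => Fc_abs_le hm _)

/-- The cosine transform is nonnegative and symmetric unimodal. -/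
structure Uni (m : ℝ → ℝ) : Prop where
  int : Integrable m
  nn : ∀ τ, 0 ≤ Fc m τ
  anti : ∀ τ τ' : ℝ, |τ| ≤ |τ'| → Fc m τ' ≤ Fc m τ

lemma Fc_abs (m : ℝ → ℝ) (τ : ℝ) : Fc m |τ| = Fc m τ := by
  rcases abs_choice τ with h | h <;> rw [h]
  exact Fc_neg m τ

lemma Fs_lap_le {m : ℝ → ℝ} (hm : Integrable m) (hn : ∀ τ, 0 ≤ Fc m τ) {b : ℝ} (hb : 0 < b) (τ : ℝ) :
    |Fs (fun x => m x * lap b x) τ| ≤ b * Fc (fun x => m x * lap b x) τ := by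
  have h1 := exp_avg hm hb τ
  have h2 := exp_avg' hm hb τ
  have p1 : 0 ≤ ∫ s in Set.Ioi (0 : ℝ), b * Real.exp (-b * s) * Fc m (τ + s) :=
    setIntegral_nonneg measurableSet_Ioi fun s _ => by have := hn (τ + s); positivity
  have p2 : 0 ≤ ∫ s in Set.Ioi (0 : ℝ), b * Real.exp (-b * s) * Fc m (τ - s) :=
    setIntegral_nonneg measurableSet_Ioi fun s _ => by have := hn (τ - s); positivity
  rw [h1] at p1
  rw [h2] at p2
  have e : b * (b⁻¹ * Fs (fun x => m x * lap b x) τ) = Fs (fun x => m x * lap b x) τ := by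
    field_simp
  rw [abs_le]
  constructor
  · nlinarith
  · nlinarith

lemma Fc_lap_nonneg {m : ℝ → ℝ} (hm : Integrable m) (hn : ∀ τ, 0 ≤ Fc m τ) {b : ℝ} (hb : 0 < b) (τ : ℝ) :
    0 ≤ Fc (fun x => m x * lap b x) τ := by
  have := (abs_nonneg _).trans (Fs_lap_le hm hn hb τ)
  exact nonneg_of_mul_nonneg_right this hb

lemma Uni.Fs_lap_nonneg {m : ℝ → ℝ} (h : Uni m) {b : ℝ} (hb : 0 < b) {τ : ℝ} (hτ : 0 ≤ τ) :
    0 ≤ Fs (fun x => m x * lap b x) τ := by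
  have h1 := exp_avg h.int hb τ
  have h2 := exp_avg' h.int hb τ
  have : ∫ s in Set.Ioi (0 : ℝ), b * Real.exp (-b * s) * Fc m (τ + s) ≤
      ∫ s in Set.Ioi (0 : ℝ), b * Real.exp (-b * s) * Fc m (τ - s) := by
    refine setIntegral_mono_on (exp_avg_integrable h.int hb τ) (exp_avg_integrable' h.int hb τ)
      measurableSet_Ioi fun s hs => ?_
    have hs : 0 < s := hs
    have := h.anti (τ - s) (τ + s) (by
      rw [abs_of_nonneg (by linarith : 0 ≤ τ + s)]; rw [abs_le]; constructor <;> linarith)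
    gcongr
  rw [h1, h2] at this
  have h3 : 0 ≤ b⁻¹ * Fs (fun x => m x * lap b x) τ := by linarith
  exact nonneg_of_mul_nonneg_right h3 (by positivity)

/-- For `τ ≥ 0`, `b (g - f) ≤ - g'` where `g = f * Laplace`. -/
lemma Uni.Fs_lap_ge {m : ℝ → ℝ} (h : Uni m) {b : ℝ} (hb : 0 < b) {τ : ℝ} (hτ : 0 ≤ τ) :
    b * (Fc (fun x => m x * lap b x) τ - Fc m τ) ≤ Fs (fun x => m x * lap b x) τ := by
  have h1 := exp_avg h.int hb τ
  have : ∫ s in Set.Ioi (0 : ℝ), b * Real.exp (-b * s) * Fc m (τ + s) ≤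
      ∫ s in Set.Ioi (0 : ℝ), b * Real.exp (-b * s) * Fc m τ := by
    refine setIntegral_mono_on (exp_avg_integrable h.int hb τ)
      ((exp_kernel_integrable hb).mul_const _)
      measurableSet_Ioi fun s hs => ?_
    have hs : 0 < s := hs
    have := h.anti τ (τ + s) (by
      rw [abs_of_nonneg (by linarith : 0 ≤ τ + s), abs_of_nonneg hτ]; linarith)
    gcongr
  rw [h1, integral_mul_const, exp_kernel_integral hb] at this
  have e : b * (b⁻¹ * Fs (fun x => m x * lap b x) τ) = Fs (fun x => m x * lap b x) τ := by
    field_simp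
  nlinarith

lemma Uni.lap {m : ℝ → ℝ} (h : Uni m) {b : ℝ} (hb : 0 < b) : Uni (fun x => m x * lap b x) := by
  refine ⟨integrable_mul_lap h.int hb, Fc_lap_nonneg h.int h.nn hb, ?_⟩
  have hanti : AntitoneOn (Fc (fun x => m x * _root_.lap b x)) (Set.Ici 0) := by
    have hd := fun τ => Fc_hasDerivAt (integrable_mul_lap h.int hb) (integrable_mul_lap' h.int hb) τ
    refine antitoneOn_of_deriv_nonpos (convex_Ici 0) (Fc_continuous (integrable_mul_lap h.int hb)).continuousOn
      (fun τ _ => (hd τ).differentiableAt.differentiableWithinAt) ?_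
    intro τ hτ
    rw [interior_Ici] at hτ
    rw [(hd τ).deriv]
    have := h.Fs_lap_nonneg hb (le_of_lt hτ)
    linarith
  intro τ τ' hh
  rw [← Fc_abs _ τ, ← Fc_abs _ τ']
  exact hanti (Set.mem_Ici.mpr (abs_nonneg _)) (Set.mem_Ici.mpr (abs_nonneg _)) hh

lemma Uni.lap_pow {m : ℝ → ℝ} (h : Uni m) {b : ℝ} (hb : 0 < b) (n : ℕ) :
    Uni (fun x => m x * _root_.lap b x ^ n) := by
  induction n with
  | zero => simpa using h
  | succ n ih => simpa [pow_succ, mul_assoc] using ih.lap hb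

lemma Fc_add {m m' : ℝ → ℝ} (hm : Integrable m) (hm' : Integrable m') (τ : ℝ) :
    Fc (fun x => m x + m' x) τ = Fc m τ + Fc m' τ := by
  unfold Fc
  rw [← integral_add (Fc_integrable hm τ) (Fc_integrable hm' τ)]
  simp only [add_mul]

lemma Fc_sub {m m' : ℝ → ℝ} (hm : Integrable m) (hm' : Integrable m') (τ : ℝ) :
    Fc (fun x => m x - m' x) τ = Fc m τ - Fc m' τ := by
  unfold Fc
  rw [← integral_sub (Fc_integrable hm τ) (Fc_integrable hm' τ)]
  simp only [sub_mul]

lemma Fc_const_mul (c : ℝ) (m : ℝ → ℝ) (τ : ℝ) :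
    Fc (fun x => c * m x) τ = c * Fc m τ := by
  unfold Fc
  rw [← integral_const_mul]
  simp only [mul_assoc]

lemma Fc_sum {ι : Type*} (s : Finset ι) {m : ι → ℝ → ℝ} (hm : ∀ i ∈ s, Integrable (m i)) (τ : ℝ) :
    Fc (fun x => ∑ i ∈ s, m i x) τ = ∑ i ∈ s, Fc (m i) τ := by
  unfold Fc
  rw [← integral_finsetSum s (fun i hi => Fc_integrable (hm i hi) τ)]
  simp only [Finset.sum_mul]

lemma Uni.add {m m' : ℝ → ℝ} (h : Uni m) (h' : Uni m') : Uni (fun x => m x + m' x) := by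
  refine ⟨h.int.add h'.int, fun τ => ?_, fun τ τ' hh => ?_⟩
  · rw [Fc_add h.int h'.int]; exact add_nonneg (h.nn τ) (h'.nn τ)
  · rw [Fc_add h.int h'.int, Fc_add h.int h'.int]; exact add_le_add (h.anti _ _ hh) (h'.anti _ _ hh)

lemma Uni.const_mul {m : ℝ → ℝ} (h : Uni m) {c : ℝ} (hc : 0 ≤ c) : Uni (fun x => c * m x) := by
  refine ⟨h.int.const_mul c, fun τ => ?_, fun τ τ' hh => ?_⟩
  · rw [Fc_const_mul]; exact mul_nonneg hc (h.nn τ)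
  · rw [Fc_const_mul, Fc_const_mul]; exact mul_le_mul_of_nonneg_left (h.anti _ _ hh) hc

lemma Fc_tendsto {m : ℕ → ℝ → ℝ} {m' bd : ℝ → ℝ} (hm : ∀ᶠ N in atTop, Integrable (m N)) (hbd : Integrable bd)
    (hle : ∀ᶠ N in atTop, ∀ x, |m N x| ≤ bd x) (hl : ∀ᵐ x, Tendsto (fun N => m N x) atTop (𝓝 (m' x))) (τ : ℝ) :
    Tendsto (fun N => Fc (m N) τ) atTop (𝓝 (Fc m' τ)) := by
  unfold Fc
  refine tendsto_integral_filter_of_dominated_convergence bd ?_ ?_ hbd ?_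
  · filter_upwards [hm] with N hN using (Fc_integrable hN τ).1
  · filter_upwards [hle] with N hN
    refine Eventually.of_forall fun x => ?_
    simp only [norm_mul, Real.norm_eq_abs]
    exact (mul_le_of_le_one_right (abs_nonneg _) (Real.abs_cos_le_one _)).trans (hN x)
  · filter_upwards [hl] with x hx using hx.mul_const _

lemma Uni.limit {m : ℕ → ℝ → ℝ} {m' bd : ℝ → ℝ} (hm : ∀ N, Uni (m N)) (hbd : Integrable bd)
    (hle : ∀ N x, |m N x| ≤ bd x) (hm' : Integrable m') (hl : ∀ x, Tendsto (fun N => m N x) atTop (𝓝 (m' x))) :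
    Uni m' := by
  have ht := fun τ => Fc_tendsto (Eventually.of_forall fun N => (hm N).int) hbd
    (Eventually.of_forall hle) (Eventually.of_forall hl) τ
  refine ⟨hm', fun τ => ge_of_tendsto' (ht τ) (fun N => (hm N).nn τ), fun τ τ' hh => ?_⟩
  exact le_of_tendsto_of_tendsto' (ht τ') (ht τ) fun N => (hm N).anti _ _ hh

lemma one_add_div_pow_le_exp {y : ℝ} (hy : 0 ≤ y) (N : ℕ) : (1 + y / N) ^ N ≤ Real.exp y := by
  rcases Nat.eq_zero_or_pos N with h | h
  · subst h; simp [hy]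
  · have h1 : 1 + y / N ≤ Real.exp (y / N) := by linarith [Real.add_one_le_exp (y / N)]
    calc (1 + y / N) ^ N ≤ (Real.exp (y / N)) ^ N := pow_le_pow_left₀ (by positivity) h1 N
      _ = Real.exp y := by rw [← Real.exp_nat_mul]; congr 1; field_simp

lemma integrable_mul_exp_lap {m : ℝ → ℝ} (hm : Integrable m) {b : ℝ} (hb : 0 < b) (w : ℝ) :
    Integrable (fun x => m x * Real.exp (w * lap b x)) := by
  refine hm.mul_bdd (c := Real.exp |w|)
    (Real.continuous_exp.comp (continuous_const.mul (lap_cont hb))).aestronglyMeasurable ?_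
  refine Eventually.of_forall fun x => ?_
  rw [Real.norm_eq_abs, abs_of_pos (Real.exp_pos _)]
  gcongr
  refine (le_abs_self _).trans ?_
  rw [abs_mul, abs_of_pos (lap_pos hb x)]
  exact mul_le_of_le_one_right (abs_nonneg _) (lap_le_one hb x)

lemma Uni.exp_lap {m : ℝ → ℝ} (h : Uni m) {b : ℝ} (hb : 0 < b) {w : ℝ} (hw : 0 ≤ w) :
    Uni (fun x => m x * Real.exp (w * _root_.lap b x)) := by
  refine Uni.limit (m := fun N x => m x * (1 + w * _root_.lap b x / N) ^ N)
    (bd := fun x => |m x * Real.exp (w * _root_.lap b x)|) ?_ (integrable_mul_exp_lap h.int hb w).abs ?_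
    (integrable_mul_exp_lap h.int hb w) ?_
  · intro N
    have : ∀ j : ℕ, Uni (fun x => m x * (1 + w * _root_.lap b x / N) ^ j) := by
      intro j
      induction j with
      | zero => simpa using h
      | succ j ih =>
        have := ih.add ((ih.lap hb).const_mul (by positivity : 0 ≤ w / N))
        convert this using 2
        ring
    exact this N
  · intro N x
    have := mul_nonneg hw (lap_pos hb x).le
    rw [abs_mul, abs_mul, abs_of_pos (Real.exp_pos _), abs_of_nonneg (by positivity : 0 ≤ (1 + w * _root_.lap b x / N) ^ N)]
    gcongr
    exact one_add_div_pow_le_exp this N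
  · intro x
    exact (Real.tendsto_one_add_div_pow_exp _).const_mul _

lemma integrable_gauss {ε : ℝ} (hε : 0 < ε) : Integrable (fun x : ℝ => Real.exp (-ε * x ^ 2)) :=
  integrable_exp_neg_mul_sq hε

lemma Fc_gauss {ε : ℝ} (hε : 0 < ε) (τ : ℝ) :
    Fc (fun x : ℝ => Real.exp (-ε * x ^ 2)) τ = Real.sqrt (π / ε) * Real.exp (-(τ ^ 2 / (4 * ε))) := by
  have h := fourierIntegral_gaussian (b := (ε : ℂ)) (by simpa using hε) (τ : ℂ)
  have h2 := congrArg Complex.re h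
  rw [← RCLike.re_eq_complex_re, ← integral_re] at h2
  · unfold Fc
    convert h2 using 1
    · congr 1; ext x
      rw [RCLike.re_eq_complex_re, Complex.mul_re]
      have e1 : Complex.I * (τ : ℂ) * (x : ℂ) = ((x * τ : ℝ) : ℂ) * Complex.I := by push_cast; ring
      have e2 : -(ε : ℂ) * (x : ℂ) ^ 2 = ((-ε * x ^ 2 : ℝ) : ℂ) := by push_cast; ring
      rw [e1, e2, Complex.exp_ofReal_mul_I_re, Complex.exp_ofReal_re, Complex.exp_ofReal_im]
      ring
    · rw [RCLike.re_eq_complex_re]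
      have e1 : ((π : ℂ) / (ε : ℂ)) ^ (1 / 2 : ℂ) = ((Real.sqrt (π / ε) : ℝ) : ℂ) := by
        rw [Real.sqrt_eq_rpow, Complex.ofReal_cpow (by positivity)]
        push_cast; rfl
      have e2 : -(τ : ℂ) ^ 2 / (4 * (ε : ℂ)) = ((-(τ ^ 2 / (4 * ε)) : ℝ) : ℂ) := by push_cast; ring
      rw [e1, e2, ← Complex.ofReal_exp, ← Complex.ofReal_mul, Complex.ofReal_re]
  · have := (integrable_gauss hε).ofReal (𝕜 := ℂ)
    have h3 := this.bdd_mul (c := 1) (f := fun x : ℝ => Complex.exp (Complex.I * (τ : ℂ) * (x : ℂ)))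
      (by fun_prop) (Eventually.of_forall fun x => by
        have e1 : Complex.I * (τ : ℂ) * (x : ℂ) = ((x * τ : ℝ) : ℂ) * Complex.I := by push_cast; ring
        rw [e1, Complex.norm_exp_ofReal_mul_I])
    refine h3.congr (Eventually.of_forall fun x => ?_)
    simp

lemma Uni_gauss {ε : ℝ} (hε : 0 < ε) : Uni (fun x : ℝ => Real.exp (-ε * x ^ 2)) := by
  refine ⟨integrable_gauss hε, fun τ => ?_, fun τ τ' hh => ?_⟩
  · rw [Fc_gauss hε]; positivity
  · rw [Fc_gauss hε, Fc_gauss hε]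
    have := sq_le_sq.mpr hh
    gcongr

lemma integrable_lap {b : ℝ} (hb : 0 < b) : Integrable (lap b) := by
  have h := (integrable_inv_one_add_sq).comp_div (g := fun x : ℝ => (1 + x ^ 2)⁻¹) hb.ne'
  refine h.congr (Eventually.of_forall fun x => ?_)
  simp only [lap]
  have : b ^ 2 + x ^ 2 ≠ 0 := by positivity
  have h2 : (1 + (x / b) ^ 2) ≠ 0 := by positivity
  field_simp

lemma two_Fc_lap {m : ℝ → ℝ} (hm : Integrable m) {b : ℝ} (hb : 0 < b) (τ : ℝ) :
    ∫ s in Set.Ioi (0 : ℝ), b * Real.exp (-b * s) * (Fc m (τ + s) + Fc m (τ - s)) =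
      2 * Fc (fun x => m x * lap b x) τ := by
  simp_rw [mul_add]
  rw [integral_add (exp_avg_integrable hm hb τ) (exp_avg_integrable' hm hb τ), exp_avg hm hb, exp_avg' hm hb]
  ring

lemma Fc_lap_two_le {m : ℝ → ℝ} (hm : Integrable m) (hn : ∀ τ, 0 ≤ Fc m τ) {b : ℝ} (hb : 0 < b) (τ : ℝ) :
    Fc (fun x => m x * lap (2 * b) x) τ ≤ 2 * Fc (fun x => m x * lap b x) τ := by
  have h1 := two_Fc_lap hm hb τ
  have hb2 : 0 < 2 * b := by linarith
  have h2 := two_Fc_lap hm hb2 τ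
  have hc : Continuous (fun s => Fc m (τ + s) + Fc m (τ - s)) := by
    have := Fc_continuous hm
    fun_prop
  have hbd : ∀ s, |Fc m (τ + s) + Fc m (τ - s)| ≤ (∫ x, |m x|) + ∫ x, |m x| := fun s =>
    (abs_add_le _ _).trans (add_le_add (Fc_abs_le hm _) (Fc_abs_le hm _))
  have : ∫ s in Set.Ioi (0 : ℝ), (2 * b) * Real.exp (-(2 * b) * s) * (Fc m (τ + s) + Fc m (τ - s)) ≤
      ∫ s in Set.Ioi (0 : ℝ), 2 * (b * Real.exp (-b * s) * (Fc m (τ + s) + Fc m (τ - s))) := by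
    refine setIntegral_mono_on (exp_kernel_mul_integrable hb2 hc hbd)
      ((exp_kernel_mul_integrable hb hc hbd).const_mul 2) measurableSet_Ioi fun s hs => ?_
    have hs : 0 < s := hs
    rw [← mul_assoc, ← mul_assoc 2]
    have h3 := add_nonneg (hn (τ + s)) (hn (τ - s))
    gcongr
    nlinarith
  rw [h2, integral_const_mul, h1] at this
  linarith

/-- Weights with two distinguished Laplace factors. -/
def Good (m : ℝ → ℝ) : Prop := ∃ H : ℝ → ℝ, Uni H ∧ m = fun x => H x * lap π x * lap (2 * π) x

lemma two_pi_pos' : 0 < 2 * π := by positivity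

lemma Good.uni {m : ℝ → ℝ} (h : Good m) : Uni m := by
  obtain ⟨H, hH, rfl⟩ := h
  exact (hH.lap pi_pos).lap two_pi_pos'

lemma Good.lap {m : ℝ → ℝ} (h : Good m) {b : ℝ} (hb : 0 < b) : Good (fun x => m x * _root_.lap b x) := by
  obtain ⟨H, hH, rfl⟩ := h
  exact ⟨_, hH.lap hb, by ext x; ring⟩

lemma Good.lap_factor {m : ℝ → ℝ} (h : Good m) : ∃ m', Uni m' ∧ m = fun x => m' x * _root_.lap π x := by
  obtain ⟨H, hH, rfl⟩ := h
  exact ⟨_, hH.lap two_pi_pos', by ext x; ring⟩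

lemma Good.Fs_nonneg {m : ℝ → ℝ} (h : Good m) {τ : ℝ} (hτ : 0 ≤ τ) : 0 ≤ Fs m τ := by
  obtain ⟨m', h', rfl⟩ := h.lap_factor
  exact h'.Fs_lap_nonneg pi_pos hτ

lemma Good.Fs_le {m : ℝ → ℝ} (h : Good m) (τ : ℝ) : |Fs m τ| ≤ π * Fc m τ := by
  obtain ⟨m', h', rfl⟩ := h.lap_factor
  exact Fs_lap_le h'.int h'.nn pi_pos τ

lemma Good.int_x {m : ℝ → ℝ} (h : Good m) : Integrable (fun x => x * m x) := by
  obtain ⟨m', h', rfl⟩ := h.lap_factor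
  exact integrable_mul_lap' h'.int pi_pos

lemma Good.int_sq {m : ℝ → ℝ} (h : Good m) : Integrable (fun x => x ^ 2 * m x) := by
  obtain ⟨m', h', rfl⟩ := h.lap_factor
  have := (h'.int.sub (integrable_mul_lap h'.int pi_pos)).const_mul (π ^ 2)
  refine this.congr (Eventually.of_forall fun x => ?_)
  have := sq_mul_lap pi_pos x
  simp only [Pi.sub_apply]
  linear_combination (-m' x) * this

lemma Good.Fc_sq {m : ℝ → ℝ} (h : Good m) (τ : ℝ) :
    -(π ^ 2 * Fc m τ) ≤ Fc (fun x => x ^ 2 * m x) τ ∧ Fc (fun x => x ^ 2 * m x) τ ≤ 2 * π ^ 2 * Fc m τ := by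
  obtain ⟨H, hH, rfl⟩ := h
  have hA := hH.lap pi_pos
  have hB := hH.lap two_pi_pos'
  have hC := hA.lap two_pi_pos'
  have e1 : Fc (fun x => x ^ 2 * (H x * _root_.lap π x * _root_.lap (2 * π) x)) τ =
      π ^ 2 * (Fc (fun x => H x * _root_.lap (2 * π) x) τ - Fc (fun x => H x * _root_.lap π x * _root_.lap (2 * π) x) τ) := by
    rw [← Fc_sub hB.int hC.int, ← Fc_const_mul]
    congr 1
    ext x
    have := sq_mul_lap pi_pos x
    linear_combination (H x * _root_.lap (2 * π) x) * this
  have e2 : Fc (fun x => H x * _root_.lap π x * _root_.lap (2 * π) x) τ =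
      4 / 3 * Fc (fun x => H x * _root_.lap π x) τ - 1 / 3 * Fc (fun x => H x * _root_.lap (2 * π) x) τ := by
    rw [← Fc_const_mul, ← Fc_const_mul, ← Fc_sub (hA.int.const_mul _) (hB.int.const_mul _)]
    congr 1
    ext x
    simp only [_root_.lap]
    have h1 : π ^ 2 + x ^ 2 ≠ 0 := by positivity
    have h2 : (2 * π) ^ 2 + x ^ 2 ≠ 0 := by positivity
    field_simp
    ring
  have e3 := Fc_lap_two_le hH.int hH.nn pi_pos τ
  have n1 := hB.nn τ
  have hp : 0 < π ^ 2 := by positivity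
  rw [e1]
  constructor
  · nlinarith
  · have : Fc (fun x => H x * _root_.lap (2 * π) x) τ ≤ 3 * Fc (fun x => H x * _root_.lap π x * _root_.lap (2 * π) x) τ := by
      rw [e2]; linarith
    nlinarith

lemma Good.Fc_one_sub {m : ℝ → ℝ} (h : Good m) {b : ℝ} (hb : 0 < b) (τ : ℝ) :
    Fc m τ - Fc (fun x => m x * _root_.lap b x) τ = (b ^ 2)⁻¹ * Fc (fun x => x ^ 2 * (m x * _root_.lap b x)) τ := by
  rw [← Fc_sub h.uni.int (h.lap hb).uni.int, ← Fc_const_mul]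
  congr 1
  ext x
  have := sq_mul_lap hb x
  field_simp
  linear_combination (-m x) * this

lemma Good.Fc_le_lap {m : ℝ → ℝ} (h : Good m) {b : ℝ} (hb : 0 < b) (τ : ℝ) :
    Fc m τ ≤ (1 + 2 * π ^ 2 / b ^ 2) * Fc (fun x => m x * _root_.lap b x) τ := by
  have h1 := h.Fc_one_sub hb τ
  have h2 := ((h.lap hb).Fc_sq τ).2
  have h3 : (b ^ 2)⁻¹ * Fc (fun x => x ^ 2 * (m x * _root_.lap b x)) τ ≤ (b ^ 2)⁻¹ * (2 * π ^ 2 * Fc (fun x => m x * _root_.lap b x) τ) := by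
    gcongr
  rw [← h1] at h3
  have : (1 + 2 * π ^ 2 / b ^ 2) * Fc (fun x => m x * _root_.lap b x) τ = Fc (fun x => m x * _root_.lap b x) τ + (b ^ 2)⁻¹ * (2 * π ^ 2 * Fc (fun x => m x * _root_.lap b x) τ) := by
    ring
  linarith

lemma Good.abs_one_sub_le {m : ℝ → ℝ} (h : Good m) {b : ℝ} (hb : 0 < b) (τ : ℝ) :
    |Fc m τ - Fc (fun x => m x * _root_.lap b x) τ| ≤ (2 * π ^ 2 / b ^ 2) * Fc (fun x => m x * _root_.lap b x) τ := by
  have h1 := h.Fc_one_sub hb τ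
  have h2 := ((h.lap hb).Fc_sq τ)
  have hn := (h.lap hb).uni.nn τ
  rw [h1, abs_mul, abs_of_pos (by positivity : 0 < (b ^ 2)⁻¹)]
  have : |Fc (fun x => x ^ 2 * (m x * _root_.lap b x)) τ| ≤ 2 * π ^ 2 * Fc (fun x => m x * _root_.lap b x) τ := by
    have : 0 < π ^ 2 := by positivity
    rw [abs_le]
    constructor <;> nlinarith
  calc (b ^ 2)⁻¹ * |Fc (fun x => x ^ 2 * (m x * _root_.lap b x)) τ| ≤ (b ^ 2)⁻¹ * (2 * π ^ 2 * Fc (fun x => m x * _root_.lap b x) τ) := by gcongr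
    _ = _ := by ring

/-- `b ≥ b₀ > π`, `q = (1 - π²/b₀²)⁻¹`. -/
lemma Good.lap_le {m : ℝ → ℝ} (h : Good m) {b q : ℝ} (hb : 0 < b) (hq : 1 ≤ q * (1 - π ^ 2 / b ^ 2)) (hq0 : 0 ≤ q) (τ : ℝ) :
    Fc (fun x => m x * _root_.lap b x) τ ≤ q * Fc m τ := by
  have h1 := h.Fc_one_sub hb τ
  have h2 := ((h.lap hb).Fc_sq τ).1
  have hn := (h.lap hb).uni.nn τ
  have h3 : (b ^ 2)⁻¹ * (-(π ^ 2 * Fc (fun x => m x * _root_.lap b x) τ)) ≤ (b ^ 2)⁻¹ * Fc (fun x => x ^ 2 * (m x * _root_.lap b x)) τ := by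
    gcongr
  rw [← h1] at h3
  have h4 : (1 - π ^ 2 / b ^ 2) * Fc (fun x => m x * _root_.lap b x) τ ≤ Fc m τ := by
    have : (1 - π ^ 2 / b ^ 2) * Fc (fun x => m x * _root_.lap b x) τ = Fc (fun x => m x * _root_.lap b x) τ + (b ^ 2)⁻¹ * (-(π ^ 2 * Fc (fun x => m x * _root_.lap b x) τ)) := by ring
    linarith
  calc Fc (fun x => m x * _root_.lap b x) τ ≤ (q * (1 - π ^ 2 / b ^ 2)) * Fc (fun x => m x * _root_.lap b x) τ := le_mul_of_one_le_left hn hq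
    _ = q * ((1 - π ^ 2 / b ^ 2) * Fc (fun x => m x * _root_.lap b x) τ) := by ring
    _ ≤ _ := by gcongr

lemma Good.prod {ι : Type*} {m : ℝ → ℝ} (h : Good m) (T : Finset ι) {b : ι → ℝ} (hb : ∀ i ∈ T, 0 < b i) :
    Good (fun x => m x * ∏ i ∈ T, _root_.lap (b i) x ^ 2) ∧
    ∀ τ, Fc m τ ≤ Real.exp (∑ i ∈ T, 4 * π ^ 2 / b i ^ 2) * Fc (fun x => m x * ∏ i ∈ T, _root_.lap (b i) x ^ 2) τ := by
  classical
  induction T using Finset.induction_on with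
  | empty => simpa using h
  | insert i T hi ih =>
    obtain ⟨g, hle⟩ := ih (fun j hj => hb j (Finset.mem_insert_of_mem hj))
    have hbi := hb i (Finset.mem_insert_self _ _)
    have e : (fun x => m x * ∏ i ∈ insert i T, _root_.lap (b i) x ^ 2) =
      fun x => (m x * ∏ i ∈ T, _root_.lap (b i) x ^ 2) * _root_.lap (b i) x * _root_.lap (b i) x := by
      ext x; rw [Finset.prod_insert hi]; ring
    rw [e]
    refine ⟨(g.lap hbi).lap hbi, fun τ => (hle τ).trans ?_⟩
    rw [Finset.sum_insert hi, add_comm, Real.exp_add, mul_assoc]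
    refine mul_le_mul_of_nonneg_left ?_ (Real.exp_pos _).le
    have h1 := g.Fc_le_lap hbi τ
    have h2 := (g.lap hbi).Fc_le_lap hbi τ
    have n2 := ((g.lap hbi).lap hbi).uni.nn τ
    have h3 : 1 + 2 * π ^ 2 / b i ^ 2 ≤ Real.exp (2 * π ^ 2 / b i ^ 2) := by
      linarith [Real.add_one_le_exp (2 * π ^ 2 / b i ^ 2)]
    have h4 : Real.exp (4 * π ^ 2 / b i ^ 2) = Real.exp (2 * π ^ 2 / b i ^ 2) * Real.exp (2 * π ^ 2 / b i ^ 2) := by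
      rw [← Real.exp_add]; congr 1; ring
    rw [h4, mul_assoc]
    refine h1.trans (mul_le_mul h3 (h2.trans (mul_le_mul_of_nonneg_right h3 n2)) ((g.lap hbi).uni.nn τ) (Real.exp_pos _).le)

/-- gaussian multiplication preserves nonnegativity of the transform -/
lemma Fc_gauss_mul_nonneg {m : ℝ → ℝ} (h : Uni m) {s : ℝ} (hs : 0 < s) (τ : ℝ) :
    0 ≤ Fc (fun x => m x * Real.exp (-s * x ^ 2)) τ := by
  have hU : ∀ N : ℕ, Uni (fun x => m x * (lap (Real.sqrt ((N + 1 : ℕ) / s)) x) ^ (N + 1)) := fun N =>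
    h.lap_pow (Real.sqrt_pos.mpr (by positivity)) _
  have ht := Fc_tendsto (m := fun N x => m x * (lap (Real.sqrt ((N + 1 : ℕ) / s)) x) ^ (N + 1))
    (m' := fun x => m x * Real.exp (-s * x ^ 2)) (bd := fun x => |m x|)
    (Eventually.of_forall fun N => (hU N).int) h.int.abs
    (Eventually.of_forall fun N x => ?_) (Eventually.of_forall fun x => ?_) τ
  · exact ge_of_tendsto' ht fun N => (hU N).nn τ
  · have hb : 0 < Real.sqrt ((N + 1 : ℕ) / s) := Real.sqrt_pos.mpr (by positivity)
    rw [abs_mul, abs_of_nonneg (pow_nonneg (lap_pos hb x).le _)]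
    exact mul_le_of_le_one_right (abs_nonneg _) (pow_le_one₀ (lap_pos hb x).le (lap_le_one hb x))
  · refine Tendsto.const_mul _ ?_
    have h1 := ((Real.tendsto_one_add_div_pow_exp (s * x ^ 2)).comp (tendsto_add_atTop_nat 1)).inv₀ (Real.exp_pos _).ne'
    rw [← Real.exp_neg] at h1
    rw [show -s * x ^ 2 = -(s * x ^ 2) by ring]
    refine h1.congr fun N => ?_
    simp only [Function.comp]
    rw [← inv_pow]
    congr 1
    unfold lap
    rw [Real.sq_sqrt (by positivity)]
    have : (0:ℝ) < ((N + 1 : ℕ) : ℝ) := by positivity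
    field_simp

lemma pow_exp_integrable (n : ℕ) {r : ℝ} (hr : 0 < r) :
    IntegrableOn (fun s : ℝ => s ^ n * Real.exp (-(r * s))) (Set.Ioi 0) := by
  have := integrableOn_rpow_mul_exp_neg_mul_rpow (p := 1) (s := (n : ℝ)) (b := r)
    (by have : (0:ℝ) ≤ n := Nat.cast_nonneg n
        linarith) one_pos hr
  refine this.congr_fun (fun s hs => ?_) measurableSet_Ioi
  simp

lemma pow_exp_integral (n : ℕ) {r : ℝ} (hr : 0 < r) :
    ∫ s in Set.Ioi (0 : ℝ), s ^ n * Real.exp (-(r * s)) = n.factorial * (r⁻¹) ^ (n + 1) := by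
  have := Real.integral_rpow_mul_exp_neg_mul_Ioi (a := n + 1) (r := r) (by positivity) hr
  rw [Real.Gamma_nat_eq_factorial] at this
  rw [mul_comm, ← one_div]
  have e : (1 / r) ^ (n + 1) = (1 / r) ^ ((n : ℝ) + 1) := by
    rw [← Real.rpow_natCast]; push_cast; rfl
  rw [e, ← this]
  refine setIntegral_congr_fun measurableSet_Ioi fun s hs => ?_
  simp

lemma Fc_mix_nonneg {H Q : ℝ → ℝ} (h : Uni H) (hQ : ∀ s, 0 < s → 0 ≤ Q s)
    (hQi : IntegrableOn (fun s => Q s * Real.exp (-s)) (Set.Ioi 0)) (τ : ℝ) :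
    0 ≤ Fc (fun x => H x * ∫ s in Set.Ioi (0 : ℝ), Q s * Real.exp (-((1 + x ^ 2 / π ^ 2) * s))) τ := by
  have e : Fc (fun x => H x * ∫ s in Set.Ioi (0 : ℝ), Q s * Real.exp (-((1 + x ^ 2 / π ^ 2) * s))) τ =
      ∫ s in Set.Ioi (0 : ℝ), (Q s * Real.exp (-s)) * Fc (fun x => H x * Real.exp (-(s / π ^ 2) * x ^ 2)) τ := by
    unfold Fc
    have e1 : ∀ x : ℝ, (H x * ∫ s in Set.Ioi (0 : ℝ), Q s * Real.exp (-((1 + x ^ 2 / π ^ 2) * s))) * Real.cos (x * τ) =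
      ∫ s in Set.Ioi (0 : ℝ), (Q s * Real.exp (-s)) * (H x * Real.exp (-(s / π ^ 2) * x ^ 2) * Real.cos (x * τ)) := by
      intro x
      rw [← integral_const_mul, ← integral_mul_const]
      congr 1
      ext s
      have : Real.exp (-((1 + x ^ 2 / π ^ 2) * s)) = Real.exp (-s) * Real.exp (-(s / π ^ 2) * x ^ 2) := by
        rw [← Real.exp_add]; congr 1; ring
      rw [this]; ring
    simp_rw [e1]
    rw [integral_integral_swap]
    · congr 1
      ext s
      rw [integral_const_mul]
    · have h1 := h.int.mul_prod hQi
      have h2 := h1.mul_bdd (c := 1) (g := fun p : ℝ × ℝ => Real.exp (-(|p.2| / π ^ 2) * p.1 ^ 2) * Real.cos (p.1 * τ))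
        (by fun_prop) (Eventually.of_forall fun p => ?_)
      · refine h2.congr ?_
        have : ∀ᵐ p ∂((volume : Measure ℝ).prod ((volume : Measure ℝ).restrict (Set.Ioi 0))), 0 < p.2 := by
          have h3 : ∀ᵐ s ∂((volume : Measure ℝ).restrict (Set.Ioi 0)), 0 < s := by
            filter_upwards [ae_restrict_mem measurableSet_Ioi] with s hs using hs
          exact Measure.quasiMeasurePreserving_snd.ae h3
        filter_upwards [this] with p hp
        simp [Function.uncurry, abs_of_pos hp]
        ring
      · rw [norm_mul, Real.norm_eq_abs, Real.norm_eq_abs, abs_of_pos (Real.exp_pos _)]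
        have : Real.exp (-(|p.2| / π ^ 2) * p.1 ^ 2) ≤ 1 := by
          rw [Real.exp_le_one_iff]
          have : 0 ≤ |p.2| / π ^ 2 * p.1 ^ 2 := by positivity
          linarith
        exact mul_le_one₀ this (abs_nonneg _) (Real.abs_cos_le_one _)
  rw [e]
  refine setIntegral_nonneg measurableSet_Ioi fun s hs => ?_
  have hs : 0 < s := hs
  exact mul_nonneg (mul_nonneg (hQ s hs) (Real.exp_pos _).le) (Fc_gauss_mul_nonneg h (by positivity) τ)

lemma quad_pow_nonneg {H : ℝ → ℝ} (h : Uni H) (n : ℕ) (c τ : ℝ) :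
    0 ≤ Fc (fun x => H x * lap π x ^ (n + 1) * (c ^ 2 - 2 * c * lap π x + 2 * lap π x ^ 2)) τ := by
  have key := Fc_mix_nonneg (Q := fun s => c ^ 2 / n.factorial * s ^ n - 2 * c / (n + 1).factorial * s ^ (n + 1)
    + 2 / (n + 2).factorial * s ^ (n + 2)) h ?_ ?_ τ
  · refine key.trans_eq ?_
    congr 1
    ext x
    have hr : 0 < 1 + x ^ 2 / π ^ 2 := by positivity
    have hl : (1 + x ^ 2 / π ^ 2)⁻¹ = lap π x := by
      unfold lap; field_simp
    have i0 := (pow_exp_integrable n hr).const_mul (c ^ 2 / n.factorial)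
    have i1 := (pow_exp_integrable (n + 1) hr).const_mul (2 * c / (n + 1).factorial)
    have i2 := (pow_exp_integrable (n + 2) hr).const_mul (2 / (n + 2).factorial)
    have i01 : Integrable (fun s : ℝ => c ^ 2 / n.factorial * (s ^ n * Real.exp (-((1 + x ^ 2 / π ^ 2) * s)))
          - 2 * c / (n + 1).factorial * (s ^ (n + 1) * Real.exp (-((1 + x ^ 2 / π ^ 2) * s)))) (volume.restrict (Set.Ioi 0)) := i0.sub i1
    rw [mul_assoc]
    congr 1
    calc _ = ∫ s in Set.Ioi (0 : ℝ), ((c ^ 2 / n.factorial * (s ^ n * Real.exp (-((1 + x ^ 2 / π ^ 2) * s)))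
          - 2 * c / (n + 1).factorial * (s ^ (n + 1) * Real.exp (-((1 + x ^ 2 / π ^ 2) * s))))
          + 2 / (n + 2).factorial * (s ^ (n + 2) * Real.exp (-((1 + x ^ 2 / π ^ 2) * s)))) := by
          congr 1; ext s; ring
      _ = _ := by
        rw [integral_add i01 i2, integral_sub i0 i1, integral_const_mul, integral_const_mul, integral_const_mul,
          pow_exp_integral _ hr, pow_exp_integral _ hr, pow_exp_integral _ hr, hl]
        have f0 : ((n.factorial : ℕ) : ℝ) ≠ 0 := by positivity
        have f1 : (((n + 1).factorial : ℕ) : ℝ) ≠ 0 := by positivity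
        have f2 : (((n + 2).factorial : ℕ) : ℝ) ≠ 0 := by positivity
        field_simp
        ring
  · intro s hs
    have f0 : (0 : ℝ) < ((n.factorial : ℕ) : ℝ) := by positivity
    have f1 : (((n + 1).factorial : ℕ) : ℝ) = (n + 1) * n.factorial := by push_cast [Nat.factorial_succ]; ring
    have f2 : (((n + 2).factorial : ℕ) : ℝ) = (n + 2) * ((n + 1) * n.factorial) := by
      push_cast [Nat.factorial_succ]; ring
    rw [f1, f2]
    have hn : (0 : ℝ) ≤ n := Nat.cast_nonneg n
    have : c ^ 2 / n.factorial * s ^ n - 2 * c / ((n + 1) * n.factorial) * s ^ (n + 1)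
      + 2 / ((n + 2) * ((n + 1) * n.factorial)) * s ^ (n + 2) =
      s ^ n / n.factorial * ((c - s / (n + 1)) ^ 2 + n / ((n + 2) * (n + 1) ^ 2) * s ^ 2) := by
      field_simp
      ring
    rw [this]
    positivity
  · have i0 := (pow_exp_integrable n one_pos).const_mul (c ^ 2 / n.factorial)
    have i1 := (pow_exp_integrable (n + 1) one_pos).const_mul (2 * c / (n + 1).factorial)
    have i2 := (pow_exp_integrable (n + 2) one_pos).const_mul (2 / (n + 2).factorial)
    refine ((i0.sub i1).add i2).congr (Eventually.of_forall fun s => ?_)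
    simp only [Pi.add_apply, Pi.sub_apply, one_mul]
    ring

lemma quad_exp_nonneg {H : ℝ → ℝ} (h : Uni H) (n : ℕ) {w : ℝ} (hw : 0 ≤ w) (c τ : ℝ) :
    0 ≤ Fc (fun x => H x * lap π x ^ (n + 1) * Real.exp (w * lap π x) * (c ^ 2 - 2 * c * lap π x + 2 * lap π x ^ 2)) τ := by
  have hsum : ∀ N : ℕ, ∀ x, H x * lap π x ^ (n + 1) * (1 + w * lap π x / N) ^ N * (c ^ 2 - 2 * c * lap π x + 2 * lap π x ^ 2) =
      ∑ j ∈ Finset.range (N + 1), ((w / N) ^ j * (N.choose j)) * (H x * lap π x ^ (n + j + 1) * (c ^ 2 - 2 * c * lap π x + 2 * lap π x ^ 2)) := by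
    intro N x
    rw [add_comm 1 (w * lap π x / N), add_pow, Finset.mul_sum, Finset.sum_mul]
    refine Finset.sum_congr rfl fun j _ => ?_
    rw [one_pow, show w * lap π x / N = w / N * lap π x by ring, mul_pow]
    ring
  have hQb : ∀ x, |c ^ 2 - 2 * c * lap π x + 2 * lap π x ^ 2| ≤ c ^ 2 + 2 * |c| + 2 := by
    intro x
    have h1 := lap_pos pi_pos x
    have h2 := lap_le_one pi_pos x
    have h3 : |2 * c * lap π x| ≤ 2 * |c| := by
      rw [abs_mul, abs_mul, abs_of_pos h1, abs_two]
      exact mul_le_of_le_one_right (by positivity) h2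
    have h4 : lap π x ^ 2 ≤ 1 := pow_le_one₀ h1.le h2
    have h5 : 0 ≤ lap π x ^ 2 := by positivity
    rw [abs_le] at h3 ⊢
    constructor <;> nlinarith [sq_nonneg c, abs_nonneg c]
  have hcont := lap_cont pi_pos
  have hI : ∀ j : ℕ, Integrable (fun x => H x * lap π x ^ (n + j + 1) * (c ^ 2 - 2 * c * lap π x + 2 * lap π x ^ 2)) := by
    intro j
    refine (h.lap_pow pi_pos _).int.mul_bdd (c := c ^ 2 + 2 * |c| + 2) (by fun_prop) (Eventually.of_forall hQb)
  have hIN : ∀ N : ℕ, Integrable (fun x => H x * lap π x ^ (n + 1) * (1 + w * lap π x / N) ^ N * (c ^ 2 - 2 * c * lap π x + 2 * lap π x ^ 2)) := by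
    intro N
    simp_rw [hsum N]
    exact integrable_finsetSum _ fun j _ => (hI j).const_mul _
  have ht := Fc_tendsto (m := fun N x => H x * lap π x ^ (n + 1) * (1 + w * lap π x / N) ^ N * (c ^ 2 - 2 * c * lap π x + 2 * lap π x ^ 2))
    (m' := fun x => H x * lap π x ^ (n + 1) * Real.exp (w * lap π x) * (c ^ 2 - 2 * c * lap π x + 2 * lap π x ^ 2))
    (bd := fun x => |H x| * (Real.exp w * (c ^ 2 + 2 * |c| + 2)))
    (Eventually.of_forall hIN) (h.int.abs.mul_const _) (Eventually.of_forall fun N x => ?_) (Eventually.of_forall fun x => ?_) τ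
  · refine ge_of_tendsto' ht fun N => ?_
    have : Fc (fun x => H x * lap π x ^ (n + 1) * (1 + w * lap π x / N) ^ N * (c ^ 2 - 2 * c * lap π x + 2 * lap π x ^ 2)) τ
      = ∑ j ∈ Finset.range (N + 1), ((w / N) ^ j * (N.choose j)) * Fc (fun x => (H x * lap π x ^ (n + j + 1) * (c ^ 2 - 2 * c * lap π x + 2 * lap π x ^ 2))) τ := by
      simp_rw [hsum N]
      rw [Fc_sum _ (fun j _ => (hI j).const_mul _)]
      simp_rw [Fc_const_mul]
    rw [this]
    exact Finset.sum_nonneg fun j _ => mul_nonneg (by positivity) (quad_pow_nonneg h (n + j) c τ)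
  · have h1 := lap_pos pi_pos x
    have h2 := lap_le_one pi_pos x
    have h3 : 0 ≤ w * lap π x := by positivity
    rw [abs_mul, abs_mul, abs_mul, abs_of_nonneg (pow_nonneg h1.le _), abs_of_nonneg (by positivity : 0 ≤ (1 + w * lap π x / N) ^ N)]
    have h5 : (1 + w * lap π x / N) ^ N ≤ Real.exp w :=
      (one_add_div_pow_le_exp h3 N).trans (Real.exp_le_exp.mpr (mul_le_of_le_one_right hw h2))
    have h6 : lap π x ^ (n + 1) ≤ 1 := pow_le_one₀ h1.le h2
    calc |H x| * lap π x ^ (n + 1) * (1 + w * lap π x / N) ^ N * |c ^ 2 - 2 * c * lap π x + 2 * lap π x ^ 2|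
        ≤ |H x| * 1 * Real.exp w * (c ^ 2 + 2 * |c| + 2) := by
          gcongr
          exact hQb x
      _ = _ := by ring
  · exact ((Real.tendsto_one_add_div_pow_exp _).const_mul _).mul_const _

/-- I4 -/
lemma cauchy_lap {H : ℝ → ℝ} (h : Uni H) (n : ℕ) {w : ℝ} (hw : 0 ≤ w) (τ : ℝ) {W : ℝ → ℝ}
    (hW : W = fun x => H x * lap π x ^ (n + 1) * Real.exp (w * lap π x)) :
    Fc (fun x => W x * lap π x) τ ^ 2 ≤ 2 * Fc W τ * Fc (fun x => W x * lap π x ^ 2) τ := by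
  have hU : Uni W := by rw [hW]; exact (h.lap_pow pi_pos _).exp_lap pi_pos hw
  have hU1 := hU.lap pi_pos
  have hU2 := hU.lap_pow pi_pos 2
  have key : ∀ c : ℝ, 0 ≤ c ^ 2 * Fc W τ - 2 * c * Fc (fun x => W x * lap π x) τ + 2 * Fc (fun x => W x * lap π x ^ 2) τ := by
    intro c
    refine (quad_exp_nonneg h n hw c τ).trans_eq ?_
    have hs : Integrable (fun x => c ^ 2 * W x - 2 * c * (W x * lap π x)) :=
      (hU.int.const_mul _).sub (hU1.int.const_mul _)
    rw [← Fc_const_mul, ← Fc_const_mul, ← Fc_const_mul, ← Fc_sub (hU.int.const_mul _) (hU1.int.const_mul _),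
      ← Fc_add hs (hU2.int.const_mul _)]
    congr 1
    ext x
    rw [hW]
    ring
  set A := Fc W τ
  set B := Fc (fun x => W x * lap π x) τ
  set D := Fc (fun x => W x * lap π x ^ 2) τ
  have hA : 0 ≤ A := hU.nn τ
  have hD : 0 ≤ D := hU2.nn τ
  have hB : 0 ≤ B := hU1.nn τ
  rcases hA.eq_or_lt with h0 | h0
  · rw [← h0] at key ⊢
    by_contra hc
    have hB' : 0 < B := lt_of_le_of_ne hB (by rintro h; rw [← h] at hc; simp at hc)
    have := key ((D + 1) / B)
    have e : 2 * ((D + 1) / B) * B = 2 * (D + 1) := by field_simp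
    rw [e] at this
    linarith
  · have := key (B / A)
    have e : (B / A) ^ 2 * A - 2 * (B / A) * B + 2 * D = 2 * D - B ^ 2 / A := by field_simp; ring
    rw [e, sub_nonneg, div_le_iff₀ h0] at this
    linarith

/-- Finite product weight. -/
def Wt {ι : Type*} (ε : ℝ) (s : Finset ι) (b w : ι → ℝ) (n : ι → ℕ) (x : ℝ) : ℝ :=
  Real.exp (-ε * x ^ 2) * ∏ i ∈ s, (lap (b i) x ^ n i * Real.exp (w i * lap (b i) x))

section
variable {ι : Type*} {ε : ℝ} {b w : ι → ℝ} {n : ι → ℕ}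

lemma Uni_Wt (hε : 0 < ε) (s : Finset ι) (hb : ∀ i, 0 < b i) (hw : ∀ i, 0 ≤ w i) :
    Uni (Wt ε s b w n) := by
  classical
  induction s using Finset.induction_on with
  | empty =>
    have e : Wt ε ∅ b w n = fun x => Real.exp (-ε * x ^ 2) := by ext x; simp [Wt]
    rw [e]; exact Uni_gauss hε
  | insert i s hi ih =>
    have := (ih.lap_pow (hb i) (n i)).exp_lap (hb i) (hw i)
    convert this using 1
    ext x
    simp only [Wt]
    rw [Finset.prod_insert hi]
    ring

lemma Wt_erase [DecidableEq ι] {s : Finset ι} {i : ι} (hi : i ∈ s) (x : ℝ) :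
    Wt ε s b w n x = Wt ε (s.erase i) b w n x * lap (b i) x ^ n i * Real.exp (w i * lap (b i) x) := by
  simp only [Wt]
  rw [← Finset.mul_prod_erase s _ hi]
  ring

lemma Wt_cauchy (hε : 0 < ε) {s : Finset ι} (hb : ∀ i, 0 < b i) (hw : ∀ i, 0 ≤ w i)
    {i : ι} (hi : i ∈ s) (hbi : b i = π) (hn : 0 < n i) (τ : ℝ) :
    Fc (fun x => Wt ε s b w n x * lap π x) τ ^ 2 ≤ 2 * Fc (Wt ε s b w n) τ * Fc (fun x => Wt ε s b w n x * lap π x ^ 2) τ := by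
  classical
  obtain ⟨m, hm⟩ := Nat.exists_eq_succ_of_ne_zero hn.ne'
  refine cauchy_lap (Uni_Wt (n := n) hε (s.erase i) hb hw) m (hw i) τ ?_
  ext x
  rw [Wt_erase hi, hbi, hm]

lemma Good_Wt (hε : 0 < ε) {s : Finset ι} (hb : ∀ i, 0 < b i) (hw : ∀ i, 0 ≤ w i)
    {i i' : ι} (hi : i ∈ s) (hi' : i' ∈ s) (hne : i' ≠ i) (hbi : b i = π) (hbi' : b i' = 2 * π) (hn : 0 < n i) (hn' : 0 < n i') :
    Good (Wt ε s b w n) := by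
  classical
  obtain ⟨m, hm⟩ := Nat.exists_eq_succ_of_ne_zero hn.ne'
  obtain ⟨m', hm'⟩ := Nat.exists_eq_succ_of_ne_zero hn'.ne'
  have h0 := Uni_Wt (n := n) hε ((s.erase i).erase i') hb hw
  have h1 := (h0.lap_pow pi_pos m).exp_lap pi_pos (hw i)
  have h2 := (h1.lap_pow two_pi_pos' m').exp_lap two_pi_pos' (hw i')
  refine ⟨_, h2, ?_⟩
  ext x
  rw [Wt_erase hi, Wt_erase (Finset.mem_erase.mpr ⟨hne, hi'⟩), hbi, hbi', hm, hm', Nat.succ_eq_add_one, Nat.succ_eq_add_one]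
  ring

lemma lap_hasDerivAt {b : ℝ} (hb : 0 < b) (x : ℝ) :
    HasDerivAt (lap b) (-(2 * x / b ^ 2) * lap b x ^ 2) x := by
  unfold lap
  have h1 : HasDerivAt (fun x : ℝ => b ^ 2 + x ^ 2) (2 * x) x := by
    simpa using (hasDerivAt_pow 2 x).const_add (b ^ 2)
  have hne : b ^ 2 + x ^ 2 ≠ 0 := by positivity
  refine ((hasDerivAt_const x (b ^ 2)).div h1 hne).congr_deriv ?_
  field_simp
  ring

lemma Wt_hasDerivAt (s : Finset ι) (hb : ∀ i, 0 < b i) (x : ℝ) :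
    HasDerivAt (Wt ε s b w n) (-(x * (2 * ε + ∑ i ∈ s, (2 * n i / b i ^ 2 * lap (b i) x + 2 * w i / b i ^ 2 * lap (b i) x ^ 2)) * Wt ε s b w n x)) x := by
  classical
  induction s using Finset.induction_on with
  | empty =>
    have h1 : HasDerivAt (fun x : ℝ => -ε * x ^ 2) (-ε * (2 * x)) x := by
      simpa using (hasDerivAt_pow 2 x).const_mul (-ε)
    have e : Wt ε ∅ b w n = fun x => Real.exp (-ε * x ^ 2) := by ext x; simp [Wt]
    rw [e]
    refine h1.exp.congr_deriv ?_
    simp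
    ring
  | insert i s hi ih =>
    have e : Wt ε (insert i s) b w n = fun x => Wt ε s b w n x * (lap (b i) x ^ n i * Real.exp (w i * lap (b i) x)) := by
      ext x
      simp only [Wt]
      rw [Finset.prod_insert hi]
      ring
    have hl := lap_hasDerivAt (hb i) x
    have h1 := (hl.pow (n i)).mul (hl.const_mul (w i)).exp
    rw [e, Finset.sum_insert hi]
    refine (ih.mul h1).congr_deriv ?_
    rcases Nat.eq_zero_or_pos (n i) with h0 | h0
    · simp [h0]; ring
    · obtain ⟨m, hm⟩ := Nat.exists_eq_succ_of_ne_zero h0.ne'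
      rw [hm]
      simp only [Nat.succ_eq_add_one, Nat.add_sub_cancel, Pi.pow_apply, Pi.mul_apply]
      push_cast
      ring

lemma Wt_identity (s : Finset ι) (hb : ∀ i, 0 < b i) (hG : Good (Wt ε s b w n)) (τ : ℝ) :
    τ * Fc (Wt ε s b w n) τ = 2 * ε * Fs (Wt ε s b w n) τ +
      ∑ i ∈ s, (2 * n i / b i ^ 2 * Fs (fun x => Wt ε s b w n x * lap (b i) x) τ +
        2 * w i / b i ^ 2 * Fs (fun x => Wt ε s b w n x * lap (b i) x * lap (b i) x) τ) := by
  set W := Wt ε s b w n with hW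
  have hd : ∀ x, HasDerivAt (fun x => W x * Real.sin (x * τ))
      (τ * (W x * Real.cos (x * τ)) - (2 * ε * (x * W x * Real.sin (x * τ)) +
        ∑ i ∈ s, (2 * n i / b i ^ 2 * (x * (W x * lap (b i) x) * Real.sin (x * τ)) +
        2 * w i / b i ^ 2 * (x * (W x * lap (b i) x * lap (b i) x) * Real.sin (x * τ))))) x := by
    intro x
    have h1 : HasDerivAt (fun x : ℝ => x * τ) τ x := by
      simpa using (hasDerivAt_id x).mul_const τ
    refine ((Wt_hasDerivAt s hb x).mul h1.sin).congr_deriv ?_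
    rw [← hW]
    have : ∑ i ∈ s, (2 * n i / b i ^ 2 * (x * (W x * lap (b i) x) * Real.sin (x * τ)) +
        2 * w i / b i ^ 2 * (x * (W x * lap (b i) x * lap (b i) x) * Real.sin (x * τ))) =
        (∑ i ∈ s, (2 * n i / b i ^ 2 * lap (b i) x + 2 * w i / b i ^ 2 * lap (b i) x ^ 2)) * (x * W x * Real.sin (x * τ)) := by
      rw [Finset.sum_mul]
      exact Finset.sum_congr rfl fun i _ => by ring
    rw [this]
    ring
  have i1 := (Fc_integrable hG.uni.int τ).const_mul τ
  have i2 := (Fs_integrable hG.int_x τ).const_mul (2 * ε)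
  have i3 := fun i => (Fs_integrable (hG.lap (hb i)).int_x τ).const_mul (2 * n i / b i ^ 2)
  have i4 := fun i => (Fs_integrable ((hG.lap (hb i)).lap (hb i)).int_x τ).const_mul (2 * w i / b i ^ 2)
  have i34 : ∀ i ∈ s, Integrable (fun x => 2 * n i / b i ^ 2 * (x * (W x * lap (b i) x) * Real.sin (x * τ)) +
        2 * w i / b i ^ 2 * (x * (W x * lap (b i) x * lap (b i) x) * Real.sin (x * τ))) := fun i _ => (i3 i).add (i4 i)
  have i5 := integrable_finsetSum s i34
  have i6 : Integrable (fun x => 2 * ε * (x * W x * Real.sin (x * τ)) +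
        ∑ i ∈ s, (2 * n i / b i ^ 2 * (x * (W x * lap (b i) x) * Real.sin (x * τ)) +
        2 * w i / b i ^ 2 * (x * (W x * lap (b i) x * lap (b i) x) * Real.sin (x * τ)))) := i2.add i5
  have hsin : Integrable (fun x => W x * Real.sin (x * τ)) := by
    refine hG.uni.int.mul_bdd (c := 1) (by fun_prop) ?_
    exact Eventually.of_forall fun x => by simpa using Real.abs_sin_le_one _
  have h0 := integral_eq_zero_of_hasDerivAt_of_integrable hd (i1.sub i6) hsin
  rw [integral_sub i1 i6, integral_add i2 i5, integral_finsetSum s i34, integral_const_mul, integral_const_mul] at h0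
  have : ∀ i, ∫ x, (2 * n i / b i ^ 2 * (x * (W x * lap (b i) x) * Real.sin (x * τ)) +
        2 * w i / b i ^ 2 * (x * (W x * lap (b i) x * lap (b i) x) * Real.sin (x * τ))) =
      (2 * n i / b i ^ 2 * Fs (fun x => W x * lap (b i) x) τ +
        2 * w i / b i ^ 2 * Fs (fun x => W x * lap (b i) x * lap (b i) x) τ) := by
    intro i
    rw [integral_add (i3 i) (i4 i), integral_const_mul, integral_const_mul]
    rfl
  simp_rw [this] at h0
  simp only [Fc, Fs] at h0 ⊢
  linarith

/-- I3 -/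
lemma Wt_I3 (hε : 0 < ε) {s : Finset ι} (hb : ∀ i, 0 < b i) (hw : ∀ i, 0 ≤ w i) (hG : Good (Wt ε s b w n))
    {i : ι} (hi : i ∈ s) (hbi : b i = π) {τ : ℝ} (hτ : 0 ≤ τ) :
    2 * w i * Fc (fun x => Wt ε s b w n x * lap π x ^ 2) τ ≤
      2 * w i * Fc (fun x => Wt ε s b w n x * lap π x) τ + π * (τ * Fc (Wt ε s b w n) τ) := by
  have hid := Wt_identity s hb hG τ
  set W := Wt ε s b w n
  have h1 : (2 * n i / b i ^ 2 * Fs (fun x => W x * lap (b i) x) τ +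
        2 * w i / b i ^ 2 * Fs (fun x => W x * lap (b i) x * lap (b i) x) τ) ≤ τ * Fc W τ := by
    rw [hid]
    have := Finset.single_le_sum (f := fun i => (2 * n i / b i ^ 2 * Fs (fun x => W x * lap (b i) x) τ +
        2 * w i / b i ^ 2 * Fs (fun x => W x * lap (b i) x * lap (b i) x) τ)) (s := s) (fun j _ => ?_) hi
    · have h2 := hG.Fs_nonneg hτ
      have : 0 ≤ 2 * ε * Fs W τ := by positivity
      linarith
    · have h2 := (hG.lap (hb j)).Fs_nonneg hτ
      have h3 := ((hG.lap (hb j)).lap (hb j)).Fs_nonneg hτ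
      have h4 := hw j
      positivity
  have h2 := (hG.lap (hb i)).Fs_nonneg hτ
  have h2' : 0 ≤ 2 * n i / b i ^ 2 * Fs (fun x => W x * lap (b i) x) τ := by positivity
  rw [hbi] at h1 h2'
  have h3 := (hG.lap pi_pos).uni.Fs_lap_ge pi_pos hτ
  have e : (fun x => W x * lap π x ^ 2) = fun x => W x * lap π x * lap π x := by ext x; ring
  rw [e]
  have h4 : 2 * w i / π ^ 2 * (π * (Fc (fun x => W x * lap π x * lap π x) τ - Fc (fun x => W x * lap π x) τ)) ≤
      2 * w i / π ^ 2 * Fs (fun x => W x * lap π x * lap π x) τ := by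
    have := hw i
    gcongr
  have h5 : 2 * w i / π ^ 2 * (π * (Fc (fun x => W x * lap π x * lap π x) τ - Fc (fun x => W x * lap π x) τ)) ≤ τ * Fc W τ := by
    linarith
  have h6 := mul_le_mul_of_nonneg_left h5 pi_pos.le
  have h7 : π * (2 * w i / π ^ 2 * (π * (Fc (fun x => W x * lap π x * lap π x) τ - Fc (fun x => W x * lap π x) τ))) =
    2 * w i * (Fc (fun x => W x * lap π x * lap π x) τ - Fc (fun x => W x * lap π x) τ) := by
    field_simp
  rw [h7] at h6
  linarith

/-- I5 -/
lemma Wt_I5 (hε1 : ε ≤ 1) {s : Finset ι} (hb : ∀ i, 0 < b i) (hw : ∀ i, 0 ≤ w i) (hG : Good (Wt ε s b w n))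
    {i : ι} (hi : i ∈ s) (hbi : b i = π) {τ q D N R : ℝ} (hτ : 0 ≤ τ) (hq0 : 0 ≤ q) 
    (hN : ∀ i, (n i : ℝ) ≤ N) (hR : ∀ i, w i ≤ R)
    (hq : ∀ j ∈ s, j ≠ i → 1 ≤ q * (1 - π ^ 2 / b j ^ 2))
    (hD : ∀ T ⊆ s, (i ∉ T) → ∑ j ∈ T, 1 / b j ^ 2 ≤ D) :
    τ * Fc (Wt ε s b w n) τ ≤ (2 * π + (2 * N * π * q + 2 * R * π * q ^ 2) * D) * Fc (Wt ε s b w n) τ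
      + 2 * N / π * Fc (fun x => Wt ε s b w n x * lap π x) τ 
      + 2 * w i / π * Fc (fun x => Wt ε s b w n x * lap π x ^ 2) τ := by
  classical
  rw [Wt_identity s hb hG τ]
  set W := Wt ε s b w n
  have hN0 : 0 ≤ N := (Nat.cast_nonneg _).trans (hN i)
  have hR0 : 0 ≤ R := (hw i).trans (hR i)
  have n0 := hG.uni.nn τ
  have t1 : 2 * ε * Fs W τ ≤ 2 * π * Fc W τ := by
    have h1 := (le_abs_self _).trans (hG.Fs_le τ)
    have h2 := hG.Fs_nonneg hτ
    nlinarith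
  rw [← Finset.add_sum_erase s _ hi, hbi]
  have t2 : 2 * n i / π ^ 2 * Fs (fun x => W x * lap π x) τ ≤ 2 * N / π * Fc (fun x => W x * lap π x) τ := by
    have h1 := (le_abs_self _).trans ((hG.lap pi_pos).Fs_le τ)
    have h3 := (hG.lap pi_pos).uni.nn τ
    calc 2 * n i / π ^ 2 * Fs (fun x => W x * lap π x) τ ≤ 2 * n i / π ^ 2 * (π * Fc (fun x => W x * lap π x) τ) := by gcongr
      _ = 2 * n i / π * Fc (fun x => W x * lap π x) τ := by field_simp
      _ ≤ _ := by gcongr; exact hN i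
  have e : (fun x => W x * lap π x ^ 2) = fun x => W x * lap π x * lap π x := by ext x; ring
  rw [e]
  have t3 : 2 * w i / π ^ 2 * Fs (fun x => W x * lap π x * lap π x) τ ≤ 2 * w i / π * Fc (fun x => W x * lap π x * lap π x) τ := by
    have h1 := (le_abs_self _).trans (((hG.lap pi_pos).lap pi_pos).Fs_le τ)
    have := hw i
    calc 2 * w i / π ^ 2 * Fs (fun x => W x * lap π x * lap π x) τ ≤ 2 * w i / π ^ 2 * (π * Fc (fun x => W x * lap π x * lap π x) τ) := by gcongr
      _ = _ := by field_simp
  have t4 : ∑ j ∈ s.erase i, (2 * n j / b j ^ 2 * Fs (fun x => W x * lap (b j) x) τ +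
        2 * w j / b j ^ 2 * Fs (fun x => W x * lap (b j) x * lap (b j) x) τ) ≤
      ∑ j ∈ s.erase i, ((2 * N * π * q + 2 * R * π * q ^ 2) * Fc W τ) * (1 / b j ^ 2) := by
    refine Finset.sum_le_sum fun j hj => ?_
    obtain ⟨hji, hjs⟩ := Finset.mem_erase.mp hj
    have hqj := hq j hjs hji
    have g1 := hG.lap (hb j)
    have g2 := g1.lap (hb j)
    have a1 := (le_abs_self _).trans (g1.Fs_le τ)
    have a2 := (le_abs_self _).trans (g2.Fs_le τ)
    have l1 := hG.lap_le (hb j) hqj hq0 τ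
    have l2 := g1.lap_le (hb j) hqj hq0 τ
    have b1 : Fs (fun x => W x * lap (b j) x) τ ≤ π * (q * Fc W τ) := a1.trans (by gcongr)
    have b2 : Fs (fun x => W x * lap (b j) x * lap (b j) x) τ ≤ π * (q * (q * Fc W τ)) := a2.trans (by
      refine mul_le_mul_of_nonneg_left ?_ pi_pos.le
      exact l2.trans (by gcongr))
    have hwj := hw j
    have hbj := hb j
    calc _ ≤ 2 * n j / b j ^ 2 * (π * (q * Fc W τ)) + 2 * w j / b j ^ 2 * (π * (q * (q * Fc W τ))) := by gcongr
      _ ≤ 2 * N / b j ^ 2 * (π * (q * Fc W τ)) + 2 * R / b j ^ 2 * (π * (q * (q * Fc W τ))) := by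
        gcongr
        · exact hN j
        · exact hR j
      _ = _ := by ring
  rw [← Finset.mul_sum] at t4
  have t5 : ((2 * N * π * q + 2 * R * π * q ^ 2) * Fc W τ) * ∑ j ∈ s.erase i, (1 / b j ^ 2) ≤
      ((2 * N * π * q + 2 * R * π * q ^ 2) * Fc W τ) * D := by
    have := hD (s.erase i) (Finset.erase_subset _ _) (Finset.notMem_erase _ _)
    gcongr
  nlinarith

lemma Good.sum_one_sub {m : ℝ → ℝ} (hm : Good m) (T : Finset ι) (hb : ∀ i, 0 < b i) {q D : ℝ} (hq0 : 0 ≤ q)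
    (hq : ∀ j ∈ T, 1 ≤ q * (1 - π ^ 2 / b j ^ 2)) (hD : ∑ j ∈ T, 1 / b j ^ 2 ≤ D) (τ : ℝ) :
    |Fc (fun x => m x * ∑ i ∈ T, (1 - _root_.lap (b i) x)) τ| ≤ 2 * π ^ 2 * q * D * Fc m τ := by
  have hi : ∀ i, Integrable (fun x => m x - m x * _root_.lap (b i) x) := fun i => hm.uni.int.sub (hm.lap (hb i)).uni.int
  have e : Fc (fun x => m x * ∑ i ∈ T, (1 - _root_.lap (b i) x)) τ = ∑ i ∈ T, (Fc m τ - Fc (fun x => m x * _root_.lap (b i) x) τ) := by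
    simp_rw [← fun i => Fc_sub hm.uni.int (hm.lap (hb i)).uni.int τ]
    rw [← Fc_sum T (fun i _ => hi i)]
    congr 1
    ext x
    rw [Finset.mul_sum]
    exact Finset.sum_congr rfl fun i _ => by ring
  have n0 := hm.uni.nn τ
  rw [e]
  calc _ ≤ ∑ i ∈ T, |Fc m τ - Fc (fun x => m x * _root_.lap (b i) x) τ| := Finset.abs_sum_le_sum_abs _ _
    _ ≤ ∑ i ∈ T, (2 * π ^ 2 * q * Fc m τ) * (1 / b i ^ 2) := by
      refine Finset.sum_le_sum fun i hi => ?_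
      refine (hm.abs_one_sub_le (hb i) τ).trans ?_
      have := hm.lap_le (hb i) (hq i hi) hq0 τ
      have hbi := hb i
      calc _ ≤ 2 * π ^ 2 / b i ^ 2 * (q * Fc m τ) := by gcongr
        _ = _ := by ring
    _ = (2 * π ^ 2 * q * Fc m τ) * ∑ i ∈ T, (1 / b i ^ 2) := by rw [Finset.mul_sum]
    _ ≤ (2 * π ^ 2 * q * Fc m τ) * D := by gcongr
    _ = _ := by ring
end

/-- `x / sinh x` -/
def ssh (x : ℝ) : ℝ := if x = 0 then 1 else x / Real.sinh x

/-- `x coth x` -/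
def cth (x : ℝ) : ℝ := if x = 0 then 1 else x * (Real.cosh x / Real.sinh x)

lemma lap_nat (a x : ℝ) (ha : 0 < a) (m : ℕ) :
    lap ((m + 1) * π / a) x = (1 + (a * x) ^ 2 / (π ^ 2 * (m + 1) ^ 2))⁻¹ := by
  unfold lap
  have h1 : (0:ℝ) < m + 1 := by positivity
  field_simp

lemma prod_tendsto_sinh (y : ℝ) :
    Tendsto (fun K : ℕ => y * ∏ m ∈ Finset.range K, (1 + y ^ 2 / (π ^ 2 * ((m : ℝ) + 1) ^ 2))) atTop (𝓝 (Real.sinh y)) := by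
  have h := Complex.tendsto_euler_sin_prod (Complex.I * y / π)
  have hp : (π : ℂ) ≠ 0 := by exact_mod_cast pi_ne_zero
  have e : (π : ℂ) * (Complex.I * y / π) = y * Complex.I := by field_simp
  rw [e, Complex.sin_mul_I] at h
  have h2 := (Complex.continuous_im.tendsto _).comp h
  have e3 : (Complex.sinh (y : ℂ) * Complex.I).im = Real.sinh y := by
    rw [← Complex.ofReal_sinh, Complex.im_ofReal_mul, Complex.I_im, mul_one]
  rw [e3] at h2
  refine h2.congr fun K => ?_
  simp only [Function.comp]
  have e4 : ∏ j ∈ Finset.range K, ((1 : ℂ) - (Complex.I * y / π) ^ 2 / ((j : ℂ) + 1) ^ 2) =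
    ((∏ m ∈ Finset.range K, (1 + y ^ 2 / (π ^ 2 * ((m : ℝ) + 1) ^ 2)) : ℝ) : ℂ) := by
    push_cast
    refine Finset.prod_congr rfl fun j _ => ?_
    rw [div_pow, mul_pow, Complex.I_sq]
    have : ((j : ℂ) + 1) ≠ 0 := by exact_mod_cast Nat.succ_ne_zero j
    field_simp
    ring
  rw [e4, mul_right_comm, ← Complex.ofReal_mul, Complex.im_ofReal_mul, Complex.I_im, mul_one]

lemma prod_lap_tendsto {a : ℝ} (ha : 0 < a) (x : ℝ) :
    Tendsto (fun K : ℕ => ∏ m ∈ Finset.range K, lap ((m + 1) * π / a) x) atTop (𝓝 (ssh (a * x))) := by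
  simp_rw [lap_nat a x ha]
  by_cases hx : a * x = 0
  · simp [hx, ssh]
  · have h := (prod_tendsto_sinh (a * x)).inv₀ (by simpa [Real.sinh_eq_zero] using hx)
    have h2 := h.const_mul (a * x)
    rw [ssh, if_neg hx, div_eq_mul_inv]
    refine h2.congr fun K => ?_
    rw [Finset.prod_inv_distrib, mul_inv, ← mul_assoc, mul_inv_cancel₀ hx, one_mul]

lemma sum_lap_tendsto {a : ℝ} (ha : 0 < a) (x : ℝ) :
    Tendsto (fun K : ℕ => 1 + 2 * ∑ m ∈ Finset.range K, (1 - lap ((m + 1) * π / a) x)) atTop (𝓝 (cth (a * x))) := by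
  simp_rw [lap_nat a x ha]
  by_cases hx : a * x = 0
  · simp [hx, cth]
  · set y := a * x with hy
    have hp : (π : ℂ) ≠ 0 := by exact_mod_cast pi_ne_zero
    have hyC : (y : ℂ) ≠ 0 := by exact_mod_cast hx
    have hz : (Complex.I * y / π) ∈ Complex.integerComplement := by
      rintro ⟨n, hn⟩
      have := congrArg Complex.im hn
      rw [show (Complex.I * y / π : ℂ) = ((y / π : ℝ) : ℂ) * Complex.I by push_cast; ring] at this
      rw [Complex.im_ofReal_mul, Complex.I_im, mul_one, Complex.intCast_im] at this
      exact div_ne_zero hx pi_ne_zero this.symm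
    have h := (tendsto_logDeriv_euler_cot_sub hz).const_mul (Complex.I * y / π)
    have h2 := (Complex.continuous_re.tendsto _).comp (h.const_add 1)
    have e : (π : ℂ) * (Complex.I * y / π) = y * Complex.I := by field_simp
    have e2 : (1 + Complex.I * y / π * (π * Complex.cot (π * (Complex.I * y / π)) - 1 / (Complex.I * y / π))).re = cth y := by
      rw [e, Complex.cot, Complex.cos_mul_I, Complex.sin_mul_I, cth, if_neg hx]
      have hs : Complex.sinh (y : ℂ) ≠ 0 := by
        rw [← Complex.ofReal_sinh]; exact_mod_cast (by simpa [Real.sinh_eq_zero] using hx)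
      have : 1 + Complex.I * y / π * (π * (Complex.cosh y / (Complex.sinh y * Complex.I)) - 1 / (Complex.I * y / π)) =
        ((y * (Real.cosh y / Real.sinh y) : ℝ) : ℂ) := by
        push_cast
        field_simp
        ring
      rw [this, Complex.ofReal_re]
    rw [e2] at h2
    refine h2.congr fun K => ?_
    simp only [Function.comp]
    have e3 : 1 + Complex.I * y / π * ∑ j ∈ Finset.range K, cotTerm (Complex.I * y / π) j =
        ((1 + 2 * ∑ m ∈ Finset.range K, (1 - (1 + y ^ 2 / (π ^ 2 * ((m : ℝ) + 1) ^ 2))⁻¹) : ℝ) : ℂ) := by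
      push_cast
      congr 1
      rw [Finset.mul_sum, Finset.mul_sum]
      refine Finset.sum_congr rfl fun j _ => ?_
      rw [cotTerm_identity hz]
      have h1 : (y : ℂ) ^ 2 + π ^ 2 * ((j : ℂ) + 1) ^ 2 ≠ 0 := by
        have : y ^ 2 + π ^ 2 * ((j : ℝ) + 1) ^ 2 ≠ 0 := by positivity
        exact_mod_cast this
      have h2 : ((j : ℂ) + 1) ≠ 0 := by exact_mod_cast Nat.succ_ne_zero j
      have h3 : (Complex.I * y / π + (j + 1)) * (Complex.I * y / π - (j + 1)) = -(((y : ℂ) ^ 2 + π ^ 2 * ((j : ℂ) + 1) ^ 2) / π ^ 2) := by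
        field_simp
        ring_nf
        rw [Complex.I_sq]
        ring
      have h4 : (1 + (y : ℂ) ^ 2 / (π ^ 2 * ((j : ℂ) + 1) ^ 2)) = ((y : ℂ) ^ 2 + π ^ 2 * ((j : ℂ) + 1) ^ 2) / (π ^ 2 * ((j : ℂ) + 1) ^ 2) := by
        field_simp
        ring
      rw [h3, h4]
      field_simp
      ring_nf
      rw [Complex.I_sq]
      ring
    rw [e3, Complex.ofReal_re]

section
variable {l : ℕ}

/-- The true weight: `r j = |z_j|²`. -/
def GW (k : Fin (l + 1) → ℕ) (a : Fin (l + 1) → ℝ) (r : Fin (l + 1) → ℝ) (x : ℝ) : ℝ :=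
  (∏ j, ssh (a j * x) ^ k j) * Real.exp (-∑ j, r j / 4 * cth (a j * x))

/-- poles -/
def bbf (a : Fin (l + 1) → ℝ) (i : Fin (l + 1) × ℕ) : ℝ := ((i.2 : ℝ) + 1) * π / a i.1

/-- The truncated index set -/
def idx (l K : ℕ) : Finset (Fin (l + 1) × ℕ) := Finset.univ ×ˢ Finset.range K

/-- truncated product weight -/
def WK (k : Fin (l + 1) → ℕ) (a : Fin (l + 1) → ℝ) (r : Fin (l + 1) → ℝ) (K : ℕ) : ℝ → ℝ :=
  Wt (1 / ((K : ℝ) + 1)) (idx l K) (bbf a) (fun i => r i.1 / 2) (fun i => k i.1)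

/-- normalizing constant -/
def cK (r : Fin (l + 1) → ℝ) (K : ℕ) : ℝ := Real.exp (-∑ j, r j / 4 * (1 + 2 * K))

/-- truncated weight -/
def GK (k : Fin (l + 1) → ℕ) (a : Fin (l + 1) → ℝ) (r : Fin (l + 1) → ℝ) (K : ℕ) (x : ℝ) : ℝ :=
  cK r K * WK k a r K x

variable {k : Fin (l + 1) → ℕ} {a r : Fin (l + 1) → ℝ}

lemma bbf_pos (ha : ∀ j, 0 < a j) (i : Fin (l + 1) × ℕ) : 0 < bbf a i := by
  unfold bbf; have := ha i.1; positivity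

lemma GK_eq (K : ℕ) (x : ℝ) : GK k a r K x = Real.exp (-(1 / ((K : ℝ) + 1)) * x ^ 2) *
    (∏ j, (∏ m ∈ Finset.range K, lap ((m + 1) * π / a j) x) ^ k j) *
    Real.exp (-∑ j, r j / 4 * (1 + 2 * ∑ m ∈ Finset.range K, (1 - lap ((m + 1) * π / a j) x))) := by
  unfold GK cK WK Wt idx
  rw [Finset.prod_product]
  simp only [bbf]
  have e1 : ∏ j : Fin (l + 1), ∏ m ∈ Finset.range K, (lap ((m + 1) * π / a j) x ^ k j * Real.exp (r j / 2 * lap ((m + 1) * π / a j) x)) =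
    (∏ j, (∏ m ∈ Finset.range K, lap ((m + 1) * π / a j) x) ^ k j) * Real.exp (∑ j, ∑ m ∈ Finset.range K, r j / 2 * lap ((m + 1) * π / a j) x) := by
    rw [Real.exp_sum, ← Finset.prod_mul_distrib]
    refine Finset.prod_congr rfl fun j _ => ?_
    rw [Finset.prod_mul_distrib, Finset.prod_pow, Real.exp_sum]
  rw [e1]
  have e2 : Real.exp (-∑ j, r j / 4 * (1 + 2 * ∑ m ∈ Finset.range K, (1 - lap ((m + 1) * π / a j) x))) =
    Real.exp (-∑ j, r j / 4 * (1 + 2 * K)) * Real.exp (∑ j, ∑ m ∈ Finset.range K, r j / 2 * lap ((m + 1) * π / a j) x) := by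
    rw [← Real.exp_add]
    congr 1
    rw [← Finset.sum_neg_distrib, ← Finset.sum_neg_distrib, ← Finset.sum_add_distrib]
    refine Finset.sum_congr rfl fun j _ => ?_
    rw [Finset.sum_sub_distrib, ← Finset.mul_sum]
    simp
    ring
  rw [e2]
  ring

lemma GK_tendsto (ha : ∀ j, 0 < a j) (x : ℝ) : Tendsto (fun K => GK k a r K x) atTop (𝓝 (GW k a r x)) := by
  simp_rw [GK_eq]
  unfold GW
  rw [← one_mul (∏ j, ssh (a j * x) ^ k j)]
  refine Tendsto.mul (Tendsto.mul ?_ ?_) ?_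
  · have h1 : Tendsto (fun K : ℕ => -(1 / ((K : ℝ) + 1)) * x ^ 2) atTop (𝓝 (-0 * x ^ 2)) :=
      (tendsto_one_div_add_atTop_nhds_zero_nat.neg).mul_const _
    have := (Real.continuous_exp.tendsto _).comp h1
    simpa [Function.comp_def] using this
  · exact tendsto_finsetProd _ fun j _ => (prod_lap_tendsto (ha j) x).pow _
  · refine (Real.continuous_exp.tendsto _).comp ?_
    exact (tendsto_finsetSum _ fun j _ => (sum_lap_tendsto (ha j) x).const_mul _).neg

/-- dominating function -/
lemma dom_integrable : Integrable (fun x : ℝ => (1 + x ^ 2) * (lap π x * lap (2 * π) x)) := by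
  refine ((integrable_lap two_pi_pos').const_mul (π ^ 2)).mono' ?_ ?_
  · have h1 := lap_cont pi_pos
    have h2 := lap_cont two_pi_pos'
    exact Continuous.aestronglyMeasurable (by fun_prop)
  · refine Eventually.of_forall fun x => ?_
    have h1 := lap_pos pi_pos x
    have h2 := lap_pos two_pi_pos' x
    rw [Real.norm_eq_abs, abs_of_nonneg (by positivity), ← mul_assoc]
    gcongr
    unfold lap
    rw [mul_div_assoc', div_le_iff₀ (by positivity)]
    have : 1 ≤ π ^ 2 := by nlinarith [pi_gt_three]
    nlinarith [sq_nonneg x]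

lemma GK_nonneg (ha : ∀ j, 0 < a j) (K : ℕ) (x : ℝ) : 0 ≤ GK k a r K x := by
  rw [GK_eq]
  have : ∀ j, 0 ≤ (∏ m ∈ Finset.range K, lap ((m + 1) * π / a j) x) ^ k j := fun j =>
    pow_nonneg (Finset.prod_nonneg fun m _ => (lap_pos (by have := ha j; positivity) x).le) _
  have := Finset.prod_nonneg fun j (_ : j ∈ Finset.univ) => this j
  positivity

lemma GK_le (hk : ∀ i, 0 < k i) (ha : ∀ j, 0 < a j) (haLast : a (Fin.last l) = 1) (hr : ∀ j, 0 ≤ r j) {K : ℕ} (hK : 2 ≤ K) (x : ℝ) :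
    GK k a r K x ≤ lap π x * lap (2 * π) x := by
  rw [GK_eq]
  have hb : ∀ j : Fin (l + 1), ∀ m : ℕ, 0 < ((m : ℝ) + 1) * π / a j := fun j m => by have := ha j; positivity
  have p0 : ∀ j, 0 ≤ (∏ m ∈ Finset.range K, lap ((m + 1) * π / a j) x) := fun j =>
    Finset.prod_nonneg fun m _ => (lap_pos (hb j m) x).le
  have p1 : ∀ j, (∏ m ∈ Finset.range K, lap ((m + 1) * π / a j) x) ≤ 1 := fun j =>
    Finset.prod_le_one (fun m _ => (lap_pos (hb j m) x).le) (fun m _ => lap_le_one (hb j m) x)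
  have e1 : Real.exp (-(1 / ((K : ℝ) + 1)) * x ^ 2) ≤ 1 := by
    rw [Real.exp_le_one_iff]
    have : 0 ≤ (1 / ((K : ℝ) + 1)) * x ^ 2 := by positivity
    linarith
  have e2 : Real.exp (-∑ j, r j / 4 * (1 + 2 * ∑ m ∈ Finset.range K, (1 - lap ((m + 1) * π / a j) x))) ≤ 1 := by
    rw [Real.exp_le_one_iff, neg_nonpos]
    refine Finset.sum_nonneg fun j _ => mul_nonneg (by have := hr j; positivity) ?_
    have : 0 ≤ ∑ m ∈ Finset.range K, (1 - lap ((m + 1) * π / a j) x) :=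
      Finset.sum_nonneg fun m _ => sub_nonneg.mpr (lap_le_one (hb j m) x)
    linarith
  have e3 : (∏ j, (∏ m ∈ Finset.range K, lap ((m + 1) * π / a j) x) ^ k j) ≤ lap π x * lap (2 * π) x := by
    calc (∏ j, (∏ m ∈ Finset.range K, lap ((m + 1) * π / a j) x) ^ k j) ≤ 
      ∏ j, (if j = Fin.last l then lap π x * lap (2 * π) x else 1) := by
          refine Finset.prod_le_prod (fun j _ => pow_nonneg (p0 j) _) fun j _ => ?_
          split_ifs with hj
          · subst hj
            refine (pow_le_of_le_one (p0 _) (p1 _) (hk _).ne').trans ?_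
            rw [haLast]
            calc _ ≤ ∏ m ∈ Finset.range 2, lap ((m + 1) * π / 1) x := by
                  exact Finset.prod_le_prod_of_subset_of_le_one (Finset.range_mono hK)
                    (fun m _ => (lap_pos (by positivity) x).le) (fun m _ _ => lap_le_one (by positivity) x)
              _ = _ := by simp [Finset.prod_range_succ]; norm_num
          · exact pow_le_one₀ (p0 j) (p1 j)
      _ = _ := by simp
  have p2 : 0 ≤ (∏ j, (∏ m ∈ Finset.range K, lap ((m + 1) * π / a j) x) ^ k j) :=
    Finset.prod_nonneg fun j _ => pow_nonneg (p0 j) _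
  calc _ ≤ 1 * (∏ j, (∏ m ∈ Finset.range K, lap ((m + 1) * π / a j) x) ^ k j) * 1 := by gcongr
    _ ≤ _ := by linarith
end

section
variable {l : ℕ} {k : Fin (l + 1) → ℕ} {a r : Fin (l + 1) → ℝ}

/-- standing assumptions on the parameters -/
structure Par (k : Fin (l + 1) → ℕ) (a : Fin (l + 1) → ℝ) : Prop where
  hk : ∀ i, 0 < k i
  ha : ∀ j, 0 < a j
  hlt : ∀ j, j ≠ Fin.last l → a j < 1
  hlast : a (Fin.last l) = 1

lemma Par.le_one (h : Par k a) (j : Fin (l + 1)) : a j ≤ 1 := by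
  by_cases hj : j = Fin.last l
  · rw [hj, h.hlast]
  · exact (h.hlt j hj).le

lemma Par.ratio (h : Par k a) (i : Fin (l + 1) × ℕ) : π ^ 2 / bbf a i ^ 2 = a i.1 ^ 2 / ((i.2 : ℝ) + 1) ^ 2 := by
  have := (h.ha i.1).ne'
  have hp := pi_pos.ne'
  unfold bbf
  field_simp

lemma Par.exists_q (h : Par k a) : ∃ q : ℝ, 0 ≤ q ∧ ∀ i : Fin (l + 1) × ℕ, i ≠ (Fin.last l, 0) →
    1 ≤ q * (1 - π ^ 2 / bbf a i ^ 2) := by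
  have h0 : ∀ j, 0 ≤ (if j = Fin.last l then 0 else 1 / (1 - a j ^ 2)) := by
    intro j
    split_ifs with hj
    · exact le_rfl
    · have h1 := h.hlt j hj
      have h2 := h.ha j
      have : 0 < 1 - a j ^ 2 := by nlinarith
      positivity
  refine ⟨2 + ∑ j, (if j = Fin.last l then 0 else 1 / (1 - a j ^ 2)), ?_, fun i hi => ?_⟩
  · have := Finset.sum_nonneg fun j (_ : j ∈ Finset.univ) => h0 j
    linarith
  · rw [h.ratio]
    have hs := Finset.sum_nonneg fun j (_ : j ∈ Finset.univ) => h0 j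
    have h2 := h.ha i.1
    by_cases hj : i.1 = Fin.last l
    · have hm : 1 ≤ i.2 := by
        rcases i with ⟨i1, i2⟩
        rcases Nat.eq_zero_or_pos i2 with h0 | h0
        · simp only at hj; subst hj; subst h0; exact absurd rfl hi
        · exact h0
      have hm' : (1 : ℝ) ≤ i.2 := by exact_mod_cast hm
      rw [hj, h.hlast]
      have : (1 : ℝ) ^ 2 / ((i.2 : ℝ) + 1) ^ 2 ≤ 1 / 4 := by
        rw [div_le_div_iff₀ (by positivity) (by norm_num)]
        nlinarith
      nlinarith
    · have hs' := Finset.single_le_sum (fun j (_ : j ∈ Finset.univ) => h0 j) (Finset.mem_univ i.1)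
      simp only [if_neg hj] at hs'
      have h1 := h.hlt _ hj
      have h3 : 0 < 1 - a i.1 ^ 2 := by nlinarith
      have h4 : a i.1 ^ 2 / ((i.2 : ℝ) + 1) ^ 2 ≤ a i.1 ^ 2 := by
        apply div_le_self (by positivity)
        have : (0 : ℝ) ≤ i.2 := by positivity
        nlinarith
      calc (1 : ℝ) = 1 / (1 - a i.1 ^ 2) * (1 - a i.1 ^ 2) := by field_simp
        _ ≤ _ := by
          apply mul_le_mul _ (by linarith) h3.le (by linarith)
          linarith

lemma sum_inv_sq (K : ℕ) : ∑ m ∈ Finset.range K, 1 / ((m : ℝ) + 1) ^ 2 ≤ 2 := by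
  have : ∀ K : ℕ, ∑ m ∈ Finset.range (K + 1), 1 / ((m : ℝ) + 1) ^ 2 ≤ 2 - 1 / ((K : ℝ) + 1) := by
    intro K
    induction K with
    | zero => norm_num
    | succ K ih =>
      rw [Finset.sum_range_succ]
      push_cast
      have : 1 / ((K : ℝ) + 1 + 1) ^ 2 ≤ 1 / ((K : ℝ) + 1) - 1 / ((K : ℝ) + 1 + 1) := by
        rw [div_sub_div _ _ (by positivity) (by positivity), div_le_div_iff₀ (by positivity) (by positivity)]
        have : (0 : ℝ) ≤ K := by positivity
        nlinarith
      linarith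
  rcases K with _ | K
  · norm_num
  · have h1 := this K
    have : 0 ≤ 1 / ((K : ℝ) + 1) := by positivity
    linarith

lemma Par.sum_le (h : Par k a) (K : ℕ) (j : Fin (l + 1)) :
    ∑ m ∈ Finset.range K, π ^ 2 / bbf a (j, m) ^ 2 ≤ 2 := by
  refine le_trans (Finset.sum_le_sum fun m _ => ?_) (sum_inv_sq K)
  rw [h.ratio]
  have h1 := h.le_one j
  have h2 := h.ha j
  simp only
  gcongr
  nlinarith

lemma Par.sum_idx_le (h : Par k a) {K : ℕ} {T : Finset (Fin (l + 1) × ℕ)} (hT : T ⊆ idx l K) :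
    ∑ i ∈ T, 1 / bbf a i ^ 2 ≤ 2 * ((l : ℝ) + 1) := by
  have hp : (1 : ℝ) ≤ π ^ 2 := by nlinarith [pi_gt_three]
  calc ∑ i ∈ T, 1 / bbf a i ^ 2 ≤ ∑ i ∈ idx l K, π ^ 2 / bbf a i ^ 2 := by
        refine (Finset.sum_le_sum_of_subset_of_nonneg hT fun i _ _ => by positivity).trans ?_
        refine Finset.sum_le_sum fun i _ => ?_
        gcongr
    _ = ∑ j : Fin (l + 1), ∑ m ∈ Finset.range K, π ^ 2 / bbf a (j, m) ^ 2 := by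
        unfold idx; rw [Finset.sum_product]
    _ ≤ ∑ j : Fin (l + 1), 2 := Finset.sum_le_sum fun j _ => h.sum_le K j
    _ = _ := by simp; ring

lemma Good.const_mul {m : ℝ → ℝ} (h : Good m) {c : ℝ} (hc : 0 ≤ c) : Good (fun x => c * m x) := by
  obtain ⟨H, hH, rfl⟩ := h
  exact ⟨_, hH.const_mul hc, by ext x; ring⟩

lemma Par.bbf0 (h : Par k a) : bbf a (Fin.last l, 0) = π := by simp [bbf, h.hlast]
lemma Par.bbf1 (h : Par k a) : bbf a (Fin.last l, 1) = 2 * π := by simp [bbf, h.hlast]; norm_num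

lemma mem_idx {K : ℕ} {j : Fin (l + 1)} {m : ℕ} : (j, m) ∈ idx l K ↔ m < K := by simp [idx]

lemma Par.good_WK (h : Par k a) (hr : ∀ j, 0 ≤ r j) {K : ℕ} (hK : 2 ≤ K) : Good (WK k a r K) :=
  Good_Wt (by positivity) (bbf_pos h.ha) (fun i => by have := hr i.1; positivity)
    (i := (Fin.last l, 0)) (i' := (Fin.last l, 1)) (mem_idx.2 (by omega)) (mem_idx.2 (by omega))
    (by simp) h.bbf0 h.bbf1 (h.hk _) (h.hk _)

lemma cK_pos (K : ℕ) : 0 < cK r K := Real.exp_pos _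

lemma Par.good_GK (h : Par k a) (hr : ∀ j, 0 ≤ r j) {K : ℕ} (hK : 2 ≤ K) : Good (GK k a r K) :=
  (h.good_WK hr hK).const_mul (cK_pos K).le

lemma Fc_GK (K : ℕ) (m : ℝ → ℝ) (τ : ℝ) : Fc (fun x => GK k a r K x * m x) τ = cK r K * Fc (fun x => WK k a r K x * m x) τ := by
  rw [← Fc_const_mul]; congr 1; ext x; unfold GK; ring

lemma Fc_GK' (K : ℕ) (τ : ℝ) : Fc (GK k a r K) τ = cK r K * Fc (WK k a r K) τ := by
  rw [← Fc_const_mul]; rfl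

/-- limit passage -/
lemma Par.lim (h : Par k a) (hr : ∀ j, 0 ≤ r j) {mK : ℕ → ℝ → ℝ} {m : ℝ → ℝ} (hc : ∀ K, Continuous (mK K)) {C : ℝ}
    (hC : ∀ K x, |mK K x| ≤ C * (1 + x ^ 2)) (hm : ∀ x, Tendsto (fun K => mK K x) atTop (𝓝 (m x))) (τ : ℝ) :
    Tendsto (fun K => Fc (fun x => GK k a r K x * mK K x) τ) atTop (𝓝 (Fc (fun x => GW k a r x * m x) τ)) := by
  have hle : ∀ᶠ K in atTop, ∀ x, |GK k a r K x * mK K x| ≤ C * ((1 + x ^ 2) * (lap π x * lap (2 * π) x)) := by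
    filter_upwards [eventually_ge_atTop 2] with K hK x
    rw [abs_mul, abs_of_nonneg (GK_nonneg h.ha K x)]
    have h1 := GK_le h.hk h.ha h.hlast hr hK x
    have h2 := GK_nonneg (k := k) (r := r) h.ha K x
    calc _ ≤ (lap π x * lap (2 * π) x) * (C * (1 + x ^ 2)) := by
          exact mul_le_mul h1 (hC K x) (abs_nonneg _) (h2.trans h1)
      _ = _ := by ring
  refine Fc_tendsto ?_ (dom_integrable.const_mul C) hle ?_ τ
  · filter_upwards [hle, eventually_ge_atTop 2] with K h1 hK
    refine (dom_integrable.const_mul C).mono' ?_ (Eventually.of_forall h1)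
    exact ((h.good_GK hr hK).uni.int.1).mul (hc K).aestronglyMeasurable
  · exact Eventually.of_forall fun x => (GK_tendsto h.ha x).mul (hm x)

lemma Par.lim1 (h : Par k a) (hr : ∀ j, 0 ≤ r j) {m : ℝ → ℝ} (hc : Continuous m) {C : ℝ}
    (hC : ∀ x, |m x| ≤ C * (1 + x ^ 2)) (τ : ℝ) :
    Tendsto (fun K => Fc (fun x => GK k a r K x * m x) τ) atTop (𝓝 (Fc (fun x => GW k a r x * m x) τ)) :=
  h.lim hr (fun _ => hc) (fun _ => hC) (fun _ => tendsto_const_nhds) τ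

lemma Par.lim0 (h : Par k a) (hr : ∀ j, 0 ≤ r j) (τ : ℝ) :
    Tendsto (fun K => Fc (GK k a r K) τ) atTop (𝓝 (Fc (GW k a r) τ)) := by
  have := h.lim1 hr (m := fun _ => 1) continuous_const (C := 1) (fun x => by rw [abs_one]; nlinarith [sq_nonneg x]) τ
  simpa using this

lemma GW_nonneg_le (h : Par k a) (hr : ∀ j, 0 ≤ r j) (x : ℝ) : 0 ≤ GW k a r x ∧ GW k a r x ≤ lap π x * lap (2 * π) x := by
  have h1 := GK_tendsto (k := k) (r := r) h.ha x
  refine ⟨ge_of_tendsto' h1 fun K => GK_nonneg h.ha K x, le_of_tendsto h1 ?_⟩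
  filter_upwards [eventually_ge_atTop 2] with K hK using GK_le h.hk h.ha h.hlast hr hK x

lemma Par.limFs (h : Par k a) (hr : ∀ j, 0 ≤ r j) (τ : ℝ) :
    Tendsto (fun K => Fs (GK k a r K) τ) atTop (𝓝 (Fs (GW k a r) τ)) := by
  unfold Fs
  refine tendsto_integral_filter_of_dominated_convergence _ ?_ ?_ dom_integrable ?_
  · filter_upwards [eventually_ge_atTop 2] with K hK using (Fs_integrable (h.good_GK hr hK).int_x τ).1
  · filter_upwards [eventually_ge_atTop 2] with K hK
    refine Eventually.of_forall fun x => ?_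
    have h1 := GK_le h.hk h.ha h.hlast hr hK x
    have h2 := GK_nonneg (k := k) (r := r) h.ha K x
    rw [Real.norm_eq_abs, abs_mul, abs_mul, abs_of_nonneg h2]
    have h3 := Real.abs_sin_le_one (x * τ)
    have h4 : |x| ≤ 1 + x ^ 2 := by rw [abs_le]; constructor <;> nlinarith [sq_nonneg (x - 1), sq_nonneg (x + 1)]
    calc |x| * GK k a r K x * |Real.sin (x * τ)| ≤ |x| * GK k a r K x * 1 := by gcongr
      _ ≤ _ := by rw [mul_one]; exact mul_le_mul h4 h1 h2 (by positivity)
  · exact Eventually.of_forall fun x => ((GK_tendsto h.ha x).const_mul _).mul_const _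

lemma T0 (h : Par k a) (hr : ∀ j, 0 ≤ r j) (τ : ℝ) : 0 ≤ Fc (GW k a r) τ := by
  refine ge_of_tendsto (h.lim0 hr τ) ?_
  filter_upwards [eventually_ge_atTop 2] with K hK using (h.good_GK hr hK).uni.nn τ

lemma T1 (h : Par k a) (hr : ∀ j, 0 ≤ r j) (τ : ℝ) : |Fs (GW k a r) τ| ≤ π * Fc (GW k a r) τ := by
  refine le_of_tendsto_of_tendsto (h.limFs hr τ).abs ((h.lim0 hr τ).const_mul π) ?_
  filter_upwards [eventually_ge_atTop 2] with K hK using (h.good_GK hr hK).Fs_le τ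

lemma phi_bd (x : ℝ) : |lap π x| ≤ 1 * (1 + x ^ 2) := by
  rw [abs_of_pos (lap_pos pi_pos x)]
  nlinarith [lap_le_one pi_pos x, sq_nonneg x]

lemma phi2_bd (x : ℝ) : |lap π x ^ 2| ≤ 1 * (1 + x ^ 2) := by
  have h1 := lap_pos pi_pos x
  rw [abs_of_pos (by positivity)]
  nlinarith [lap_le_one pi_pos x, sq_nonneg x]

lemma Par.limφ (h : Par k a) (hr : ∀ j, 0 ≤ r j) (τ : ℝ) :
    Tendsto (fun K => Fc (fun x => GK k a r K x * lap π x) τ) atTop (𝓝 (Fc (fun x => GW k a r x * lap π x) τ)) :=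
  h.lim1 hr (lap_cont pi_pos) phi_bd τ

lemma Par.limφ2 (h : Par k a) (hr : ∀ j, 0 ≤ r j) (τ : ℝ) :
    Tendsto (fun K => Fc (fun x => GK k a r K x * lap π x ^ 2) τ) atTop (𝓝 (Fc (fun x => GW k a r x * lap π x ^ 2) τ)) :=
  h.lim1 hr ((lap_cont pi_pos).pow 2) phi2_bd τ

lemma T3 (h : Par k a) (hr : ∀ j, 0 ≤ r j) (τ : ℝ) :
    r (Fin.last l) * Fc (fun x => GW k a r x * lap π x ^ 2) τ ≤
      r (Fin.last l) * Fc (fun x => GW k a r x * lap π x) τ + π * |τ| * Fc (GW k a r) τ := by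
  rw [← Fc_abs _ τ, ← Fc_abs (fun x => GW k a r x * lap π x) τ, ← Fc_abs (GW k a r) τ]
  set t := |τ|
  have ht : 0 ≤ t := abs_nonneg τ
  refine le_of_tendsto_of_tendsto ((h.limφ2 hr t).const_mul _) (((h.limφ hr t).const_mul _).add ((h.lim0 hr t).const_mul _)) ?_
  filter_upwards [eventually_ge_atTop 2] with K hK
  have := Wt_I3 (ε := 1 / ((K : ℝ) + 1)) (s := idx l K) (n := fun i : Fin (l + 1) × ℕ => k i.1) (w := fun i : Fin (l + 1) × ℕ => r i.1 / 2) (by positivity) (bbf_pos h.ha)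
    (fun i => by have := hr i.1; positivity) (h.good_WK hr hK) (i := (Fin.last l, 0)) (mem_idx.2 (by omega)) h.bbf0 ht
  rw [Fc_GK', Fc_GK K (lap π), Fc_GK K (fun x => lap π x ^ 2)]
  simp only [] at this
  change 2 * (r (Fin.last l) / 2) * Fc (fun x => WK k a r K x * lap π x ^ 2) t ≤ 2 * (r (Fin.last l) / 2) * Fc (fun x => WK k a r K x * lap π x) t + π * (t * Fc (WK k a r K) t) at this
  have := mul_le_mul_of_nonneg_left this (cK_pos (r := r) K).le
  linarith

lemma T4 (h : Par k a) (hr : ∀ j, 0 ≤ r j) (τ : ℝ) :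
    Fc (fun x => GW k a r x * lap π x) τ ^ 2 ≤ 2 * Fc (GW k a r) τ * Fc (fun x => GW k a r x * lap π x ^ 2) τ := by
  refine le_of_tendsto_of_tendsto ((h.limφ hr τ).pow 2) (((h.lim0 hr τ).const_mul 2).mul (h.limφ2 hr τ)) ?_
  filter_upwards [eventually_ge_atTop 2] with K hK
  have : Fc (fun x => WK k a r K x * lap π x) τ ^ 2 ≤ 2 * Fc (WK k a r K) τ * Fc (fun x => WK k a r K x * lap π x ^ 2) τ :=
    Wt_cauchy (by positivity) (bbf_pos h.ha)
      (fun i => by have := hr i.1; positivity) (i := (Fin.last l, 0)) (mem_idx.2 (by omega)) h.bbf0 (h.hk _) τ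
  rw [Fc_GK', Fc_GK K (lap π), Fc_GK K (fun x => lap π x ^ 2)]
  have := mul_le_mul_of_nonneg_left this (sq_nonneg (cK r K))
  linarith

lemma T7 (h : Par k a) (hr : ∀ j, 0 ≤ r j) (τ : ℝ) :
    Fc (GW k a r) τ ≤ 9 * Fc (fun x => GW k a r x * lap π x ^ 2) τ ∧ 0 ≤ Fc (fun x => GW k a r x * lap π x) τ ∧ 
    0 ≤ Fc (fun x => GW k a r x * lap π x ^ 2) τ := by
  refine ⟨le_of_tendsto_of_tendsto (h.lim0 hr τ) ((h.limφ2 hr τ).const_mul _) ?_, ge_of_tendsto (h.limφ hr τ) ?_, ge_of_tendsto (h.limφ2 hr τ) ?_⟩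
  · filter_upwards [eventually_ge_atTop 2] with K hK
    have h1 := (h.good_GK hr hK).Fc_le_lap pi_pos τ
    have h2 := ((h.good_GK hr hK).lap pi_pos).Fc_le_lap pi_pos τ
    have : 1 + 2 * π ^ 2 / π ^ 2 = 3 := by have := pi_pos.ne'; field_simp; norm_num
    rw [this] at h1 h2
    simp_rw [mul_assoc, ← pow_two] at h2
    linarith
  · filter_upwards [eventually_ge_atTop 2] with K hK
    exact ((h.good_GK hr hK).lap pi_pos).uni.nn τ
  · filter_upwards [eventually_ge_atTop 2] with K hK
    have := (((h.good_GK hr hK).lap pi_pos).lap pi_pos).uni.nn τ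
    simpa only [mul_assoc, ← pow_two] using this

set_option maxHeartbeats 800000 in
lemma T5 (h : Par k a) : ∃ C > 0, ∀ r : Fin (l + 1) → ℝ, (∀ j, 0 ≤ r j) → ∀ τ,
    |τ| * Fc (GW k a r) τ ≤ C * (1 + ∑ j, r j) * Fc (GW k a r) τ + C * Fc (fun x => GW k a r x * lap π x) τ 
      + r (Fin.last l) * Fc (fun x => GW k a r x * lap π x ^ 2) τ := by
  obtain ⟨q, hq0, hq⟩ := h.exists_q
  set N : ℝ := ∑ j, (k j : ℝ) with hN
  have hN0 : 0 ≤ N := by positivity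
  have hkN : ∀ j, (k j : ℝ) ≤ N := fun j => Finset.single_le_sum (f := fun j => (k j : ℝ)) (fun _ _ => by positivity) (Finset.mem_univ j)
  set D : ℝ := 2 * ((l : ℝ) + 1)
  have hD0 : 0 ≤ D := by positivity
  set C := (2 * π + (2 * N * π * q + 2 * π * q ^ 2) * D) + 2 * N / π + 1
  have hp := pi_pos
  refine ⟨C, by positivity, fun r hr τ => ?_⟩
  rw [← Fc_abs _ τ, ← Fc_abs (fun x => GW k a r x * lap π x) τ, ← Fc_abs (fun x => GW k a r x * lap π x ^ 2) τ]
  set t := |τ|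
  have ht : 0 ≤ t := abs_nonneg τ
  set R := ∑ j, r j
  have hR0 : 0 ≤ R := Finset.sum_nonneg fun j _ => hr j
  have hrR : ∀ j, r j ≤ R := fun j => Finset.single_le_sum (fun j _ => hr j) (Finset.mem_univ j)
  refine le_of_tendsto_of_tendsto ((h.lim0 hr t).const_mul _) ((((h.lim0 hr t).const_mul _).add ((h.limφ hr t).const_mul _)).add ((h.limφ2 hr t).const_mul _)) ?_
  filter_upwards [eventually_ge_atTop 2] with K hK
  have : t * Fc (WK k a r K) t ≤ (2 * π + (2 * N * π * q + 2 * R * π * q ^ 2) * D) * Fc (WK k a r K) t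
      + 2 * N / π * Fc (fun x => WK k a r K x * lap π x) t + 2 * (r (Fin.last l) / 2) / π * Fc (fun x => WK k a r K x * lap π x ^ 2) t := 
    Wt_I5 (ε := 1 / ((K : ℝ) + 1)) (s := idx l K) (n := fun i : Fin (l + 1) × ℕ => k i.1) (w := fun i : Fin (l + 1) × ℕ => r i.1 / 2)
    (by rw [div_le_one (by positivity)]; have : (0 : ℝ) ≤ K := by positivity
        linarith) (bbf_pos h.ha)
    (fun i => by have := hr i.1; positivity) (h.good_WK hr hK) (i := (Fin.last l, 0)) (mem_idx.2 (by omega)) h.bbf0 ht hq0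
    (fun i => hkN i.1) (fun i => by have := hrR i.1; have := hr i.1; linarith) (fun i _ hi => hq i hi)
    (fun T hT _ => h.sum_idx_le hT)
  have hG := h.good_GK hr hK
  have n0 := hG.uni.nn t
  have n1 := (hG.lap pi_pos).uni.nn t
  have n2 := ((hG.lap pi_pos).lap pi_pos).uni.nn t
  simp_rw [mul_assoc, ← pow_two] at n2
  have h2 := mul_le_mul_of_nonneg_left this (cK_pos (r := r) K).le
  have h3 : t * Fc (GK k a r K) t ≤ (2 * π + (2 * N * π * q + 2 * R * π * q ^ 2) * D) * Fc (GK k a r K) t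
      + 2 * N / π * Fc (fun x => GK k a r K x * lap π x) t + 2 * (r (Fin.last l) / 2) / π * Fc (fun x => GK k a r K x * lap π x ^ 2) t := by
    rw [Fc_GK', Fc_GK K (lap π), Fc_GK K (fun x => lap π x ^ 2)]
    linarith
  refine h3.trans ?_
  have e1 : (2 * π + (2 * N * π * q + 2 * R * π * q ^ 2) * D) ≤ C * (1 + R) := by
    have : C * (1 + R) = (2 * π + (2 * N * π * q + 2 * R * π * q ^ 2) * D) + (2 * π + 2 * N * π * q * D) * R + 2 * π * q ^ 2 * D + (2 * N / π + 1) * (1 + R) := by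
      simp only [C]; ring
    rw [this]
    have : 0 ≤ (2 * π + 2 * N * π * q * D) * R + 2 * π * q ^ 2 * D + (2 * N / π + 1) * (1 + R) := by positivity
    linarith
  have e2 : 2 * N / π ≤ C := by
    have : 0 ≤ (2 * π + (2 * N * π * q + 2 * π * q ^ 2) * D) := by positivity
    simp only [C]; linarith
  have e3 : 2 * (r (Fin.last l) / 2) / π ≤ r (Fin.last l) := by
    rw [mul_div_cancel₀ _ (by norm_num)]
    exact div_le_self (hr _) (by linarith [pi_gt_three])
  gcongr

end

section
variable {l : ℕ} {k : Fin (l + 1) → ℕ} {a r : Fin (l + 1) → ℝ}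

/-- truncated coth -/
def cKf (a : Fin (l + 1) → ℝ) (j : Fin (l + 1)) (K : ℕ) (x : ℝ) : ℝ :=
  1 + 2 * ∑ m ∈ Finset.range K, (1 - lap (bbf a (j, m)) x)

lemma Par.cKf_cont (h : Par k a) (j : Fin (l + 1)) (K : ℕ) : Continuous (cKf a j K) := by
  have : ∀ m, Continuous (lap (bbf a (j, m))) := fun m => lap_cont (bbf_pos h.ha _)
  unfold cKf
  fun_prop

lemma one_sub_lap_nonneg {b : ℝ} (hb : 0 < b) (x : ℝ) : 0 ≤ 1 - lap b x := by linarith [lap_le_one hb x]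

lemma one_sub_lap_le {b : ℝ} (hb : 0 < b) (x : ℝ) : 1 - lap b x ≤ x ^ 2 * (1 / b ^ 2) := by
  have h1 := sq_mul_lap hb x
  have h2 := lap_le_one hb x
  have : 1 - lap b x = x ^ 2 * lap b x * (1 / b ^ 2) := by rw [h1]; field_simp
  rw [this]
  gcongr
  nlinarith [sq_nonneg x]

lemma Par.sum_le' (h : Par k a) (T K : ℕ) (j : Fin (l + 1)) :
    ∑ m ∈ Finset.Ico T K, 1 / bbf a (j, m) ^ 2 ≤ 2 := by
  have hp : (1 : ℝ) ≤ π ^ 2 := by nlinarith [pi_gt_three]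
  calc ∑ m ∈ Finset.Ico T K, 1 / bbf a (j, m) ^ 2 ≤ ∑ m ∈ Finset.range K, 1 / bbf a (j, m) ^ 2 := by
        refine Finset.sum_le_sum_of_subset_of_nonneg ?_ fun i _ _ => by positivity
        intro m hm; simp at hm ⊢; omega
    _ ≤ ∑ m ∈ Finset.range K, π ^ 2 / bbf a (j, m) ^ 2 := by
        refine Finset.sum_le_sum fun i _ => ?_
        gcongr
    _ ≤ 2 := h.sum_le K j

lemma Par.cKf_bd (h : Par k a) (j : Fin (l + 1)) (K : ℕ) (x : ℝ) : |cKf a j K x| ≤ 4 * (1 + x ^ 2) := by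
  have h0 : 0 ≤ ∑ m ∈ Finset.range K, (1 - lap (bbf a (j, m)) x) :=
    Finset.sum_nonneg fun m _ => one_sub_lap_nonneg (bbf_pos h.ha _) x
  have h1 : ∑ m ∈ Finset.range K, (1 - lap (bbf a (j, m)) x) ≤ x ^ 2 * 2 := by
    calc _ ≤ ∑ m ∈ Finset.range K, x ^ 2 * (1 / bbf a (j, m) ^ 2) := Finset.sum_le_sum fun m _ => one_sub_lap_le (bbf_pos h.ha _) x
      _ = x ^ 2 * ∑ m ∈ Finset.range K, (1 / bbf a (j, m) ^ 2) := by rw [Finset.mul_sum]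
      _ ≤ _ := by
        have := h.sum_le' 0 K j
        rw [← Finset.range_eq_Ico] at this
        gcongr
  unfold cKf
  rw [abs_of_nonneg (by positivity)]
  nlinarith [sq_nonneg x]

lemma Par.cKf_tendsto (h : Par k a) (j : Fin (l + 1)) (x : ℝ) : Tendsto (fun K => cKf a j K x) atTop (𝓝 (cth (a j * x))) :=
  sum_lap_tendsto (h.ha j) x

lemma Par.limc (h : Par k a) (hr : ∀ j, 0 ≤ r j) (j : Fin (l + 1)) (τ : ℝ) :
    Tendsto (fun K => Fc (fun x => GK k a r K x * cKf a j K x) τ) atTop (𝓝 (Fc (fun x => GW k a r x * cth (a j * x)) τ)) :=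
  h.lim hr (h.cKf_cont j) (h.cKf_bd j) (h.cKf_tendsto j) τ

lemma integrable_mul_one_sub {m : ℝ → ℝ} (hm : Good m) {b : ℕ → ℝ} (hb : ∀ i, 0 < b i) (T : Finset ℕ) :
    Integrable (fun x => m x * ∑ i ∈ T, (1 - lap (b i) x)) := by
  simp_rw [Finset.mul_sum]
  refine integrable_finsetSum _ fun i _ => ?_
  have := hm.uni.int.sub (hm.lap (hb i)).uni.int
  refine this.congr (Eventually.of_forall fun x => ?_)
  simp; ring

lemma T2 (h : Par k a) : ∃ C > 0, ∀ r : Fin (l + 1) → ℝ, (∀ j, 0 ≤ r j) → ∀ τ,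
    (∀ j, j ≠ Fin.last l → |Fc (fun x => GW k a r x * cth (a j * x)) τ| ≤ C * Fc (GW k a r) τ) ∧
    |Fc (fun x => GW k a r x * cth (a (Fin.last l) * x)) τ + 2 * Fc (fun x => GW k a r x * lap π x) τ| ≤ C * Fc (GW k a r) τ := by
  obtain ⟨q, hq0, hq⟩ := h.exists_q
  refine ⟨3 + 2 * (2 * π ^ 2 * q * 2), by positivity, fun r hr τ => ⟨fun j hj => ?_, ?_⟩⟩
  · refine le_of_tendsto_of_tendsto (h.limc hr j τ).abs ((h.lim0 hr τ).const_mul _) ?_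
    filter_upwards [eventually_ge_atTop 2] with K hK
    have hG := h.good_GK hr hK
    have h1 := hG.sum_one_sub (Finset.range K) (b := fun m => bbf a (j, m)) (fun m => bbf_pos h.ha _) hq0
      (fun m _ => hq (j, m) (by simp [hj])) (D := 2) (by have := h.sum_le' 0 K j; rwa [← Finset.range_eq_Ico] at this) τ
    have e : Fc (fun x => GK k a r K x * cKf a j K x) τ = Fc (GK k a r K) τ + 2 * Fc (fun x => GK k a r K x * ∑ m ∈ Finset.range K, (1 - lap (bbf a (j, m)) x)) τ := by
      rw [← Fc_const_mul, ← Fc_add hG.uni.int ((integrable_mul_one_sub hG (fun m => bbf_pos h.ha (j, m)) _).const_mul 2)]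
      congr 1; ext x; unfold cKf; ring
    rw [e]
    have h2 := hG.uni.nn τ
    rw [abs_le] at h1 ⊢
    constructor <;> linarith
  · refine le_of_tendsto_of_tendsto ((h.limc hr _ τ).add ((h.limφ hr τ).const_mul 2)).abs ((h.lim0 hr τ).const_mul _) ?_
    filter_upwards [eventually_ge_atTop 2] with K hK
    have hG := h.good_GK hr hK
    have h1 := hG.sum_one_sub (Finset.Ico 1 K) (b := fun m => bbf a (Fin.last l, m)) (fun m => bbf_pos h.ha _) hq0
      (fun m hm => hq (Fin.last l, m) (by simp at hm ⊢; omega)) (D := 2) (h.sum_le' 1 K _) τ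
    have e : Fc (fun x => GK k a r K x * cKf a (Fin.last l) K x) τ + 2 * Fc (fun x => GK k a r K x * lap π x) τ = 
        3 * Fc (GK k a r K) τ + 2 * Fc (fun x => GK k a r K x * ∑ m ∈ Finset.Ico 1 K, (1 - lap (bbf a (Fin.last l, m)) x)) τ := by
      have i1 := (integrable_mul_one_sub hG (fun m => bbf_pos h.ha (Fin.last l, m)) (Finset.Ico 1 K)).const_mul 2
      have i2 : Integrable (fun x => GK k a r K x * cKf a (Fin.last l) K x) := by
        have := hG.uni.int.add ((integrable_mul_one_sub hG (fun m => bbf_pos h.ha (Fin.last l, m)) (Finset.range K)).const_mul 2)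
        refine this.congr (Eventually.of_forall fun x => ?_)
        unfold cKf; simp; ring
      rw [← Fc_const_mul 3, ← Fc_const_mul 2, ← Fc_const_mul 2, ← Fc_add (hG.uni.int.const_mul 3) i1, ← Fc_add i2 ((hG.lap pi_pos).uni.int.const_mul 2)]
      congr 1; ext x; unfold cKf
      rw [Finset.range_eq_Ico, Finset.sum_eq_sum_Ico_succ_bot (by omega : 0 < K), h.bbf0]
      ring
    rw [e]
    have h2 := hG.uni.nn τ
    rw [abs_le] at h1 ⊢
    constructor <;> linarith

lemma exp_sum_le (h : Par k a) (T K : ℕ) (j : Fin (l + 1)) :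
    Real.exp (∑ m ∈ Finset.Ico T K, 4 * π ^ 2 / bbf a (j, m) ^ 2) ≤ Real.exp (8 * π ^ 2) := by
  apply Real.exp_le_exp.2
  calc _ = 4 * π ^ 2 * ∑ m ∈ Finset.Ico T K, 1 / bbf a (j, m) ^ 2 := by
        rw [Finset.mul_sum]; exact Finset.sum_congr rfl fun m _ => by ring
    _ ≤ 4 * π ^ 2 * 2 := by have := h.sum_le' T K j; gcongr
    _ = _ := by ring

lemma Par.prod_bd (h : Par k a) (j : Fin (l + 1)) (K : ℕ) (x : ℝ) :
    0 ≤ ∏ m ∈ Finset.range K, lap (bbf a (j, m)) x ^ 2 ∧ ∏ m ∈ Finset.range K, lap (bbf a (j, m)) x ^ 2 ≤ 1 := by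
  have hp : ∀ m, 0 < lap (bbf a (j, m)) x := fun m => lap_pos (bbf_pos h.ha _) x
  have hp1 : ∀ m, lap (bbf a (j, m)) x ≤ 1 := fun m => lap_le_one (bbf_pos h.ha _) x
  exact ⟨Finset.prod_nonneg fun m _ => sq_nonneg _, Finset.prod_le_one (fun m _ => sq_nonneg _) fun m _ => pow_le_one₀ (hp m).le (hp1 m)⟩

lemma Par.limS (h : Par k a) (hr : ∀ j, 0 ≤ r j) (j : Fin (l + 1)) (τ : ℝ) :
    Tendsto (fun K => Fc (fun x => GK k a r K x * ∏ m ∈ Finset.range K, lap (bbf a (j, m)) x ^ 2) τ) atTop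
      (𝓝 (Fc (fun x => GW k a r x * ssh (a j * x) ^ 2) τ)) := by
  refine h.lim hr (C := 1) (fun K => ?_) (fun K x => ?_) (fun x => ?_) τ
  · have : ∀ m, Continuous (lap (bbf a (j, m))) := fun m => lap_cont (bbf_pos h.ha _)
    fun_prop
  · have := h.prod_bd j K x
    rw [abs_of_nonneg this.1]
    nlinarith [sq_nonneg x]
  · simp_rw [Finset.prod_pow]
    exact (prod_lap_tendsto (h.ha j) x).pow 2

lemma T6 (h : Par k a) (hr : ∀ j, 0 ≤ r j) (τ : ℝ) :
    (∀ j, Fc (GW k a r) τ ≤ Real.exp (8 * π ^ 2) * Fc (fun x => GW k a r x * ssh (a j * x) ^ 2) τ) ∧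
    Fc (fun x => GW k a r x * lap π x ^ 2) τ ≤ Real.exp (8 * π ^ 2) * Fc (fun x => GW k a r x * ssh (a (Fin.last l) * x) ^ 2) τ := by
  refine ⟨fun j => ?_, ?_⟩
  · refine le_of_tendsto_of_tendsto (h.lim0 hr τ) ((h.limS hr j τ).const_mul _) ?_
    filter_upwards [eventually_ge_atTop 2] with K hK
    obtain ⟨g1, g2⟩ := (h.good_GK hr hK).prod (Finset.range K) (b := fun m => bbf a (j, m)) (fun m _ => bbf_pos h.ha _)
    refine (g2 τ).trans ?_
    have := exp_sum_le h 0 K j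
    rw [← Finset.range_eq_Ico] at this
    have := g1.uni.nn τ
    gcongr
  · refine le_of_tendsto_of_tendsto (h.limφ2 hr τ) ((h.limS hr _ τ).const_mul _) ?_
    filter_upwards [eventually_ge_atTop 2] with K hK
    obtain ⟨g1, g2⟩ := (((h.good_GK hr hK).lap pi_pos).lap pi_pos).prod (Finset.Ico 1 K) (b := fun m => bbf a (Fin.last l, m)) (fun m _ => bbf_pos h.ha _)
    have e : (fun x => GK k a r K x * lap π x * lap π x * ∏ m ∈ Finset.Ico 1 K, lap (bbf a (Fin.last l, m)) x ^ 2) =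
      fun x => GK k a r K x * ∏ m ∈ Finset.range K, lap (bbf a (Fin.last l, m)) x ^ 2 := by
      ext x
      rw [Finset.range_eq_Ico, Finset.prod_eq_prod_Ico_succ_bot (by omega : 0 < K), h.bbf0]
      ring
    have g3 := g2 τ
    have g4 := g1.uni.nn τ
    rw [e] at g3 g4
    simp_rw [mul_assoc, ← pow_two] at g3
    refine g3.trans ?_
    have := exp_sum_le h 1 K (Fin.last l)
    gcongr

lemma A3 (h : Par k a) : ∃ C > 0, ∀ r : Fin (l + 1) → ℝ, (∀ j, 0 ≤ r j) → ∀ τ j,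
    r j * Fc (fun x => GW k a r x * cth (a j * x)) τ ^ 2 ≤ C * (1 + ∑ j, r j + |τ|) * Fc (GW k a r) τ ^ 2 := by
  obtain ⟨C, hC, h2⟩ := T2 h
  have hp := pi_pos
  refine ⟨2 * C ^ 2 + 32 + 32 * π, by positivity, fun r hr τ j => ?_⟩
  have hR0 : 0 ≤ ∑ j, r j := Finset.sum_nonneg fun j _ => hr j
  have hrR : r j ≤ ∑ j, r j := Finset.single_le_sum (fun j _ => hr j) (Finset.mem_univ j)
  have hj0 := hr j
  have hτ := abs_nonneg τ
  set R := ∑ j, r j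
  obtain ⟨h21, h22⟩ := h2 r hr τ
  set F := Fc (GW k a r) τ
  have hF : 0 ≤ F := T0 h hr τ
  by_cases hj : j = Fin.last l
  · subst hj
    have h3 := T3 h hr τ
    have h4 := T4 h hr τ
    obtain ⟨-, h7, -⟩ := T7 h hr τ
    set f := Fc (fun x => GW k a r x * lap π x) τ
    set f2 := Fc (fun x => GW k a r x * lap π x ^ 2) τ
    set c := Fc (fun x => GW k a r x * cth (a (Fin.last l) * x)) τ
    set ρ := r (Fin.last l)
    have k1 : ρ * f ^ 2 ≤ (4 * ρ + 4 * π * |τ|) * F ^ 2 := by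
      have e1 : ρ * f ^ 2 ≤ 2 * F * (ρ * f + π * |τ| * F) := by
        calc ρ * f ^ 2 ≤ ρ * (2 * F * f2) := by gcongr
          _ = 2 * F * (ρ * f2) := by ring
          _ ≤ _ := by gcongr
      have e2 : 0 ≤ ρ * (f - 2 * F) ^ 2 := by positivity
      nlinarith
    have k2 : c ^ 2 ≤ 2 * C ^ 2 * F ^ 2 + 8 * f ^ 2 := by
      have : (c + 2 * f) ^ 2 ≤ (C * F) ^ 2 := sq_le_sq' (abs_le.1 h22).1 (abs_le.1 h22).2
      nlinarith [sq_nonneg (c + 4 * f)]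
    calc ρ * c ^ 2 ≤ ρ * (2 * C ^ 2 * F ^ 2 + 8 * f ^ 2) := by gcongr
      _ = 2 * C ^ 2 * ρ * F ^ 2 + 8 * (ρ * f ^ 2) := by ring
      _ ≤ 2 * C ^ 2 * ρ * F ^ 2 + 8 * ((4 * ρ + 4 * π * |τ|) * F ^ 2) := by gcongr
      _ = (2 * C ^ 2 * ρ + 32 * ρ + 32 * π * |τ|) * F ^ 2 := by ring
      _ ≤ _ := by
        gcongr
        have : 2 * C ^ 2 * ρ ≤ 2 * C ^ 2 * R := by gcongr
        nlinarith [mul_nonneg (sq_nonneg C) hτ, mul_nonneg hp.le hR0]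
  · have h1 := h21 j hj
    set c := Fc (fun x => GW k a r x * cth (a j * x)) τ
    have : c ^ 2 ≤ (C * F) ^ 2 := sq_le_sq' (abs_le.1 h1).1 (abs_le.1 h1).2
    calc r j * c ^ 2 ≤ R * (C * F) ^ 2 := by gcongr
      _ = (C ^ 2 * R) * F ^ 2 := by ring
      _ ≤ _ := by
        refine mul_le_mul_of_nonneg_right ?_ (sq_nonneg F)
        have : 0 ≤ C ^ 2 * R := by positivity
        have : 0 ≤ (32 + 32 * π) * (1 + R + |τ|) := by positivity
        have : 0 ≤ C ^ 2 * (1 + |τ|) := by positivity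
        linarith

set_option maxHeartbeats 800000 in
lemma A4 (h : Par k a) : ∃ c > 0, ∃ C > 0, ∀ r : Fin (l + 1) → ℝ, (∀ j, 0 ≤ r j) → ∀ τ,
    (c * (∑ j, r j + |τ|) - C) * Fc (GW k a r) τ ≤
     ∑ j, r j / 4 * Fc (fun x => GW k a r x * ssh (a j * x) ^ 2) τ - ∑ j, k j * Fc (fun x => GW k a r x * cth (a j * x)) τ := by
  obtain ⟨C, hC, h2⟩ := T2 h
  obtain ⟨C5, hC5, h5⟩ := T5 h
  set E := Real.exp (8 * π ^ 2) with hE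
  have hE1 : 1 ≤ E := Real.one_le_exp (by positivity)
  set δ := 1 / (72 * E) with hδ
  have hδ0 : 0 < δ := by positivity
  have hδ1 : δ ≤ 1 := by rw [hδ, div_le_one (by positivity)]; linarith
  set N : ℝ := ∑ j, (k j : ℝ)
  have hN0 : 0 ≤ N := by positivity
  set c := δ / (2 * C5 + 2) with hc
  have hc0 : 0 < c := by positivity
  have hcC : c * (2 * C5 + 2) = δ := by rw [hc]; field_simp
  have hcC5 : c * C5 ≤ δ / 2 := by nlinarith
  have hcδ : c ≤ δ / 2 := by nlinarith
  refine ⟨c, hc0, N * C + 1, by positivity, fun r hr τ => ?_⟩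
  have hR0 : 0 ≤ ∑ j, r j := Finset.sum_nonneg fun j _ => hr j
  obtain ⟨h21, h22⟩ := h2 r hr τ
  have h5 := h5 r hr τ
  obtain ⟨h6, h6'⟩ := T6 h hr τ
  obtain ⟨h7, h71, h72⟩ := T7 h hr τ
  have hF : 0 ≤ Fc (GW k a r) τ := T0 h hr τ
  set F := Fc (GW k a r) τ
  set f := Fc (fun x => GW k a r x * lap π x) τ
  set f2 := Fc (fun x => GW k a r x * lap π x ^ 2) τ
  have s1 : ∀ j, k j * Fc (fun x => GW k a r x * cth (a j * x)) τ ≤ k j * (C * F) - (if j = Fin.last l then 2 * f else 0) := by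
    intro j
    split_ifs with hj
    · subst hj
      have : (1 : ℝ) ≤ k (Fin.last l) := by exact_mod_cast h.hk _
      have h3 := (abs_le.1 h22).2
      calc k (Fin.last l) * Fc (fun x => GW k a r x * cth (a (Fin.last l) * x)) τ ≤ k (Fin.last l) * (C * F - 2 * f) := by
            gcongr; linarith
        _ ≤ _ := by nlinarith
    · have h3 := (abs_le.1 (h21 j hj)).2
      rw [sub_zero]
      gcongr
  have s2 : ∑ j, k j * Fc (fun x => GW k a r x * cth (a j * x)) τ ≤ N * (C * F) - 2 * f := by
    refine (Finset.sum_le_sum fun j _ => s1 j).trans ?_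
    rw [Finset.sum_sub_distrib, ← Finset.sum_mul]
    simp [N]
  have s3 : ∀ j, δ * r j * F + (if j = Fin.last l then δ * r j * f2 else 0) ≤ r j / 4 * Fc (fun x => GW k a r x * ssh (a j * x) ^ 2) τ := by
    intro j
    have hrj := hr j
    have hδE : δ * E = 1 / 72 := by rw [hδ]; field_simp
    split_ifs with hj
    · subst hj
      set S := Fc (fun x => GW k a r x * ssh (a (Fin.last l) * x) ^ 2) τ
      have hS : δ * F + δ * f2 ≤ 1 / 4 * S := by
        have q1 := mul_le_mul_of_nonneg_left (h6 (Fin.last l)) hδ0.le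
        have q2 := mul_le_mul_of_nonneg_left h6' hδ0.le
        rw [← mul_assoc, hδE] at q1 q2
        have : 0 ≤ S := by nlinarith
        linarith
      nlinarith
    · set S := Fc (fun x => GW k a r x * ssh (a j * x) ^ 2) τ
      have hS : δ * F ≤ 1 / 4 * S := by
        have q1 := mul_le_mul_of_nonneg_left (h6 j) hδ0.le
        rw [← mul_assoc, hδE] at q1
        have : 0 ≤ S := by nlinarith [h6 j]
        linarith
      nlinarith
  have s4 : δ * (∑ j, r j) * F + δ * r (Fin.last l) * f2 ≤ ∑ j, r j / 4 * Fc (fun x => GW k a r x * ssh (a j * x) ^ 2) τ := by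
    refine le_trans (le_of_eq ?_) (Finset.sum_le_sum fun j _ => s3 j)
    rw [Finset.sum_add_distrib, Finset.mul_sum, Finset.sum_mul]
    simp
  set R := ∑ j, r j
  set ρ := r (Fin.last l)
  have hρ : 0 ≤ ρ := hr _
  have s5 := mul_le_mul_of_nonneg_left h5 hc0.le
  have s6 : c * (C5 * (1 + R) * F + C5 * f + ρ * f2) ≤ δ / 2 * (1 + R) * F + δ / 2 * f + δ * ρ * f2 := by
    calc _ = c * C5 * ((1 + R) * F) + c * C5 * f + c * (ρ * f2) := by ring
      _ ≤ δ / 2 * ((1 + R) * F) + δ / 2 * f + δ * (ρ * f2) := by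
        gcongr; linarith
      _ = _ := by ring
  have s7 : c * R * F ≤ δ / 2 * R * F := by gcongr
  have s8 : δ / 2 * F ≤ F := by nlinarith
  have s9 : δ / 2 * f ≤ 2 * f := by nlinarith
  linarith
end

lemma ssh_meas : Measurable ssh :=
  Measurable.ite (measurableSet_singleton 0) measurable_const (measurable_id.div Real.measurable_sinh)

lemma cth_meas : Measurable cth :=
  Measurable.ite (measurableSet_singleton 0) measurable_const
    (measurable_id.mul (Real.measurable_cosh.div Real.measurable_sinh))

lemma cth_sq (x : ℝ) : cth x ^ 2 - x ^ 2 = ssh x ^ 2 := by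
  unfold cth ssh
  split_ifs with h
  · subst h; norm_num
  · have : Real.sinh x ≠ 0 := by simpa [Real.sinh_eq_zero] using h
    have h2 := Real.cosh_sq x
    field_simp
    rw [h2]; ring

lemma ssh_pos (x : ℝ) : 0 < ssh x := by
  unfold ssh
  split_ifs with h
  · norm_num
  · rcases lt_or_gt_of_ne h with h | h
    · exact div_pos_of_neg_of_neg h (Real.sinh_neg_iff.2 h)
    · exact div_pos h (Real.sinh_pos_iff.2 h)

lemma ssh_le_prod (N : ℕ) (x : ℝ) : ssh x ≤ ∏ m ∈ Finset.range N, lap ((m + 1) * π) x := by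
  have h := prod_lap_tendsto one_pos x
  rw [one_mul] at h
  refine le_of_tendsto h ?_
  filter_upwards [eventually_ge_atTop N] with K hK
  simp only [div_one]
  exact Finset.prod_le_prod_of_subset_of_le_one (Finset.range_mono hK)
    (fun m _ => (lap_pos (by positivity) x).le) (fun m _ _ => lap_le_one (by positivity) x)

lemma ssh_le_one (x : ℝ) : ssh x ≤ 1 := by simpa using ssh_le_prod 0 x

lemma lap_le_inv {b : ℝ} (hb : 1 ≤ b) (x : ℝ) : lap b x ≤ b ^ 2 * (1 + x ^ 2)⁻¹ := by
  unfold lap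
  rw [div_eq_mul_inv]
  have : 1 ≤ b ^ 2 := by nlinarith
  gcongr

lemma ssh_decay : ∃ C > 0, ∀ x, ssh x ≤ C * ((1 + x ^ 2)⁻¹) ^ 4 := by
  have hp := pi_gt_three
  refine ⟨∏ m ∈ Finset.range 4, (((m : ℝ) + 1) * π) ^ 2, by positivity, fun x => ?_⟩
  refine (ssh_le_prod 4 x).trans ?_
  calc _ ≤ ∏ m ∈ Finset.range 4, ((((m : ℝ) + 1) * π) ^ 2 * (1 + x ^ 2)⁻¹) := by
        refine Finset.prod_le_prod (fun m _ => (lap_pos (by positivity) x).le) fun m _ => lap_le_inv ?_ x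
        have : (0 : ℝ) ≤ m := by positivity
        nlinarith
    _ = _ := by rw [Finset.prod_mul_distrib]; simp

section
variable {l : ℕ} {k : Fin (l + 1) → ℕ} {a r : Fin (l + 1) → ℝ}

lemma Par.cth_bd (h : Par k a) (j : Fin (l + 1)) (x : ℝ) : 0 ≤ cth (a j * x) ∧ cth (a j * x) ≤ 4 * (1 + x ^ 2) := by
  have h1 := h.cKf_tendsto j x
  constructor
  · refine ge_of_tendsto' h1 fun K => ?_
    have : 0 ≤ ∑ m ∈ Finset.range K, (1 - lap (bbf a (j, m)) x) :=
      Finset.sum_nonneg fun m _ => one_sub_lap_nonneg (bbf_pos h.ha _) x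
    unfold cKf; positivity
  · exact le_of_tendsto' h1 fun K => (le_abs_self _).trans (h.cKf_bd j K x)

lemma GW_meas : Measurable (GW k a r) := by
  unfold GW
  have h1 : ∀ j, Measurable fun x => ssh (a j * x) := fun j => ssh_meas.comp (measurable_const.mul measurable_id)
  have h2 : ∀ j, Measurable fun x => cth (a j * x) := fun j => cth_meas.comp (measurable_const.mul measurable_id)
  fun_prop

lemma GW_pos (x : ℝ) : 0 < GW k a r x := by
  unfold GW
  have : 0 < ∏ j, ssh (a j * x) ^ k j := Finset.prod_pos fun j _ => pow_pos (ssh_pos _) _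
  positivity

/-- uniform decay of the weight -/
lemma Par.GW_decay (h : Par k a) : ∃ C > 0, ∀ r : Fin (l + 1) → ℝ, (∀ j, 0 ≤ r j) → ∀ x, GW k a r x ≤ C * ((1 + x ^ 2)⁻¹) ^ 4 := by
  obtain ⟨C, hC, hs⟩ := ssh_decay
  refine ⟨C, hC, fun r hr x => ?_⟩
  unfold GW
  have e1 : Real.exp (-∑ j, r j / 4 * cth (a j * x)) ≤ 1 := by
    rw [Real.exp_le_one_iff, neg_nonpos]
    exact Finset.sum_nonneg fun j _ => mul_nonneg (by have := hr j; positivity) (h.cth_bd j x).1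
  have e2 : ∏ j, ssh (a j * x) ^ k j ≤ C * ((1 + x ^ 2)⁻¹) ^ 4 := by
    rw [Fin.prod_univ_castSucc]
    have e3 : ∏ j : Fin l, ssh (a j.castSucc * x) ^ k j.castSucc ≤ 1 :=
      Finset.prod_le_one (fun j _ => (pow_pos (ssh_pos _) _).le) fun j _ => pow_le_one₀ (ssh_pos _).le (ssh_le_one _)
    have e4 : ssh (a (Fin.last l) * x) ^ k (Fin.last l) ≤ C * ((1 + x ^ 2)⁻¹) ^ 4 := by
      refine (pow_le_of_le_one (ssh_pos _).le (ssh_le_one _) (h.hk _).ne').trans ?_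
      rw [h.hlast, one_mul]; exact hs x
    have e5 : 0 < ssh (a (Fin.last l) * x) ^ k (Fin.last l) := pow_pos (ssh_pos _) _
    calc _ ≤ 1 * (ssh (a (Fin.last l) * x) ^ k (Fin.last l)) := by gcongr
      _ ≤ _ := by rwa [one_mul]
  have : 0 < ∏ j, ssh (a j * x) ^ k j := Finset.prod_pos fun j _ => pow_pos (ssh_pos _) _
  calc _ ≤ (∏ j, ssh (a j * x) ^ k j) * 1 := by gcongr
    _ ≤ _ := by rwa [mul_one]

/-- general oscillatory integral -/
def Qf (k : Fin (l + 1) → ℕ) (a : Fin (l + 1) → ℝ) (m : ℝ → ℝ) (φ : ℝ) (r : Fin (l + 1) → ℝ) (τ : ℝ) : ℝ :=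
  ∫ x : ℝ, m x * GW k a r x * Real.cos (x * τ + φ)

/-- polynomial growth -/
structure PG (N : ℕ) (m : ℝ → ℝ) : Prop where
  meas : Measurable m
  bd : ∃ C ≥ 0, ∀ x, |m x| ≤ C * (1 + x ^ 2) ^ N

lemma Par.bound (h : Par k a) {m : ℝ → ℝ} (hm : PG 3 m) :
    ∃ C, ∀ r : Fin (l + 1) → ℝ, (∀ j, 0 ≤ r j) → ∀ x, |m x| * GW k a r x ≤ C * (1 + x ^ 2)⁻¹ := by
  obtain ⟨C, hC, h1⟩ := h.GW_decay
  obtain ⟨C', hC', h2⟩ := hm.bd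
  refine ⟨C' * C, fun r hr x => ?_⟩
  calc |m x| * GW k a r x ≤ (C' * (1 + x ^ 2) ^ 3) * (C * ((1 + x ^ 2)⁻¹) ^ 4) :=
        mul_le_mul (h2 x) (h1 r hr x) (GW_pos x).le (by positivity)
    _ = _ := by field_simp

lemma Qf_meas {m : ℝ → ℝ} (hm : Measurable m) (φ : ℝ) (r : Fin (l + 1) → ℝ) (τ : ℝ) :
    AEStronglyMeasurable (fun x => m x * GW k a r x * Real.cos (x * τ + φ)) := by
  have := GW_meas (k := k) (a := a) (r := r)
  exact Measurable.aestronglyMeasurable (by fun_prop)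

lemma Qf_pt_le (m : ℝ → ℝ) (φ : ℝ) (r : Fin (l + 1) → ℝ) (τ x : ℝ) :
    ‖m x * GW k a r x * Real.cos (x * τ + φ)‖ ≤ |m x| * GW k a r x := by
  rw [Real.norm_eq_abs, abs_mul, abs_mul, abs_of_pos (GW_pos (k := k) (a := a) (r := r) x)]
  have h3 := Real.abs_cos_le_one (x * τ + φ)
  have := (GW_pos (k := k) (a := a) (r := r) x).le
  calc _ ≤ |m x| * GW k a r x * 1 := by gcongr
    _ = _ := mul_one _

lemma Par.Qf_int (h : Par k a) {m : ℝ → ℝ} (hm : PG 3 m) (φ : ℝ) (hr : ∀ j, 0 ≤ r j) (τ : ℝ) :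
    Integrable (fun x => m x * GW k a r x * Real.cos (x * τ + φ)) := by
  obtain ⟨C, hC⟩ := h.bound hm
  exact (integrable_inv_one_add_sq.const_mul C).mono' (Qf_meas hm.meas φ r τ)
    (Eventually.of_forall fun x => (Qf_pt_le m φ r τ x).trans (hC r hr x))

lemma Par.Qf_cont (h : Par k a) {m : ℝ → ℝ} (hm : PG 3 m) (φ : ℝ) {X : Type*} [TopologicalSpace X] [FirstCountableTopology X]
    {ρ : X → Fin (l + 1) → ℝ} {T : X → ℝ} (hρ : Continuous ρ) (hT : Continuous T) (h0 : ∀ x j, 0 ≤ ρ x j) :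
    Continuous (fun s => Qf k a m φ (ρ s) (T s)) := by
  obtain ⟨C, hC⟩ := h.bound hm
  unfold Qf
  refine continuous_of_dominated (fun s => Qf_meas hm.meas φ _ _)
    (fun s => Eventually.of_forall fun x => (Qf_pt_le m φ _ _ x).trans (hC _ (h0 s) x)) (integrable_inv_one_add_sq.const_mul C)
    (Eventually.of_forall fun x => ?_)
  unfold GW
  have : ∀ j, Continuous fun s => ρ s j := fun j => (continuous_apply j).comp hρ
  fun_prop

lemma PG.mono {N N' : ℕ} {m : ℝ → ℝ} (hm : PG N m) (hN : N ≤ N') : PG N' m := by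
  obtain ⟨C, h0, hC⟩ := hm.bd
  refine ⟨hm.meas, C, h0, fun x => (hC x).trans ?_⟩
  gcongr
  nlinarith [sq_nonneg x]

lemma PG.mul {N N' : ℕ} {m m' : ℝ → ℝ} (hm : PG N m) (hm' : PG N' m') : PG (N + N') (fun x => m x * m' x) := by
  obtain ⟨C, h0, hC⟩ := hm.bd
  obtain ⟨C', h0', hC'⟩ := hm'.bd
  refine ⟨hm.meas.mul hm'.meas, C * C', by positivity, fun x => ?_⟩
  rw [abs_mul]
  calc _ ≤ (C * (1 + x ^ 2) ^ N) * (C' * (1 + x ^ 2) ^ N') := mul_le_mul (hC x) (hC' x) (abs_nonneg _) (by positivity)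
    _ = _ := by ring

lemma PG_one : PG 0 (fun _ => 1) := ⟨measurable_const, 1, by norm_num, fun x => by simp⟩

lemma PG_id : PG 1 (fun x => x) := ⟨measurable_id, 1, by norm_num, fun x => by
  rw [abs_le]; constructor <;> nlinarith [sq_nonneg (x - 1), sq_nonneg (x + 1)]⟩

lemma Par.PG_cth (h : Par k a) (j : Fin (l + 1)) : PG 1 (fun x => cth (a j * x)) :=
  ⟨cth_meas.comp (measurable_const.mul measurable_id), 4, by norm_num, fun x => by
    rw [abs_of_nonneg (h.cth_bd j x).1, pow_one]; exact (h.cth_bd j x).2⟩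

/-- shift of one radius -/
lemma GW_shift (i : Fin (l + 1)) (δ x : ℝ) :
    GW k a (fun j => r j + if j = i then δ else 0) x = GW k a r x * Real.exp (-(δ / 4 * cth (a i * x))) := by
  unfold GW
  rw [mul_assoc, ← Real.exp_add]
  congr 2
  have : ∀ j, (r j + if j = i then δ else 0) / 4 * cth (a j * x) = r j / 4 * cth (a j * x) + if j = i then δ / 4 * cth (a i * x) else 0 := by
    intro j
    split_ifs with hj
    · subst hj; ring
    · ring
  simp_rw [this, Finset.sum_add_distrib]
  simp
  ring

lemma Par.Qf_deriv (h : Par k a) {m : ℝ → ℝ} (hm : PG 2 m) (φ : ℝ) (i : Fin (l + 1)) (κ v τ : ℝ)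
    (h0 : ∀ s j, 0 ≤ r j + if j = i then 2 * s * κ + s ^ 2 else 0) :
    HasDerivAt (fun s => Qf k a m φ (fun j => r j + if j = i then 2 * s * κ + s ^ 2 else 0) (τ + s * v))
      (-(κ / 2) * Qf k a (fun x => m x * cth (a i * x)) φ r τ + v * Qf k a (fun x => m x * x) (φ + π / 2) r τ) 0 := by
  have hr : ∀ j, 0 ≤ r j := fun j => by simpa using h0 0 j
  set F : ℝ → ℝ → ℝ := fun s x => m x * GW k a (fun j => r j + if j = i then 2 * s * κ + s ^ 2 else 0) x * Real.cos (x * (τ + s * v) + φ)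
  set F' : ℝ → ℝ → ℝ := fun s x => -((κ + s) / 2) * (m x * cth (a i * x) * GW k a (fun j => r j + if j = i then 2 * s * κ + s ^ 2 else 0) x * Real.cos (x * (τ + s * v) + φ)) 
     + v * (m x * x * GW k a (fun j => r j + if j = i then 2 * s * κ + s ^ 2 else 0) x * Real.cos (x * (τ + s * v) + (φ + π / 2)))
  have p1 : PG 3 (fun x => m x * cth (a i * x)) := hm.mul (h.PG_cth i)
  have p2 : PG 3 (fun x => m x * x) := hm.mul PG_id
  obtain ⟨C1, hC1⟩ := h.bound p1
  obtain ⟨C2, hC2⟩ := h.bound p2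
  have key := hasDerivAt_integral_of_dominated_loc_of_deriv_le (μ := volume) (F := F) (F' := F') (x₀ := (0 : ℝ)) (s := Set.Ioo (-1) 1)
    (bound := fun x => ((|κ| + 1) * C1 + |v| * C2) * (1 + x ^ 2)⁻¹)
    (Ioo_mem_nhds (by norm_num) (by norm_num)) (Eventually.of_forall fun s => Qf_meas hm.meas φ _ _)
    (h.Qf_int (hm.mono (by norm_num)) φ (h0 0) _) ?_ ?_ (integrable_inv_one_add_sq.const_mul _) ?_
  · refine key.2.congr_deriv ?_
    simp only [F']
    rw [integral_add, integral_const_mul, integral_const_mul]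
    · simp [Qf]
    · exact (h.Qf_int p1 φ (h0 0) _).const_mul _
    · exact (h.Qf_int p2 _ (h0 0) _).const_mul _
  · exact ((Qf_meas p1.meas φ _ _).const_mul _).add ((Qf_meas p2.meas _ _ _).const_mul _)
  · refine Eventually.of_forall fun x s hs => ?_
    have b1 := (Qf_pt_le (fun x => m x * cth (a i * x)) φ _ (τ + s * v) x).trans (hC1 _ (h0 s) x)
    have b2 := (Qf_pt_le (fun x => m x * x) (φ + π / 2) _ (τ + s * v) x).trans (hC2 _ (h0 s) x)
    refine (norm_add_le _ _).trans ?_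
    rw [norm_mul, norm_mul v]
    have b3 : ‖-((κ + s) / 2)‖ ≤ |κ| + 1 := by
      rw [norm_neg, Real.norm_eq_abs, abs_div, abs_two]
      have := abs_add_le κ s
      have : |s| ≤ 1 := abs_le.2 ⟨hs.1.le, hs.2.le⟩
      have := abs_nonneg κ
      linarith
    rw [Real.norm_eq_abs v]
    have e : ((|κ| + 1) * C1 + |v| * C2) * (1 + x ^ 2)⁻¹ = (|κ| + 1) * (C1 * (1 + x ^ 2)⁻¹) + |v| * (C2 * (1 + x ^ 2)⁻¹) := by ring
    rw [e]
    refine add_le_add (mul_le_mul b3 b1 (norm_nonneg _) (by positivity)) (mul_le_mul_of_nonneg_left b2 (abs_nonneg _))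
  · refine Eventually.of_forall fun x s hs => ?_
    simp only [F, F', GW_shift]
    have d1 : HasDerivAt (fun s : ℝ => -((2 * s * κ + s ^ 2) / 4 * cth (a i * x))) (-((2 * κ + 2 * s) / 4 * cth (a i * x))) s := by
      have := ((((hasDerivAt_id s).const_mul 2).mul_const κ).add (hasDerivAt_pow 2 s))
      refine (((this.div_const 4).mul_const (cth (a i * x))).neg).congr_deriv ?_
      simp
    have d2 : HasDerivAt (fun s : ℝ => x * (τ + s * v) + φ) (x * v) s := by
      have := ((((hasDerivAt_id s).mul_const v).const_add τ).const_mul x).add_const φ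
      simpa using this
    refine (((d1.exp.const_mul (GW k a r x)).const_mul (m x)).mul d2.cos).congr_deriv ?_
    rw [← add_assoc, Real.cos_add_pi_div_two]
    ring

lemma Qf_one (r : Fin (l + 1) → ℝ) (τ : ℝ) : Qf k a (fun _ => 1) 0 r τ = Fc (GW k a r) τ := by
  unfold Qf Fc; simp

lemma Qf_zero (m : ℝ → ℝ) (r : Fin (l + 1) → ℝ) (τ : ℝ) : Qf k a m 0 r τ = Fc (fun x => GW k a r x * m x) τ := by
  unfold Qf Fc; simp only [add_zero]
  congr 1; ext x; ring

lemma Qf_id (r : Fin (l + 1) → ℝ) (τ : ℝ) : Qf k a (fun x => x) (π / 2) r τ = - Fs (GW k a r) τ := by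
  unfold Qf Fs; rw [← integral_neg]
  congr 1; ext x; rw [Real.cos_add_pi_div_two]; ring

lemma Par.Fc_pos (h : Par k a) (hr : ∀ j, 0 ≤ r j) (τ : ℝ) : 0 < Fc (GW k a r) τ := by
  have hi : Integrable (GW k a r) := by
    have := h.Qf_int (PG_one.mono (by norm_num)) 0 hr 0
    simpa using this
  have hi' : Integrable (fun x => x * GW k a r x) := by
    have := h.Qf_int (PG_id.mono (by norm_num)) 0 hr 0
    simpa using this
  have h00 : 0 < Fc (GW k a r) 0 := by
    unfold Fc
    simp only [mul_zero, Real.cos_zero, mul_one]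
    rw [integral_pos_iff_support_of_nonneg (fun x => (GW_pos x).le) hi]
    have : Function.support (GW k a r) = Set.univ := by
      ext x; simp [(GW_pos (k := k) (a := a) (r := r) x).ne']
    rw [this]; simp
  rw [← Fc_abs]
  have hmono : Monotone (fun s => Real.exp (π * s) * Fc (GW k a r) s) := by
    have hd : ∀ s, HasDerivAt (fun s => Real.exp (π * s) * Fc (GW k a r) s) (Real.exp (π * s) * (π * Fc (GW k a r) s - Fs (GW k a r) s)) s := by
      intro s
      have e1 : HasDerivAt (fun s => Real.exp (π * s)) (Real.exp (π * s) * π) s := by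
        have := ((hasDerivAt_id s).const_mul π).exp
        simpa using this
      exact (e1.mul (Fc_hasDerivAt hi hi' s)).congr_deriv (by ring)
    refine monotone_of_deriv_nonneg (fun s => (hd s).differentiableAt) fun s => ?_
    rw [(hd s).deriv]
    have := (abs_le.1 (T1 h hr s)).2
    have : 0 ≤ π * Fc (GW k a r) s - Fs (GW k a r) s := by linarith
    positivity
  have := hmono (abs_nonneg τ)
  simp only [mul_zero, Real.exp_zero, one_mul] at this
  have h2 := h00.trans_le this
  exact pos_of_mul_pos_right h2 (Real.exp_pos _).le
end

/-- index set of horizontal directions -/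
abbrev Dix {l : ℕ} (k : Fin (l + 1) → ℕ) : Type := (i : Fin (l + 1)) × (Fin (k i) × Bool)

section
variable {l : ℕ} {k : Fin (l + 1) → ℕ} {a : Fin (l + 1) → ℝ}

/-- coordinate in the direction -/
def kap (e : Dix k) (g : Heis l k) : ℝ := if e.2.2 then (g.1 e.1 e.2.1).re else (g.1 e.1 e.2.1).im

/-- conjugate coordinate -/
def sig (e : Dix k) (g : Heis l k) : ℝ := if e.2.2 then (g.1 e.1 e.2.1).im else -(g.1 e.1 e.2.1).re

/-- unit complex number of the direction -/
def uni (e : Dix k) : ℂ := if e.2.2 then 1 else Complex.I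

/-- horizontal direction at `g` -/
def hdir (a : Fin (l + 1) → ℝ) (e : Dix k) (g : Heis l k) : Heis l k :=
  (Pi.single e.1 (Pi.single e.2.1 (uni e)), 2 * a e.1 * sig e g)

/-- derivative along the direction -/
def VF (a : Fin (l + 1) → ℝ) (e : Dix k) (f : Heis l k → ℝ) (g : Heis l k) : ℝ := lineDeriv ℝ f g (hdir a e g)

lemma sum_Dix (F : Dix k → ℝ) : ∑ e, F e = ∑ i, ∑ j, (F ⟨i, j, true⟩ + F ⟨i, j, false⟩) := by
  rw [Fintype.sum_sigma]
  refine Finset.sum_congr rfl fun i _ => ?_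
  rw [Fintype.sum_prod_type]
  refine Finset.sum_congr rfl fun j _ => ?_
  rw [Fintype.sum_bool]

lemma gradNorm_eq (f : Heis l k → ℝ) (g : Heis l k) : gradNorm l k a f g = Real.sqrt (∑ e : Dix k, VF a e f g ^ 2) := by
  unfold gradNorm
  rw [sum_Dix]
  simp [VF, hdir, uni, sig, Xvf, Yvf]

lemma line_fst (e : Dix k) (g : Heis l k) (s : ℝ) (i : Fin (l + 1)) (j : Fin (k i)) :
    (g + s • hdir a e g).1 i j = g.1 i j + s * (Pi.single (M := fun i => Fin (k i) → ℂ) e.1 (Pi.single e.2.1 (uni e)) i j) := by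
  simp [hdir]

lemma line_snd (e : Dix k) (g : Heis l k) (s : ℝ) : (g + s • hdir a e g).2 = g.2 + s * (2 * a e.1 * sig e g) := by
  simp [hdir]

lemma line_self (e : Dix k) (g : Heis l k) (s : ℝ) :
    (g + s • hdir a e g).1 e.1 e.2.1 = g.1 e.1 e.2.1 + s * uni e := by
  rw [line_fst]; simp

lemma line_other (e : Dix k) (g : Heis l k) (s : ℝ) {i : Fin (l + 1)} (hi : i ≠ e.1) (j : Fin (k i)) :
    (g + s • hdir a e g).1 i j = g.1 i j := by
  rw [line_fst]; simp [Pi.single_eq_of_ne hi]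

lemma line_other' (e : Dix k) (g : Heis l k) (s : ℝ) {j : Fin (k e.1)} (hj : j ≠ e.2.1) :
    (g + s • hdir a e g).1 e.1 j = g.1 e.1 j := by
  rw [line_fst]; simp [Pi.single_eq_of_ne hj]

lemma line_zNormSq (e : Dix k) (g : Heis l k) (s : ℝ) : zNormSq l k (g + s • hdir a e g).1 =
    fun j => zNormSq l k g.1 j + if j = e.1 then 2 * s * kap e g + s ^ 2 else 0 := by
  ext j
  unfold zNormSq
  split_ifs with hj
  · subst hj
    rw [← Finset.add_sum_erase _ _ (Finset.mem_univ e.2.1), ← Finset.add_sum_erase _ (fun j => Complex.normSq (g.1 e.1 j)) (Finset.mem_univ e.2.1)]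
    rw [line_self]
    have : ∑ x ∈ Finset.univ.erase e.2.1, Complex.normSq ((g + s • hdir a e g).1 e.1 x) = ∑ x ∈ Finset.univ.erase e.2.1, Complex.normSq (g.1 e.1 x) :=
      Finset.sum_congr rfl fun x hx => by rw [line_other' e g s (Finset.ne_of_mem_erase hx)]
    rw [this]
    simp only [Complex.normSq_apply, kap, uni]
    split_ifs <;> simp <;> ring
  · rw [add_zero]
    exact Finset.sum_congr rfl fun x hx => by rw [line_other e g s hj]

lemma line_kap (e : Dix k) (g : Heis l k) (s : ℝ) : kap e (g + s • hdir a e g) = kap e g + s := by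
  unfold kap; rw [line_self]; unfold uni; split_ifs <;> simp

lemma line_sig (e : Dix k) (g : Heis l k) (s : ℝ) : sig e (g + s • hdir a e g) = sig e g := by
  unfold sig; rw [line_self]; unfold uni; split_ifs <;> simp

lemma line_hdir (e : Dix k) (g : Heis l k) (s : ℝ) : hdir a e (g + s • hdir a e g) = hdir a e g := by
  simp [hdir, line_sig e g s]
  have := line_sig (a := a) e g s
  simp [hdir] at this
  rw [this]; simp

lemma zNormSq_nonneg (z : (i : Fin (l + 1)) → Fin (k i) → ℂ) (j : Fin (l + 1)) : 0 ≤ zNormSq l k z j :=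
  Finset.sum_nonneg fun _ _ => Complex.normSq_nonneg _

lemma zNormSq_cont : Continuous (fun g : Heis l k => zNormSq l k g.1) := by
  unfold zNormSq
  have := Complex.continuous_normSq
  fun_prop

/-- the oscillatory integral as a function on the group -/
def Pm (a : Fin (l + 1) → ℝ) (m : ℝ → ℝ) (φ : ℝ) (g : Heis l k) : ℝ := Qf k a m φ (zNormSq l k g.1) (g.2 / 4)

lemma Par.Pm_cont (h : Par k a) {m : ℝ → ℝ} (hm : PG 3 m) (φ : ℝ) : Continuous (Pm (k := k) a m φ) :=
  h.Qf_cont hm φ zNormSq_cont (by fun_prop) fun g j => zNormSq_nonneg _ _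

lemma Par.Pm_deriv (h : Par k a) {m : ℝ → ℝ} (hm : PG 2 m) (φ : ℝ) (e : Dix k) (g : Heis l k) :
    HasLineDerivAt ℝ (Pm a m φ) (-(kap e g / 2) * Pm a (fun x => m x * cth (a e.1 * x)) φ g
      + a e.1 * sig e g / 2 * Pm a (fun x => m x * x) (φ + π / 2) g) g (hdir a e g) := by
  have := h.Qf_deriv (r := zNormSq l k g.1) hm φ e.1 (kap e g) (a e.1 * sig e g / 2) (g.2 / 4) (fun s j => by
    have := zNormSq_nonneg (g + s • hdir a e g).1 j
    rw [line_zNormSq] at this; exact this)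
  unfold HasLineDerivAt
  refine this.congr_of_eventuallyEq (Eventually.of_forall fun s => ?_)
  simp only [Pm]
  rw [line_zNormSq, line_snd]
  congr 1
  ring

/-- normalization constant of the heat kernel -/
def An (k : Fin (l + 1) → ℕ) : ℝ := (2 * (4 * π) ^ ((∑ i, k i) + 1))⁻¹

lemma An_pos : 0 < An k := by unfold An; positivity

/-- heat kernel as a real integral -/
def pk (a : Fin (l + 1) → ℝ) (g : Heis l k) : ℝ := An k * Pm a (fun _ => 1) 0 g

/-- first derivatives -/
def p1 (a : Fin (l + 1) → ℝ) (e : Dix k) (g : Heis l k) : ℝ :=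
  An k * (-(kap e g / 2) * Pm a (fun x => 1 * cth (a e.1 * x)) 0 g + a e.1 * sig e g / 2 * Pm a (fun x => 1 * x) (0 + π / 2) g)

/-- second derivatives -/
def p2 (a : Fin (l + 1) → ℝ) (e : Dix k) (g : Heis l k) : ℝ :=
  An k * ((-(1 / 2) * Pm a (fun x => 1 * cth (a e.1 * x)) 0 g +
    -(kap e g / 2) * (-(kap e g / 2) * Pm a (fun x => 1 * cth (a e.1 * x) * cth (a e.1 * x)) 0 g
      + a e.1 * sig e g / 2 * Pm a (fun x => 1 * cth (a e.1 * x) * x) (0 + π / 2) g)) +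
   a e.1 * sig e g / 2 * (-(kap e g / 2) * Pm a (fun x => 1 * x * cth (a e.1 * x)) (0 + π / 2) g
      + a e.1 * sig e g / 2 * Pm a (fun x => 1 * x * x) (0 + π / 2 + π / 2) g))

lemma kap_cont (e : Dix k) : Continuous (kap e) := by
  unfold kap; split_ifs
  · exact Complex.continuous_re.comp (by fun_prop)
  · exact Complex.continuous_im.comp (by fun_prop)

lemma sig_cont (e : Dix k) : Continuous (sig e) := by
  unfold sig; split_ifs
  · exact Complex.continuous_im.comp (by fun_prop)
  · exact (Complex.continuous_re.comp (by fun_prop)).neg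

lemma Par.pk_deriv (h : Par k a) (e : Dix k) (g : Heis l k) : HasLineDerivAt ℝ (pk a) (p1 a e g) g (hdir a e g) :=
  HasDerivAt.const_mul (An k) (h.Pm_deriv (PG_one.mono (by norm_num)) 0 e g)

lemma Par.p1_deriv (h : Par k a) (e : Dix k) (g : Heis l k) : HasLineDerivAt ℝ (p1 a e) (p2 a e g) g (hdir a e g) := by
  have d1 := h.Pm_deriv ((PG_one.mul (h.PG_cth e.1)).mono (by norm_num)) 0 e g
  have d2 := h.Pm_deriv ((PG_one.mul (PG_id)).mono (by norm_num)) (0 + π / 2) e g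
  unfold HasLineDerivAt at d1 d2 ⊢
  have d3 : HasDerivAt (fun s : ℝ => -(kap e (g + s • hdir a e g) / 2)) (-(1 / 2)) 0 := by
    simp_rw [line_kap]
    exact (((hasDerivAt_id (0:ℝ)).const_add _).div_const 2).neg
  have d4 : HasDerivAt (fun s : ℝ => a e.1 * sig e (g + s • hdir a e g) / 2) 0 0 := by
    simp_rw [line_sig]
    exact hasDerivAt_const _ _
  refine (((d3.mul d1).add (d4.mul d2)).const_mul (An k)).congr_deriv ?_
  simp only [zero_smul, add_zero, zero_mul, zero_add]
  unfold p2
  simp only [zero_add]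

lemma Par.pk_cont (h : Par k a) : Continuous (pk (k := k) a) :=
  (h.Pm_cont (PG_one.mono (by norm_num)) 0).const_mul _

lemma Par.p1_cont (h : Par k a) (e : Dix k) : Continuous (p1 a e) := by
  have d1 := h.Pm_cont ((PG_one.mul (h.PG_cth e.1)).mono (by norm_num)) 0
  have d2 := h.Pm_cont ((PG_one.mul (PG_id)).mono (by norm_num)) (0 + π / 2)
  have := kap_cont e
  have := sig_cont e
  unfold p1
  fun_prop

lemma Par.p2_cont (h : Par k a) (e : Dix k) : Continuous (p2 a e) := by
  have d1 := h.Pm_cont ((PG_one.mul (h.PG_cth e.1)).mono (by norm_num)) 0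
  have d2 := h.Pm_cont (((PG_one.mul (h.PG_cth e.1)).mul (h.PG_cth e.1)).mono (by norm_num)) 0
  have d3 := h.Pm_cont (((PG_one.mul (h.PG_cth e.1)).mul (PG_id)).mono (by norm_num)) (0 + π / 2)
  have d4 := h.Pm_cont (((PG_one.mul (PG_id)).mul (h.PG_cth e.1)).mono (by norm_num)) (0 + π / 2)
  have d5 := h.Pm_cont (((PG_one.mul (PG_id)).mul (PG_id)).mono (by norm_num)) (0 + π / 2 + π / 2)
  have := kap_cont e
  have := sig_cont e
  unfold p2
  fun_prop

lemma pk_eq (g : Heis l k) : pk a g = An k * Fc (GW k a (zNormSq l k g.1)) (g.2 / 4) := by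
  unfold pk Pm; rw [Qf_one]

lemma Par.pk_pos (h : Par k a) (g : Heis l k) : 0 < pk a g := by
  rw [pk_eq]; exact mul_pos An_pos (h.Fc_pos (zNormSq_nonneg _) _)

/-- weight function -/
def Mw (g : Heis l k) : ℝ := 1 + ∑ j, zNormSq l k g.1 j + Real.sqrt (1 + g.2 ^ 2)

lemma abs_le_sqrt_one (t : ℝ) : |t| ≤ Real.sqrt (1 + t ^ 2) := by
  apply Real.abs_le_sqrt; linarith

lemma sqrt_one_le (t : ℝ) : Real.sqrt (1 + t ^ 2) ≤ 1 + |t| := by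
  rw [Real.sqrt_le_left (by positivity)]
  have := abs_nonneg t
  nlinarith [sq_abs t]

lemma Par.sum_p1 (h : Par k a) (g : Heis l k) : ∑ e, p1 a e g ^ 2 =
    An k ^ 2 * ∑ i, zNormSq l k g.1 i / 4 * (Fc (fun x => GW k a (zNormSq l k g.1) x * cth (a i * x)) (g.2 / 4) ^ 2 +
      a i ^ 2 * Fs (GW k a (zNormSq l k g.1)) (g.2 / 4) ^ 2) := by
  rw [sum_Dix, Finset.mul_sum]
  refine Finset.sum_congr rfl fun i _ => ?_
  have e : ∀ c S A Z : ℝ, A ^ 2 * (Z / 4 * (c ^ 2 + a i ^ 2 * S ^ 2)) = Z * (A ^ 2 / 4 * (c ^ 2 + a i ^ 2 * S ^ 2)) := fun _ _ _ _ => by ring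
  rw [e, zNormSq, Finset.sum_mul]
  refine Finset.sum_congr rfl fun j _ => ?_
  simp only [p1, kap, sig, Pm, one_mul, zero_add, Qf_zero, Qf_id, if_true, Complex.normSq_apply]
  simp
  ring

lemma Par.sum_p2 (h : Par k a) (g : Heis l k) : ∑ e, p2 a e g =
    An k * (∑ i, zNormSq l k g.1 i / 4 * Fc (fun x => GW k a (zNormSq l k g.1) x * ssh (a i * x) ^ 2) (g.2 / 4) -
      ∑ i, k i * Fc (fun x => GW k a (zNormSq l k g.1) x * cth (a i * x)) (g.2 / 4)) := by
  have hz := zNormSq_nonneg (l := l) (k := k) g.1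
  rw [sum_Dix, ← Finset.sum_sub_distrib, Finset.mul_sum]
  refine Finset.sum_congr rfl fun i _ => ?_
  have e1 : Fc (fun x => GW k a (zNormSq l k g.1) x * ssh (a i * x) ^ 2) (g.2 / 4) =
      Pm a (fun x => cth (a i * x) * cth (a i * x)) 0 g + a i ^ 2 * Pm a (fun x => x * x) (π / 2 + π / 2) g := by
    rw [← Qf_zero]
    unfold Pm Qf
    have i1 := h.Qf_int (((h.PG_cth i).mul (h.PG_cth i)).mono (by norm_num)) 0 hz (g.2 / 4)
    have i2 := h.Qf_int ((PG_id.mul PG_id).mono (by norm_num)) (π / 2 + π / 2) hz (g.2 / 4)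
    rw [← integral_const_mul, ← integral_add i1 (i2.const_mul _)]
    congr 1
    ext x
    beta_reduce
    rw [← cth_sq, add_halves, Real.cos_add_pi, add_zero]
    ring
  have e : ∀ c S A Z : ℝ, A * (Z / 4 * S - k i * c) = Z * (A / 4 * S) + k i * (- A * c) := fun _ _ _ _ => by ring
  rw [e, zNormSq, Finset.sum_mul, ← nsmul_eq_mul]
  have e3 : k i • (-An k * Fc (fun x => GW k a (zNormSq l k g.1) x * cth (a i * x)) (g.2 / 4)) = ∑ j : Fin (k i), (-An k * Fc (fun x => GW k a (zNormSq l k g.1) x * cth (a i * x)) (g.2 / 4)) := by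
    simp
  rw [e3, ← Finset.sum_add_distrib]
  refine Finset.sum_congr rfl fun j _ => ?_
  rw [e1, ← Qf_zero]
  have e4 : (fun x => x * cth (a i * x)) = fun x => cth (a i * x) * x := by ext x; ring
  simp only [p2, kap, sig, one_mul, zero_add, if_true, Complex.normSq_apply, e4]
  simp [Pm]
  ring

lemma Par.grad_bound (h : Par k a) : ∃ C > 0, ∀ g : Heis l k, ∑ e, p1 a e g ^ 2 ≤ C * Mw g * pk a g ^ 2 := by
  obtain ⟨C, hC, h3⟩ := A3 h
  refine ⟨(l + 1) * C + π ^ 2, by positivity, fun g => ?_⟩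
  rw [h.sum_p1, pk_eq, mul_pow]
  have hz := zNormSq_nonneg (l := l) (k := k) g.1
  set r := zNormSq l k g.1
  set τ := g.2 / 4 with hτ
  have hF := T0 h hz τ
  have hS := T1 h hz τ
  set F := Fc (GW k a r) τ
  set S := Fs (GW k a r) τ
  have hR0 : 0 ≤ ∑ j, r j := Finset.sum_nonneg fun j _ => hz j
  have hM : 1 + ∑ j, r j + |τ| ≤ Mw g := by
    unfold Mw
    have := abs_le_sqrt_one g.2
    have : |τ| ≤ |g.2| := by rw [hτ, abs_div]; norm_num; linarith [abs_nonneg g.2]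
    linarith
  have hM1 : ∑ j, r j ≤ Mw g := by linarith [abs_nonneg τ]
  have hM0 : 0 ≤ Mw g := hR0.trans hM1
  have k1 : ∀ i, r i / 4 * (Fc (fun x => GW k a r x * cth (a i * x)) τ ^ 2 + a i ^ 2 * S ^ 2) ≤ C * Mw g * F ^ 2 + r i * (π ^ 2 * F ^ 2) := by
    intro i
    have q1 := h3 r hz τ i
    have q2 : S ^ 2 ≤ (π * F) ^ 2 := sq_le_sq' (abs_le.1 hS).1 (abs_le.1 hS).2
    have q3 : a i ^ 2 ≤ 1 := by have := h.ha i; have := h.le_one i; nlinarith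
    have q4 : C * (1 + ∑ j, r j + |τ|) * F ^ 2 ≤ C * Mw g * F ^ 2 := by gcongr
    have q5 : r i * (a i ^ 2 * S ^ 2) ≤ r i * (1 * (π * F) ^ 2) := by
      have := hz i
      gcongr
    have q6 : 0 ≤ r i * (1 * (π * F) ^ 2) := by have := hz i; positivity
    have q7 : 0 ≤ C * Mw g * F ^ 2 := by positivity
    nlinarith
  calc _ ≤ An k ^ 2 * ∑ i, (C * Mw g * F ^ 2 + r i * (π ^ 2 * F ^ 2)) := by
        gcongr with i _; exact k1 i
    _ = An k ^ 2 * (((l + 1) * C * Mw g + π ^ 2 * ∑ i, r i) * F ^ 2) := by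
        simp only [Finset.sum_add_distrib, ← Finset.sum_mul, Finset.sum_const, Finset.card_univ, Fintype.card_fin, nsmul_eq_mul]
        push_cast
        ring
    _ ≤ An k ^ 2 * (((l + 1) * C * Mw g + π ^ 2 * Mw g) * F ^ 2) := by gcongr
    _ = _ := by ring

lemma Par.lap_bound (h : Par k a) : ∃ c > 0, ∃ C > 0, ∀ g : Heis l k, (c * Mw g - C) * pk a g ≤ ∑ e, p2 a e g := by
  obtain ⟨c, hc, C, hC, h4⟩ := A4 h
  refine ⟨c / 4, by positivity, C + c, by positivity, fun g => ?_⟩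
  rw [h.sum_p2, pk_eq]
  have hz := zNormSq_nonneg (l := l) (k := k) g.1
  have q := h4 _ hz (g.2 / 4)
  set r := zNormSq l k g.1 with hr
  have hF := T0 h hz (g.2 / 4)
  have hA := An_pos (k := k)
  have hR0 : 0 ≤ ∑ j, r j := Finset.sum_nonneg fun j _ => hz j
  rw [mul_left_comm]
  refine mul_le_mul_of_nonneg_left (le_trans (mul_le_mul_of_nonneg_right ?_ hF) q) hA.le
  unfold Mw
  have := sqrt_one_le g.2
  rw [abs_div, abs_of_pos (by norm_num : (0:ℝ) < 4), ← hr]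
  nlinarith

lemma Par.heatKernel_eq (h : Par k a) (g : Heis l k) : heatKernel l k a 1 g = pk a g := by
  rw [pk_eq]
  have hz := zNormSq_nonneg (l := l) (k := k) g.1
  unfold heatKernel heatKernelC
  have e1 : (2 * (4 * (Real.pi : ℂ) * ((1 : ℝ) : ℂ)) ^ ((∑ i, k i) + 1) : ℂ)⁻¹ = ((An k : ℝ) : ℂ) := by
    unfold An; push_cast; ring
  rw [e1, Complex.re_ofReal_mul]
  congr 1
  have e2 : ∀ᵐ lam : ℝ, ((∏ j, ((a j * lam) / Real.sinh (a j * lam)) ^ (k j) : ℝ) : ℂ) *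
        Complex.exp ((4 * ((1 : ℝ) : ℂ))⁻¹ *
          (Complex.I * (lam : ℂ) * (g.2 : ℂ) -
            ∑ j, ((zNormSq l k g.1 j : ℝ) : ℂ) *
              ((a j * lam * (Real.cosh (a j * lam) / Real.sinh (a j * lam)) : ℝ) : ℂ))) = 
        ((GW k a (zNormSq l k g.1) lam : ℝ) : ℂ) * Complex.exp (((lam * (g.2 / 4) : ℝ) : ℂ) * Complex.I) := by
    have : ∀ᵐ lam : ℝ, lam ≠ 0 := by
      rw [ae_iff]; simp
    filter_upwards [this] with lam hl
    have hn : ∀ j, a j * lam ≠ 0 := fun j => mul_ne_zero (h.ha j).ne' hl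
    unfold GW ssh cth
    simp only [hn, if_false]
    rw [Complex.ofReal_mul, Complex.ofReal_exp]
    conv_rhs => rw [mul_assoc, ← Complex.exp_add]
    congr 2
    push_cast
    rw [mul_sub, Finset.mul_sum]
    have : ∀ j, (zNormSq l k g.1 j : ℂ) / 4 * (a j * lam * (Complex.cosh (a j * lam) / Complex.sinh (a j * lam))) = 
      (4 * 1)⁻¹ * ((zNormSq l k g.1 j : ℂ) * (a j * lam * (Complex.cosh (a j * lam) / Complex.sinh (a j * lam)))) := fun j => by ring
    simp_rw [this]
    ring
  rw [integral_congr_ae e2]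
  have hi : Integrable (GW k a (zNormSq l k g.1)) := by
    have := h.Qf_int (PG_one.mono (by norm_num)) 0 hz 0
    simpa using this
  have hi2 : Integrable (fun lam : ℝ => ((GW k a (zNormSq l k g.1) lam : ℝ) : ℂ) * Complex.exp (((lam * (g.2 / 4) : ℝ) : ℂ) * Complex.I)) := by
    refine Integrable.mul_bdd (c := 1) hi.ofReal ?_ ?_
    · exact Continuous.aestronglyMeasurable (by fun_prop)
    · exact Eventually.of_forall fun x => by rw [Complex.norm_exp_ofReal_mul_I]
  have := Complex.reCLM.integral_comp_comm hi2
  simp only [Complex.reCLM_apply] at this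
  rw [← this]
  unfold Fc
  congr 1
  ext x
  rw [Complex.re_ofReal_mul, Complex.exp_ofReal_mul_I_re]
end

section
variable {l : ℕ} {k : Fin (l + 1) → ℕ} {a : Fin (l + 1) → ℝ}

lemma shear_mp (ζ : (i : Fin (l + 1)) → (Fin (k i) → ℂ)) (L : ((i : Fin (l + 1)) → (Fin (k i) → ℂ)) → ℝ) (hL : Measurable L) :
    MeasurePreserving (fun g : Heis l k => ((g.1 + ζ, g.2 + L g.1) : Heis l k)) := by
  refine MeasurePreserving.skew_product (μb := volume) (μd := volume) (measurePreserving_add_right volume ζ) (g := fun z t => t + L z) ?_ ?_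
  · exact measurable_snd.add (hL.comp measurable_fst)
  · exact Eventually.of_forall fun z => (measurePreserving_add_right volume (L z)).map_eq

lemma hdir_cont (e : Dix k) : Continuous (hdir a e) := by
  have := sig_cont e
  unfold hdir
  fun_prop

lemma flow_cont (e : Dix k) : Continuous (fun q : ℝ × Heis l k => q.2 + q.1 • hdir a e q.2) := by
  have := hdir_cont (a := a) e
  fun_prop

lemma flow_mp (e : Dix k) (s : ℝ) : MeasurePreserving (fun g : Heis l k => g + s • hdir a e g) := by
  have := shear_mp (l := l) (k := k) (s • Pi.single e.1 (Pi.single e.2.1 (uni e))) (fun z => s * (2 * a e.1 * sig e (z, 0))) (by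
    have := sig_cont e
    exact Continuous.measurable (by fun_prop))
  exact this

lemma line_deriv_flow {e : Dix k} {u u' : Heis l k → ℝ} (hu : ∀ g, HasLineDerivAt ℝ u (u' g) g (hdir a e g)) (g : Heis l k) (s : ℝ) :
    HasDerivAt (fun s : ℝ => u (g + s • hdir a e g)) (u' (g + s • hdir a e g)) s := by
  have := hu (g + s • hdir a e g)
  unfold HasLineDerivAt at this
  rw [line_hdir] at this
  have h2 : HasDerivAt (fun t : ℝ => t - s) 1 s := (hasDerivAt_id s).sub_const s
  have h3 := HasDerivAt.scomp_of_eq (h := fun t : ℝ => t - s) s this h2 (by simp)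
  rw [one_smul] at h3
  refine h3.congr_of_eventuallyEq (Eventually.of_forall fun t => ?_)
  simp only [Function.comp]
  congr 1
  rw [add_assoc, ← add_smul]
  congr 2
  ring

lemma flow_ftc {e : Dix k} {u u' : Heis l k → ℝ} (hu : ∀ g, HasLineDerivAt ℝ u (u' g) g (hdir a e g)) (hc : Continuous u') (g : Heis l k) (s : ℝ) :
    ∫ x in (0:ℝ)..s, u' (g + x • hdir a e g) = u (g + s • hdir a e g) - u g := by
  rw [intervalIntegral.integral_eq_sub_of_hasDerivAt (fun x _ => line_deriv_flow hu g x)]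
  · simp
  · exact Continuous.intervalIntegrable (by fun_prop) _ _

lemma flow_integrable {e : Dix k} {u' : Heis l k → ℝ} (hc : Continuous u') (hi : Integrable u') (s : ℝ) :
    Integrable (fun q : ℝ × Heis l k => u' (q.2 + q.1 • hdir a e q.2)) ((volume.restrict (Set.Ioc 0 s)).prod volume) := by
  rw [integrable_prod_iff]
  · constructor
    · exact Eventually.of_forall fun x => (flow_mp e x).integrable_comp_of_integrable hi
    · have : ∀ x : ℝ, ∫ y, ‖u' (y + x • hdir a e y)‖ = ∫ y, ‖u' y‖ := fun x =>
        (flow_mp e x).integral_comp' (f := { toFun := fun g : Heis l k => g + x • hdir a e g, invFun := fun g => g + (-x) • hdir a e g, left_inv := fun g => by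
                                                simp only []; rw [line_hdir, add_assoc, ← add_smul]; simp
                                             right_inv := fun g => by
                                                simp only []; rw [line_hdir, add_assoc, ← add_smul]; simp
                                             measurable_toFun := (flow_mp e x).measurable
                                             measurable_invFun := (flow_mp e (-x)).measurable }) (fun y => ‖u' y‖)
      simp_rw [this]
      exact integrable_const _
  · exact (hc.comp (flow_cont e)).aestronglyMeasurable

lemma flow_integral (e : Dix k) (u : Heis l k → ℝ) (x : ℝ) : ∫ y, u (y + x • hdir a e y) = ∫ y, u y :=
        (flow_mp e x).integral_comp' (f := { toFun := fun g : Heis l k => g + x • hdir a e g, invFun := fun g => g + (-x) • hdir a e g, left_inv := fun g => by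
                                                simp only []; rw [line_hdir, add_assoc, ← add_smul]; simp
                                             right_inv := fun g => by
                                                simp only []; rw [line_hdir, add_assoc, ← add_smul]; simp
                                             measurable_toFun := (flow_mp e x).measurable
                                             measurable_invFun := (flow_mp e (-x)).measurable }) u

lemma ibp {e : Dix k} {u u' : Heis l k → ℝ} (hu : ∀ g, HasLineDerivAt ℝ u (u' g) g (hdir a e g)) (hc : Continuous u') (hi : Integrable u')
    (hi0 : Integrable u) : ∫ g, u' g = 0 := by
  have h1 : ∫ g, ∫ x in (0:ℝ)..1, u' (g + x • hdir a e g) = 0 := by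
    simp_rw [flow_ftc hu hc]
    have := (flow_mp (a := a) e 1).integrable_comp_of_integrable hi0
    rw [integral_sub (f := fun g => u (g + (1:ℝ) • hdir a e g)) this hi0, flow_integral, sub_self]
  simp_rw [intervalIntegral.integral_of_le zero_le_one] at h1
  rw [integral_integral_swap] at h1
  · simp_rw [flow_integral] at h1
    simpa using h1
  · exact (flow_integrable hc hi 1).swap

lemma VF_has (e : Dix k) {f : Heis l k → ℝ} (hf : Differentiable ℝ f) (g : Heis l k) : HasLineDerivAt ℝ f (VF a e f g) g (hdir a e g) :=
  (hf g).lineDifferentiableAt.hasLineDerivAt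

lemma VF_cont (e : Dix k) {f : Heis l k → ℝ} (hf : ContDiff ℝ 1 f) : Continuous (VF a e f) := by
  have : VF a e f = fun g => fderiv ℝ f g (hdir a e g) := by
    ext g
    exact (hf.differentiable (by norm_num) g).lineDeriv_eq_fderiv
  rw [this]
  exact (hf.continuous_fderiv (by norm_num)).clm_apply (hdir_cont e)

lemma gradNorm_cont {f : Heis l k → ℝ} (hf : ContDiff ℝ 1 f) : Continuous (gradNorm l k a f) := by
  have : gradNorm l k a f = fun g => Real.sqrt (∑ e : Dix k, VF a e f g ^ 2) := funext fun g => gradNorm_eq f g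
  rw [this]
  have := fun e => VF_cont (a := a) (k := k) e hf
  fun_prop

lemma gradNorm_nonneg (f : Heis l k → ℝ) (g) : 0 ≤ gradNorm l k a f g := Real.sqrt_nonneg _

lemma VF_le (e : Dix k) (f : Heis l k → ℝ) (g) : |VF a e f g| ≤ gradNorm l k a f g := by
  rw [gradNorm_eq]
  apply Real.abs_le_sqrt
  exact Finset.single_le_sum (f := fun e => VF a e f g ^ 2) (fun _ _ => sq_nonneg _) (Finset.mem_univ e)

lemma gradNorm_supp {f : Heis l k → ℝ} (hs : HasCompactSupport f) : HasCompactSupport (gradNorm l k a f) := by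
  refine HasCompactSupport.intro hs.isCompact fun g hg => ?_
  rw [gradNorm_eq]
  have : ∀ e : Dix k, VF a e f g = 0 := fun e => by
    unfold VF
    have h1 : f =ᶠ[𝓝 g] fun _ => 0 := notMem_tsupport_iff_eventuallyEq.1 hg
    rw [h1.lineDeriv_eq]
    simp [lineDeriv]
  simp [this]

/-- derivative of the weight -/
def M1 (a : Fin (l + 1) → ℝ) (e : Dix k) (g : Heis l k) : ℝ := 2 * kap e g + 2 * a e.1 * sig e g * (g.2 / Real.sqrt (1 + g.2 ^ 2))

lemma Mw_deriv (e : Dix k) (g : Heis l k) : HasLineDerivAt ℝ Mw (M1 a e g) g (hdir a e g) := by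
  unfold HasLineDerivAt Mw
  simp_rw [line_zNormSq, line_snd, Finset.sum_add_distrib]
  have h0 : (1 + (g.2 + 0 * (2 * a e.1 * sig e g)) ^ 2) ≠ 0 := by positivity
  have d1 : HasDerivAt (fun s : ℝ => 2 * s * kap e g + s ^ 2) (2 * kap e g) 0 := by
    refine ((((hasDerivAt_id (0:ℝ)).const_mul 2).mul_const (kap e g)).add ((hasDerivAt_id (0:ℝ)).pow 2)).congr_deriv ?_
    simp
  have d2 : HasDerivAt (fun s : ℝ => Real.sqrt (1 + (g.2 + s * (2 * a e.1 * sig e g)) ^ 2)) (2 * a e.1 * sig e g * (g.2 / Real.sqrt (1 + g.2 ^ 2))) 0 := by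
    refine ((((((hasDerivAt_id (0:ℝ)).mul_const (2 * a e.1 * sig e g)).const_add g.2).pow 2).const_add 1).sqrt h0).congr_deriv ?_
    simp
    field_simp
  have := ((d1.const_add (∑ x, zNormSq l k g.1 x)).const_add 1).add d2
  refine (this.congr_of_eventuallyEq (Eventually.of_forall fun s => ?_))
  simp

lemma M1_cont (e : Dix k) : Continuous (M1 a e) := by
  have := kap_cont e
  have := sig_cont e
  unfold M1
  refine Continuous.add (by fun_prop) (Continuous.mul (by fun_prop) (Continuous.div (by fun_prop) (by fun_prop) fun g => ?_))
  positivity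

lemma Mw_cont : Continuous (Mw (l := l) (k := k)) := by
  have := zNormSq_cont (l := l) (k := k)
  unfold Mw
  fun_prop

lemma one_le_Mw (g : Heis l k) : 1 ≤ Mw g := by
  have : 0 ≤ ∑ j, zNormSq l k g.1 j := Finset.sum_nonneg fun j _ => zNormSq_nonneg _ _
  have := Real.sqrt_nonneg (1 + g.2 ^ 2)
  unfold Mw
  linarith

lemma kap_sig (e : Dix k) (g : Heis l k) : kap e g ^ 2 + sig e g ^ 2 = Complex.normSq (g.1 e.1 e.2.1) := by
  unfold kap sig
  rw [Complex.normSq_apply]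
  split_ifs <;> ring

lemma Par.M1_bound (h : Par k a) (g : Heis l k) : ∑ e, M1 a e g ^ 2 ≤ 16 * Mw g := by
  have k1 : ∀ e : Dix k, M1 a e g ^ 2 ≤ 8 * Complex.normSq (g.1 e.1 e.2.1) := fun e => by
    rw [← kap_sig]
    unfold M1
    set T := g.2 / Real.sqrt (1 + g.2 ^ 2)
    have hT : T ^ 2 ≤ 1 := by
      rw [div_pow, Real.sq_sqrt (by positivity), div_le_one (by positivity)]; linarith
    have ha : a e.1 ^ 2 ≤ 1 := by have := h.ha e.1; have := h.le_one e.1; nlinarith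
    have q : (a e.1 * sig e g * T) ^ 2 ≤ sig e g ^ 2 := by
      calc _ = a e.1 ^ 2 * T ^ 2 * sig e g ^ 2 := by ring
        _ ≤ 1 * 1 * sig e g ^ 2 := by gcongr
        _ = _ := by ring
    nlinarith [sq_nonneg (kap e g - a e.1 * sig e g * T)]
  calc _ ≤ ∑ e : Dix k, 8 * Complex.normSq (g.1 e.1 e.2.1) := Finset.sum_le_sum fun e _ => k1 e
    _ = 16 * ∑ i, zNormSq l k g.1 i := by
      rw [sum_Dix, Finset.mul_sum]
      refine Finset.sum_congr rfl fun i _ => ?_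
      rw [zNormSq, Finset.mul_sum]
      refine Finset.sum_congr rfl fun i _ => ?_
      ring
    _ ≤ _ := by
      unfold Mw
      have := Real.sqrt_nonneg (1 + g.2 ^ 2)
      linarith

lemma Mw_compact (R : ℝ) : IsCompact {g : Heis l k | Mw g ≤ R} := by
  refine Metric.isCompact_of_isClosed_isBounded (isClosed_le Mw_cont continuous_const) ?_
  refine (Metric.isBounded_closedBall (x := (0 : Heis l k)) (r := |R|)).subset fun g hg => ?_
  have hg : Mw g ≤ R := hg
  have h1 := one_le_Mw g
  have h0 : 0 ≤ ∑ j, zNormSq l k g.1 j := Finset.sum_nonneg fun j _ => zNormSq_nonneg _ _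
  have h2 := abs_le_sqrt_one g.2
  have hR0 : 0 ≤ R := by linarith
  have hR : |R| = R := abs_of_nonneg (by linarith)
  rw [mem_closedBall_zero_iff, hR, Prod.norm_def, sup_le_iff]
  unfold Mw at hg
  constructor
  · rw [pi_norm_le_iff_of_nonneg hR0]
    intro i
    rw [pi_norm_le_iff_of_nonneg hR0]
    intro j
    have q1 : Complex.normSq (g.1 i j) ≤ zNormSq l k g.1 i := Finset.single_le_sum (f := fun j => Complex.normSq (g.1 i j)) (fun _ _ => Complex.normSq_nonneg _) (Finset.mem_univ j)
    have q2 : zNormSq l k g.1 i ≤ ∑ j, zNormSq l k g.1 j := Finset.single_le_sum (f := fun j => zNormSq l k g.1 j) (fun _ _ => zNormSq_nonneg _ _) (Finset.mem_univ i)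
    rw [Complex.normSq_eq_norm_sq] at q1
    have := abs_nonneg g.2
    nlinarith [norm_nonneg (g.1 i j), sq_nonneg (‖g.1 i j‖ - 1)]
  · rw [Real.norm_eq_abs]; linarith
end

/-- cutoff -/
def qcut (R M : ℝ) : ℝ := max 0 (1 - M / R)

lemma qcut_nonneg (R M : ℝ) : 0 ≤ qcut R M := le_max_left _ _

lemma qcut_le {R M : ℝ} (hR : 0 < R) (hM : 0 ≤ M) : qcut R M ≤ 1 := by
  unfold qcut
  have : 0 ≤ M / R := by positivity
  exact max_le zero_le_one (by linarith)

lemma qcut_zero {R M : ℝ} (hR : 0 < R) (hM : R ≤ M) : qcut R M = 0 := by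
  unfold qcut
  have : 1 ≤ M / R := by rwa [one_le_div hR]
  exact max_eq_left (by linarith)

lemma max_sq_deriv (x : ℝ) : HasDerivAt (fun x : ℝ => (max 0 x) ^ 2) (2 * max 0 x) x := by
  rcases lt_trichotomy x 0 with hx | hx | hx
  · rw [max_eq_left hx.le]
    refine ((hasDerivAt_const x (0:ℝ)).congr_of_eventuallyEq ?_).congr_deriv (by simp)
    filter_upwards [Iio_mem_nhds hx] with y hy
    rw [max_eq_left (Set.mem_Iio.1 hy).le]; simp
  · subst hx
    have : (fun x : ℝ => (max 0 x) ^ 2) =O[𝓝 0] fun x => ‖x - 0‖ ^ 2 := by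
      refine Asymptotics.IsBigO.of_bound 1 (Eventually.of_forall fun y => ?_)
      simp only [sub_zero, one_mul, norm_pow, norm_norm]
      gcongr
      rw [Real.norm_eq_abs, Real.norm_eq_abs, abs_of_nonneg (le_max_left _ _)]
      exact max_le (abs_nonneg _) (le_abs_self _)
    exact (this.hasFDerivAt (by norm_num)).hasDerivAt.congr_deriv (by simp)
  · rw [max_eq_right hx.le]
    refine (((hasDerivAt_id x).pow 2).congr_of_eventuallyEq ?_).congr_deriv (by simp)
    filter_upwards [Ioi_mem_nhds hx] with y hy
    rw [max_eq_right (Set.mem_Ioi.1 hy).le]; simp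

/-- radial weight -/
def Hcut (R M : ℝ) : ℝ := qcut R M ^ 2 / Real.sqrt M

/-- derivative of the radial weight -/
def Hcut1 (R M : ℝ) : ℝ := -(2 / R * qcut R M / Real.sqrt M) - qcut R M ^ 2 / (2 * M * Real.sqrt M)

lemma Hcut_deriv (R : ℝ) {M : ℝ} (hM : 0 < M) : HasDerivAt (Hcut R) (Hcut1 R M) M := by
  have d1 : HasDerivAt (fun M : ℝ => 1 - M / R) (-(1 / R)) M := ((hasDerivAt_id M).div_const R).const_sub 1
  have d2 : HasDerivAt (fun M : ℝ => qcut R M ^ 2) (2 * qcut R M * (-(1 / R))) M :=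
    HasDerivAt.comp (h₂ := fun x : ℝ => (max 0 x) ^ 2) M (max_sq_deriv (1 - M / R)) d1
  have d3 := Real.hasDerivAt_sqrt hM.ne'
  refine (d2.div d3 (by positivity)).congr_deriv ?_
  unfold Hcut1
  have hs : Real.sqrt M ^ 2 = M := Real.sq_sqrt hM.le
  have hs0 : 0 < Real.sqrt M := by positivity
  have e : qcut R M ^ 2 / (2 * M * Real.sqrt M) = qcut R M ^ 2 * (1 / (2 * Real.sqrt M)) / Real.sqrt M ^ 2 := by
    rw [hs]; field_simp
  rw [e, sub_div]
  congr 1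
  have e2 : Real.sqrt M / Real.sqrt M ^ 2 = 1 / Real.sqrt M := by field_simp
  rw [mul_div_assoc, e2]
  ring

lemma qcut_cont (R : ℝ) : Continuous (qcut R) := by unfold qcut; fun_prop

lemma pointwise_aux {c C C1 p φ q s : ℝ} (hc : 0 < c) (hC : 0 < C) (hC1 : 0 < C1) (hp : 0 < p) (hφ : 0 ≤ φ) (hq0 : 0 ≤ q) (hq1 : q ≤ 1)
    (hs0 : 0 < s) (hs1 : 1 ≤ s) :
    c / 2 * (φ * q ^ 2 * p) ≤ φ * (q ^ 2 / s) * ((c * s ^ 2 - C) * p) - φ * (q ^ 2 / (2 * s)) * C1 * p + (if s ^ 2 ≤ 2 * (C + C1) / c then (2 * C1 + C + c) * (φ * p) else 0) := by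
  have e : φ * (q ^ 2 / s) * ((c * s ^ 2 - C) * p) - φ * (q ^ 2 / (2 * s)) * C1 * p = φ * q ^ 2 * p * (c * s - (C + C1 / 2) / s) := by
    field_simp; ring
  rw [e]
  obtain ⟨x, hx⟩ : ∃ x, x = φ * q ^ 2 * p := ⟨_, rfl⟩
  have h3 : 0 ≤ x := by rw [hx]; positivity
  have h2 : x ≤ φ * p := by
    rw [hx]
    calc φ * q ^ 2 * p ≤ φ * 1 ^ 2 * p := by gcongr
      _ = _ := by ring
  rw [← hx]
  split_ifs with hi
  · have h1 : (C + C1 / 2) / s ≤ C + C1 / 2 := div_le_self (by positivity) hs1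
    have h4 : - (C + C1 / 2) ≤ c * s - (C + C1 / 2) / s := by
      have : 0 < c * s := by positivity
      linarith
    have h5 := mul_le_mul_of_nonneg_left h4 h3
    have h6 : (c / 2 + (C + C1 / 2)) * x ≤ (2 * C1 + C + c) * (φ * p) := by
      apply mul_le_mul _ h2 h3 (by positivity)
      linarith
    linarith
  · push Not at hi
    rw [div_lt_iff₀ hc] at hi
    have h1 : (C + C1 / 2) / s ≤ c * s / 2 := by
      rw [div_le_iff₀ hs0]
      have : c * s / 2 * s = s ^ 2 * c / 2 := by ring
      linarith
    have h4 : c / 2 ≤ c * s - (C + C1 / 2) / s := by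
      have : c * 1 ≤ c * s := by gcongr
      linarith
    have h5 := mul_le_mul_of_nonneg_left h4 h3
    linarith

lemma pointwise_lyap {c C C1 : ℝ} (hc : 0 < c) (hC : 0 < C) (hC1 : 0 < C1) : ∃ M0 > 0, ∃ K > 0, ∀ {M R p φ G A B L : ℝ}, 1 ≤ M → 1 ≤ R → 0 < p → 0 ≤ φ → 0 ≤ G →
    |A| ≤ G * (C1 * Real.sqrt M * p) → |B| ≤ C1 * M * p → (c * M - C) * p ≤ L →
    c / 2 * (φ * qcut R M ^ 2 * p) ≤ (Hcut R M * A + φ * Hcut1 R M * B + φ * Hcut R M * L) +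
      (if M ≤ M0 then K * (φ * p) else 0) + K * (G * p) + K / Real.sqrt R * (if M ≤ R then φ * p else 0) := by
  refine ⟨2 * (C + C1) / c, by positivity, 2 * C1 + C + c, by positivity, ?_⟩
  intro M R p φ G A B L hM hR hp hφ hG hA hB hL
  have hM0 : 0 < M := by linarith
  have hR0 : 0 < R := by linarith
  set q := qcut R M with hq
  have hq0 : 0 ≤ q := qcut_nonneg _ _
  have hq1 : q ≤ 1 := qcut_le hR0 hM0.le
  obtain ⟨s, hs0, rfl⟩ : ∃ s > 0, s ^ 2 = M := ⟨Real.sqrt M, by positivity, Real.sq_sqrt hM0.le⟩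
  obtain ⟨ρ, hρ0, rfl⟩ : ∃ s > 0, s ^ 2 = R := ⟨Real.sqrt R, by positivity, Real.sq_sqrt hR0.le⟩
  unfold Hcut Hcut1
  rw [← hq]
  rw [Real.sqrt_sq hs0.le] at *
  rw [Real.sqrt_sq hρ0.le]
  have hs1 : 1 ≤ s := by nlinarith
  -- term A
  have tA : -(C1 * (G * p)) ≤ q ^ 2 / s * A := by
    have : |q ^ 2 / s * A| ≤ C1 * (G * p) := by
      rw [abs_mul, abs_of_nonneg (by positivity)]
      calc q ^ 2 / s * |A| ≤ 1 ^ 2 / s * (G * (C1 * s * p)) := by gcongr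
        _ = _ := by field_simp
    exact (abs_le.1 this).1
  have tL : φ * (q ^ 2 / s) * ((c * s ^ 2 - C) * p) ≤ φ * (q ^ 2 / s) * L := by gcongr
  have tB : -(φ * (2 / ρ ^ 2 * q * s + q ^ 2 / (2 * s)) * C1 * p) ≤ φ * (-(2 / ρ ^ 2 * q / s) - q ^ 2 / (2 * s ^ 2 * s)) * B := by
    have : |φ * (-(2 / ρ ^ 2 * q / s) - q ^ 2 / (2 * s ^ 2 * s)) * B| ≤ φ * (2 / ρ ^ 2 * q * s + q ^ 2 / (2 * s)) * C1 * p := by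
      have e : φ * (-(2 / ρ ^ 2 * q / s) - q ^ 2 / (2 * s ^ 2 * s)) * B = - (φ * (2 / ρ ^ 2 * q / s + q ^ 2 / (2 * s ^ 2 * s)) * B) := by ring
      rw [e, abs_neg, abs_mul, abs_of_nonneg (by positivity)]
      calc φ * (2 / ρ ^ 2 * q / s + q ^ 2 / (2 * s ^ 2 * s)) * |B| ≤ φ * (2 / ρ ^ 2 * q / s + q ^ 2 / (2 * s ^ 2 * s)) * (C1 * s ^ 2 * p) := by gcongr
        _ = _ := by field_simp
    exact (abs_le.1 this).1
  have tR : φ * (2 / ρ ^ 2 * q * s) * C1 * p ≤ 2 * C1 / ρ * (if s ^ 2 ≤ ρ ^ 2 then φ * p else 0) := by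
    split_ifs with hi
    · have : s ≤ ρ := by nlinarith
      calc φ * (2 / ρ ^ 2 * q * s) * C1 * p ≤ φ * (2 / ρ ^ 2 * 1 * ρ) * C1 * p := by gcongr
        _ = _ := by field_simp
    · have : q = 0 := qcut_zero hR0 (by linarith)
      rw [this]; simp
  have tR' : 2 * C1 / ρ * (if s ^ 2 ≤ ρ ^ 2 then φ * p else 0) ≤ (2 * C1 + C + c) / ρ * (if s ^ 2 ≤ ρ ^ 2 then φ * p else 0) := by
    have : 0 ≤ (if s ^ 2 ≤ ρ ^ 2 then φ * p else 0) := by split_ifs <;> positivity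
    gcongr
    linarith
  have tG : C1 * (G * p) ≤ (2 * C1 + C + c) * (G * p) := by gcongr; linarith
  have tM : c / 2 * (φ * q ^ 2 * p) ≤ φ * (q ^ 2 / s) * ((c * s ^ 2 - C) * p) - φ * (q ^ 2 / (2 * s)) * C1 * p + (if s ^ 2 ≤ 2 * (C + C1) / c then (2 * C1 + C + c) * (φ * p) else 0) := pointwise_aux hc hC hC1 hp hφ hq0 hq1 hs0 hs1
  have e9 : φ * (2 / ρ ^ 2 * q * s + q ^ 2 / (2 * s)) * C1 * p = φ * (2 / ρ ^ 2 * q * s) * C1 * p + φ * (q ^ 2 / (2 * s)) * C1 * p := by ring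
  linarith

section
variable {l : ℕ} {k : Fin (l + 1) → ℕ} {a : Fin (l + 1) → ℝ}

lemma Mw_int {R : ℝ} {u : Heis l k → ℝ} (hu : Continuous u) (h0 : ∀ g, R < Mw g → u g = 0) : Integrable u :=
  hu.integrable_of_hasCompactSupport (HasCompactSupport.intro (Mw_compact R) fun g hg => h0 g (not_le.1 hg))

lemma Hcut_cont (R : ℝ) : Continuous (fun g : Heis l k => Hcut R (Mw g)) := by
  have := Mw_cont (l := l) (k := k)
  have := qcut_cont R
  unfold Hcut
  refine Continuous.div (by fun_prop) (by fun_prop) fun g => ?_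
  have := one_le_Mw g
  positivity

lemma Hcut1_cont (R : ℝ) : Continuous (fun g : Heis l k => Hcut1 R (Mw g)) := by
  have := Mw_cont (l := l) (k := k)
  have := qcut_cont R
  unfold Hcut1
  refine Continuous.sub (Continuous.neg (Continuous.div (by fun_prop) (by fun_prop) fun g => ?_)) (Continuous.div (by fun_prop) (by fun_prop) fun g => ?_)
  all_goals
    have := one_le_Mw g
    positivity

lemma cs_sum {ι : Type*} [Fintype ι] (x y : ι → ℝ) {X Y : ℝ} (hX : 0 ≤ X) (hY : 0 ≤ Y) (h1 : ∑ i, x i ^ 2 ≤ X ^ 2) (h2 : ∑ i, y i ^ 2 ≤ Y ^ 2) :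
    |∑ i, x i * y i| ≤ X * Y := by
  apply abs_le_of_sq_le_sq _ (by positivity)
  calc _ ≤ _ := Finset.sum_mul_sq_le_sq_mul_sq _ _ _
    _ ≤ X ^ 2 * Y ^ 2 := by
      have := Finset.sum_nonneg fun i (_ : i ∈ Finset.univ) => sq_nonneg (y i)
      gcongr
    _ = _ := by ring

lemma Par.lyap_trunc (h : Par k a) : ∃ c > 0, ∃ M0 > 0, ∃ K > 0, ∀ (R : ℝ) (φ G : Heis l k → ℝ) (φ1 : Dix k → Heis l k → ℝ), 1 ≤ R → Continuous φ →
    (∀ e, Continuous (φ1 e)) → Integrable (fun g => G g * pk a g) → (∀ e g, HasLineDerivAt ℝ φ (φ1 e g) g (hdir a e g)) → (∀ g, 0 ≤ φ g) → (∀ g, 0 ≤ G g) →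
    (∀ g, ∑ e, φ1 e g ^ 2 ≤ G g ^ 2) →
    c * ∫ g, φ g * qcut R (Mw g) ^ 2 * pk a g ≤ K * (∫ g in {g | Mw g ≤ M0}, φ g * pk a g) + K * (∫ g, G g * pk a g) + K / Real.sqrt R * (∫ g in {g | Mw g ≤ R}, φ g * pk a g) := by
  obtain ⟨C1, hC1, hg⟩ := h.grad_bound
  obtain ⟨c, hc, C, hC, hl⟩ := h.lap_bound
  obtain ⟨M0, hM0, K, hK, hp⟩ := pointwise_lyap hc hC (by positivity : 0 < 4 * Real.sqrt C1)
  refine ⟨c / 2, by positivity, M0, hM0, K, hK, ?_⟩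
  intro R φ G φ1 hR hφc hφ1c hGi hφd hφ0 hG0 hφG
  have hR0 : 0 < R := by linarith
  set D : Dix k → Heis l k → ℝ := fun e g => φ1 e g * (Hcut R (Mw g) * p1 a e g) + φ g * ((Hcut1 R (Mw g) * M1 a e g) * p1 a e g + Hcut R (Mw g) * p2 a e g) with hD
  have hpk := h.pk_cont
  have hMc := Mw_cont (l := l) (k := k)
  have hqc := qcut_cont R
  have hHc := Hcut_cont (l := l) (k := k) R
  have hH1c := Hcut1_cont (l := l) (k := k) R
  have hp1c := h.p1_cont
  have hp2c := h.p2_cont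
  have hM1c := fun e => M1_cont (a := a) (k := k) e
  have hDc : ∀ e, Continuous (D e) := fun e => by
    have := hφ1c e
    have := hp1c e
    have := hp2c e
    have := hM1c e
    simp only [hD]; fun_prop
  have hz : ∀ g : Heis l k, R < Mw g → Hcut R (Mw g) = 0 ∧ Hcut1 R (Mw g) = 0 := fun g hg => by
    unfold Hcut Hcut1
    rw [qcut_zero hR0 hg.le]; simp
  have hDi : ∀ e, Integrable (D e) := fun e => Mw_int (R := R) (hDc e) fun g hg => by
    simp only [hD]; rw [(hz g hg).1, (hz g hg).2]; simp
  have hD0 : ∀ e, ∫ g, D e g = 0 := fun e => by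
    refine ibp (a := a) (e := e) (u := fun g => φ g * (Hcut R (Mw g) * p1 a e g)) ?_ (hDc e) (hDi e) ?_
    · intro g
      have d1 := hφd e g
      have d2 := h.p1_deriv e g
      have d3 := Mw_deriv (a := a) e g
      unfold HasLineDerivAt at d1 d2 d3 ⊢
      have hM := one_le_Mw g
      have d4 := HasDerivAt.comp_of_eq (0:ℝ) (Hcut_deriv R (by linarith : 0 < Mw g)) d3 (by simp)
      refine (d1.mul (d4.mul d2)).congr_deriv ?_
      simp [hD]
    · have := hp1c e
      exact Mw_int (R := R) (by fun_prop) fun g hg => by rw [(hz g hg).1]; simp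
  have hsum : ∫ g, ∑ e, D e g = 0 := by
    rw [integral_finsetSum _ fun e _ => hDi e]
    simp [hD0]
  have hm : ∀ x : ℝ, MeasurableSet {g : Heis l k | Mw g ≤ x} := fun x => (isClosed_le hMc continuous_const).measurableSet
  have hφpi : ∀ x, IntegrableOn (fun g => φ g * pk a g) {g : Heis l k | Mw g ≤ x} := fun x => (Continuous.continuousOn (by fun_prop)).integrableOn_compact (Mw_compact x)
  have i0 : Integrable (fun g => φ g * qcut R (Mw g) ^ 2 * pk a g) := Mw_int (R := R) (by fun_prop) fun g hg => by rw [qcut_zero hR0 hg.le]; simp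
  have i1 : Integrable (fun g => ∑ e, D e g) := integrable_finsetSum _ fun e _ => hDi e
  have i2 : Integrable (fun g : Heis l k => if Mw g ≤ M0 then K * (φ g * pk a g) else 0) := by
    have := IntegrableOn.integrable_indicator ((hφpi M0).const_mul K) (hm M0)
    exact this
  have i3 : Integrable (fun g : Heis l k => if Mw g ≤ R then (φ g * pk a g) else 0) := by
    have := (hφpi R).integrable_indicator (hm R)
    exact this
  have e2 : ∫ g : Heis l k, (if Mw g ≤ M0 then K * (φ g * pk a g) else 0) = K * (∫ g in {g | Mw g ≤ M0}, φ g * pk a g) := by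
    rw [← integral_const_mul, ← integral_indicator (hm M0)]; rfl
  have e3 : ∫ g : Heis l k, (if Mw g ≤ R then (φ g * pk a g) else 0) = (∫ g in {g | Mw g ≤ R}, φ g * pk a g) := by
    rw [← integral_indicator (hm R)]; rfl
  have key : ∫ g, c / 2 * (φ g * qcut R (Mw g) ^ 2 * pk a g) ≤ ∫ g, ((((∑ e, D e g) + (if Mw g ≤ M0 then K * (φ g * pk a g) else 0)) + K * (G g * pk a g)) + K / Real.sqrt R * (if Mw g ≤ R then (φ g * pk a g) else 0)) := by
    refine integral_mono (i0.const_mul _) (((i1.add i2).add (hGi.const_mul K)).add (i3.const_mul _)) fun g => ?_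
    have hM := one_le_Mw g
    have hpp := h.pk_pos g
    have hq := hp (M := Mw g) (R := R) (p := pk a g) (φ := φ g) (G := G g) (A := ∑ e, φ1 e g * p1 a e g) (B := ∑ e, M1 a e g * p1 a e g) (L := ∑ e, p2 a e g) hM hR hpp (hφ0 g) (hG0 g) ?_ ?_ (hl g)
    · have : ∑ e, D e g = (Hcut R (Mw g) * ∑ e, φ1 e g * p1 a e g) + φ g * Hcut1 R (Mw g) * (∑ e, M1 a e g * p1 a e g) + φ g * Hcut R (Mw g) * ∑ e, p2 a e g := by
        rw [Finset.mul_sum, Finset.mul_sum, Finset.mul_sum, ← Finset.sum_add_distrib, ← Finset.sum_add_distrib]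
        refine Finset.sum_congr rfl fun e _ => ?_
        simp only [hD]; ring
      simp only [this]
      exact hq
    · refine (cs_sum _ _ (hG0 g) (Y := Real.sqrt C1 * Real.sqrt (Mw g) * pk a g) (by positivity) (hφG g) ?_).trans ?_
      · rw [mul_pow, mul_pow, Real.sq_sqrt hC1.le, Real.sq_sqrt (by linarith)]; exact hg g
      · have := hG0 g
        gcongr
        linarith [Real.sqrt_nonneg C1]
    · refine (cs_sum _ _ (X := 4 * Real.sqrt (Mw g)) (by positivity) (Y := Real.sqrt C1 * Real.sqrt (Mw g) * pk a g) (by positivity) ?_ ?_).trans ?_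
      · rw [mul_pow, Real.sq_sqrt (by linarith)]; linarith [h.M1_bound g]
      · rw [mul_pow, mul_pow, Real.sq_sqrt hC1.le, Real.sq_sqrt (by linarith)]; exact hg g
      · apply le_of_eq
        have : Real.sqrt (Mw g) ^ 2 = Mw g := Real.sq_sqrt (by linarith)
        calc _ = 4 * Real.sqrt C1 * (Real.sqrt (Mw g) ^ 2) * pk a g := by ring
          _ = _ := by rw [this]
  have i12 : Integrable (fun g => (∑ e, D e g) + (if Mw g ≤ M0 then K * (φ g * pk a g) else 0)) := i1.add i2
  have i123 : Integrable (fun g => ((∑ e, D e g) + (if Mw g ≤ M0 then K * (φ g * pk a g) else 0)) + K * (G g * pk a g)) := i12.add (hGi.const_mul K)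
  rw [integral_add i123 (i3.const_mul _), integral_add i12 (hGi.const_mul K), integral_add i1 i2, hsum, e2, integral_const_mul, integral_const_mul, integral_const_mul, e3, zero_add] at key
  exact key

end

section
variable {l : ℕ} {k : Fin (l + 1) → ℕ} {a : Fin (l + 1) → ℝ}

lemma Par.gradp_int (h : Par k a) {w : Heis l k → ℝ} (hw : ContDiff ℝ 1 w) (hs : HasCompactSupport (gradNorm l k a w)) :
    Integrable (fun g => gradNorm l k a w g * pk a g) :=
  Continuous.integrable_of_hasCompactSupport ((gradNorm_cont hw).mul h.pk_cont) hs.mul_right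

lemma le_of_eps {x y K : ℝ} (hK : 0 ≤ K) (h : ∀ ε > 0, x ≤ y + ε * K) : x ≤ y := by
  by_contra hc
  push Not at hc
  have := h ((x - y) / (2 * (K + 1))) (by apply div_pos <;> linarith)
  have e : (x - y) / (2 * (K + 1)) * K ≤ (x - y) / 2 := by
    rw [div_mul_eq_mul_div, div_le_div_iff₀ (by positivity) (by positivity)]
    nlinarith
  linarith

lemma Par.lyap_R (h : Par k a) : ∃ c > 0, ∃ M0 > 0, ∃ K > 0, ∀ (R : ℝ) (w : Heis l k → ℝ), 1 ≤ R → ContDiff ℝ 1 w → HasCompactSupport (gradNorm l k a w) →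
    c * ∫ g, |w g| * qcut R (Mw g) ^ 2 * pk a g ≤ K * (∫ g in {g | Mw g ≤ M0}, |w g| * pk a g) + K * (∫ g, gradNorm l k a w g * pk a g) + K / Real.sqrt R * (∫ g in {g | Mw g ≤ R}, |w g| * pk a g) := by
  obtain ⟨c, hc, M0, hM0, K, hK, H⟩ := h.lyap_trunc
  refine ⟨c, hc, M0, hM0, K, hK, fun R w hR hw hs => ?_⟩
  have hR0 : 0 < R := by linarith
  have hwc := hw.continuous
  have hpk := h.pk_cont
  have hMc := Mw_cont (l := l) (k := k)
  have hqc := qcut_cont R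
  have hpos := fun g => (h.pk_pos g).le
  refine le_of_eps (K := K * (∫ g in {g : Heis l k | Mw g ≤ M0}, pk a g) + K / Real.sqrt R * (∫ g in {g : Heis l k | Mw g ≤ R}, pk a g)) ?_ fun ε hε => ?_
  · have q1 : 0 ≤ ∫ g in {g : Heis l k | Mw g ≤ M0}, pk a g := integral_nonneg fun g => hpos g
    have q2 : 0 ≤ ∫ g in {g : Heis l k | Mw g ≤ R}, pk a g := integral_nonneg fun g => hpos g
    positivity
  have hpos2 : ∀ g, 0 < w g ^ 2 + ε ^ 2 := fun g => by positivity
  have hV := fun e => VF_cont (a := a) (k := k) e hw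
  have hφ1 : ∀ g, |w g| ≤ Real.sqrt (w g ^ 2 + ε ^ 2) := fun g => Real.abs_le_sqrt (by nlinarith)
  have hφ2 : ∀ g, Real.sqrt (w g ^ 2 + ε ^ 2) ≤ |w g| + ε := fun g => by
    rw [Real.sqrt_le_left (by positivity)]
    nlinarith [sq_abs (w g), abs_nonneg (w g)]
  have := H R (fun g => Real.sqrt (w g ^ 2 + ε ^ 2)) (gradNorm l k a w) (fun e g => w g * VF a e w g / Real.sqrt (w g ^ 2 + ε ^ 2)) hR (by fun_prop)
    (fun e => Continuous.div (by have := hV e; fun_prop) (by fun_prop) fun g => (Real.sqrt_pos.2 (hpos2 g)).ne') (h.gradp_int hw hs) ?_ (fun g => Real.sqrt_nonneg _) (gradNorm_nonneg _) ?_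
  · have i1 : ∀ x, IntegrableOn (fun g => |w g| * pk a g) {g : Heis l k | Mw g ≤ x} := fun x => (Continuous.continuousOn (by fun_prop)).integrableOn_compact (Mw_compact x)
    have i2 : ∀ x, IntegrableOn (fun g => pk a g) {g : Heis l k | Mw g ≤ x} := fun x => (Continuous.continuousOn (by fun_prop)).integrableOn_compact (Mw_compact x)
    have i3 : ∀ x, IntegrableOn (fun g => Real.sqrt (w g ^ 2 + ε ^ 2) * pk a g) {g : Heis l k | Mw g ≤ x} := fun x => (Continuous.continuousOn (by fun_prop)).integrableOn_compact (Mw_compact x)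
    have m1 : ∀ x, ∫ g in {g | Mw g ≤ x}, Real.sqrt (w g ^ 2 + ε ^ 2) * pk a g ≤ (∫ g in {g | Mw g ≤ x}, |w g| * pk a g) + ε * ∫ g in {g : Heis l k | Mw g ≤ x}, pk a g := fun x => by
      rw [← integral_const_mul, ← integral_add (i1 x) ((i2 x).const_mul ε)]
      refine integral_mono (i3 x) ((i1 x).add ((i2 x).const_mul ε)) fun g => ?_
      have := mul_le_mul_of_nonneg_right (hφ2 g) (hpos g)
      simp only [Pi.add_apply]
      linarith
    have m2 : ∫ g, |w g| * qcut R (Mw g) ^ 2 * pk a g ≤ ∫ g, Real.sqrt (w g ^ 2 + ε ^ 2) * qcut R (Mw g) ^ 2 * pk a g := by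
      refine integral_mono ?_ ?_ fun g => ?_
      · exact Mw_int (R := R) (by fun_prop) fun g hg => by rw [qcut_zero hR0 hg.le]; simp
      · exact Mw_int (R := R) (by fun_prop) fun g hg => by rw [qcut_zero hR0 hg.le]; simp
      · have := hpos g
        have := hφ1 g
        simp only []
        gcongr
    have a1 := mul_le_mul_of_nonneg_left (m1 M0) hK.le
    have a2 := mul_le_mul_of_nonneg_left (m1 R) (by positivity : 0 ≤ K / Real.sqrt R)
    have a3 := mul_le_mul_of_nonneg_left m2 hc.le
    linarith
  · intro e g
    have d := VF_has (a := a) e (hw.differentiable (by norm_num)) g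
    unfold HasLineDerivAt at d ⊢
    have := ((d.pow 2).add_const (ε ^ 2)).sqrt (by simpa using (hpos2 g).ne')
    refine this.congr_deriv ?_
    have := (Real.sqrt_pos.2 (hpos2 g)).ne'
    simp
    field_simp
  · intro g
    rw [gradNorm_eq, Real.sq_sqrt (Finset.sum_nonneg fun _ _ => sq_nonneg _)]
    refine Finset.sum_le_sum fun e _ => ?_
    rw [div_pow, Real.sq_sqrt (hpos2 g).le, div_le_iff₀ (hpos2 g), mul_pow]
    nlinarith [sq_nonneg (VF a e w g * ε)]

lemma Par.lyap (h : Par k a) : ∃ M0 > 0, ∃ K > 0, ∀ (w : Heis l k → ℝ), ContDiff ℝ 1 w → HasCompactSupport (gradNorm l k a w) →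
    Integrable (fun g => |w g| * pk a g) →
    ∫ g, |w g| * pk a g ≤ K * ((∫ g in {g | Mw g ≤ M0}, |w g| * pk a g) + (∫ g, gradNorm l k a w g * pk a g)) := by
  obtain ⟨c, hc, M0, hM0, K, hK, H⟩ := h.lyap_R
  refine ⟨M0, hM0, K / c, by positivity, fun w hw hs hi => ?_⟩
  have hwc := hw.continuous
  have hpk := h.pk_cont
  have hMc := Mw_cont (l := l) (k := k)
  set I := ∫ g, |w g| * pk a g
  have hpos := fun g => (h.pk_pos g).le
  have lim1 : Tendsto (fun n : ℕ => ∫ g, |w g| * qcut (n + 1) (Mw g) ^ 2 * pk a g) atTop (𝓝 I) := by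
    refine tendsto_integral_of_dominated_convergence (fun g => |w g| * pk a g) (fun n => ?_) hi (fun n => ?_) ?_
    · have := qcut_cont (n + 1)
      exact Continuous.aestronglyMeasurable (by fun_prop)
    · refine Eventually.of_forall fun g => ?_
      have q0 := qcut_nonneg (n + 1) (Mw g)
      have q1 : qcut (n + 1) (Mw g) ≤ 1 := qcut_le (by positivity) (by linarith [one_le_Mw g])
      have := hpos g
      rw [Real.norm_of_nonneg (by positivity)]
      calc |w g| * qcut (n + 1) (Mw g) ^ 2 * pk a g ≤ |w g| * 1 ^ 2 * pk a g := by gcongr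
        _ = _ := by ring
    · refine Eventually.of_forall fun g => ?_
      have t1 : Tendsto (fun n : ℕ => Mw g / ((n : ℝ) + 1)) atTop (𝓝 0) := by
        have := (tendsto_one_div_add_atTop_nhds_zero_nat (𝕜 := ℝ)).const_mul (Mw g)
        simpa [div_eq_mul_inv] using this
      have t2 : Tendsto (fun n : ℕ => qcut (n + 1) (Mw g)) atTop (𝓝 1) := by
        have := (tendsto_const_nhds (x := (0:ℝ))).max (t1.const_sub 1)
        simpa [qcut] using this
      have := ((t2.pow 2).const_mul |w g|).mul_const (pk a g)
      simpa using this
  have lim2 : Tendsto (fun n : ℕ => K / Real.sqrt (n + 1) * I) atTop (𝓝 0) := by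
    have : Tendsto (fun n : ℕ => Real.sqrt ((n:ℝ) + 1)) atTop atTop :=
      Real.tendsto_sqrt_atTop.comp (tendsto_atTop_add_const_right _ _ tendsto_natCast_atTop_atTop)
    have := (this.const_div_atTop K).mul_const I
    simpa using this
  have fin : c * I ≤ K * (∫ g in {g | Mw g ≤ M0}, |w g| * pk a g) + K * (∫ g, gradNorm l k a w g * pk a g) + 0 := by
    refine le_of_tendsto_of_tendsto' (lim1.const_mul c) (lim2.const_add _) fun n => ?_
    refine (H (n + 1) w (by linarith [(n.cast_nonneg : (0:ℝ) ≤ n)]) hw hs).trans ?_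
    gcongr
    exact setIntegral_le_integral hi (Eventually.of_forall fun g => mul_nonneg (abs_nonneg _) (hpos g))
  rw [div_mul_eq_mul_div, le_div_iff₀ hc]
  linarith
end

section
variable {l : ℕ} {k : Fin (l + 1) → ℕ} {a : Fin (l + 1) → ℝ}

/-- sublevel sets of the weight -/
def Kc (k : Fin (l + 1) → ℕ) (R : ℝ) : Set (Heis l k) := {g | Mw g ≤ R}

lemma Kc_compact (R : ℝ) : IsCompact (Kc k R) := Mw_compact R

lemma Kc_meas (R : ℝ) : MeasurableSet (Kc k R) := (Kc_compact R).isClosed.measurableSet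

/-- families of moves along which differences are controlled by the gradient -/
structure Mv (a : Fin (l + 1) → ℝ) (T : Heis l k → Heis l k → Heis l k) : Prop where
  mp : ∀ v, MeasurePreserving (T v)
  est : ∀ S ρ : ℝ, ∃ ρ' : ℝ, ∃ C : NNReal, ∀ v, ‖v‖ ≤ S → (∀ g, g ∈ Kc k ρ → T v g ∈ Kc k ρ') ∧
    ∀ f, ContDiff ℝ 1 f → ∫⁻ g in Kc k ρ, ‖f (T v g) - f g‖ₑ ≤ C * ∫⁻ g in Kc k ρ', ‖gradNorm l k a f g‖ₑ

lemma mp_le {T : Heis l k → Heis l k} (hT : MeasurePreserving T) {A B : Set (Heis l k)} (hB : MeasurableSet B) (hA : ∀ g ∈ A, T g ∈ B)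
    {F : Heis l k → ENNReal} (hF : Measurable F) : ∫⁻ g in A, F (T g) ≤ ∫⁻ g in B, F g := by
  rw [← hT.setLIntegral_comp_preimage hB hF]
  exact lintegral_mono_set hA

lemma Kc_mono {x y : ℝ} (h : x ≤ y) : Kc k x ⊆ Kc k y := fun _ hg => le_trans hg h

lemma Mv.comp {T1 T2 : Heis l k → Heis l k → Heis l k} (h1 : Mv a T1) (h2 : Mv a T2) : Mv a (fun v g => T2 v (T1 v g)) := by
  refine ⟨fun v => (h2.mp v).comp (h1.mp v), fun S ρ => ?_⟩
  obtain ⟨ρ1, C1, H1⟩ := h1.est S ρ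
  obtain ⟨ρ2, C2, H2⟩ := h2.est S ρ1
  refine ⟨max ρ1 ρ2, C2 + C1, fun v hv => ⟨fun g hg => Kc_mono (le_max_right _ _) ((H2 v hv).1 _ ((H1 v hv).1 g hg)), fun f hf => ?_⟩⟩
  have hfc := hf.continuous
  have m1 := (h1.mp v).measurable
  have m2 := (h2.mp v).measurable
  have mf := hfc.measurable
  calc ∫⁻ g in Kc k ρ, ‖f (T2 v (T1 v g)) - f g‖ₑ ≤ ∫⁻ g in Kc k ρ, (‖f (T2 v (T1 v g)) - f (T1 v g)‖ₑ + ‖f (T1 v g) - f g‖ₑ) := by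
        refine lintegral_mono fun g => ?_
        refine le_trans (le_of_eq ?_) (enorm_add_le _ _)
        congr 1; ring
    _ = (∫⁻ g in Kc k ρ, ‖f (T2 v (T1 v g)) - f (T1 v g)‖ₑ) + ∫⁻ g in Kc k ρ, ‖f (T1 v g) - f g‖ₑ := by
        rw [lintegral_add_left]
        exact ((mf.comp (m2.comp m1)).sub (mf.comp m1)).enorm
    _ ≤ (∫⁻ g in Kc k ρ1, ‖f (T2 v g) - f g‖ₑ) + ∫⁻ g in Kc k ρ, ‖f (T1 v g) - f g‖ₑ := by
        refine add_le_add ?_ le_rfl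
        exact mp_le (h1.mp v) (Kc_meas _) (H1 v hv).1 (F := fun g => ‖f (T2 v g) - f g‖ₑ) ((mf.comp m2).sub mf).enorm
    _ ≤ C2 * (∫⁻ g in Kc k ρ2, ‖gradNorm l k a f g‖ₑ) + C1 * ∫⁻ g in Kc k ρ1, ‖gradNorm l k a f g‖ₑ :=
        add_le_add ((H2 v hv).2 f hf) ((H1 v hv).2 f hf)
    _ ≤ C2 * (∫⁻ g in Kc k (max ρ1 ρ2), ‖gradNorm l k a f g‖ₑ) + C1 * ∫⁻ g in Kc k (max ρ1 ρ2), ‖gradNorm l k a f g‖ₑ := by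
        gcongr
        · exact Kc_mono (le_max_right _ _)
        · exact Kc_mono (le_max_left _ _)
    _ = _ := by rw [← add_mul]; push_cast; rfl

lemma flow_diff_le (e : Dix k) {f : Heis l k → ℝ} (hf : ContDiff ℝ 1 f) (g : Heis l k) {x X : ℝ} (hx : |x| ≤ X) :
    ‖f (g + x • hdir a e g) - f g‖ₑ ≤ ∫⁻ s in Set.Icc (-X) X, ‖VF a e f (g + s • hdir a e g)‖ₑ := by
  have hc := VF_cont (a := a) e hf
  rw [← flow_ftc (VF_has (a := a) e (hf.differentiable (by norm_num))) hc]
  have hX := abs_le.1 hx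
  have hX0 : 0 ≤ X := (abs_nonneg _).trans hx
  rw [enorm_eq_nnnorm, ← enorm_eq_nnnorm, ← enorm_norm, intervalIntegral.norm_intervalIntegral_eq, enorm_norm]
  refine (enorm_integral_le_lintegral_enorm _).trans ?_
  refine lintegral_mono_set fun s hs => ?_
  rw [Set.mem_uIoc] at hs
  rcases hs with hs | hs <;> constructor <;> linarith [hs.1, hs.2]

lemma Mv_flow (e : Dix k) (c : Heis l k → ℝ) (hc : ∀ S, ∃ X, ∀ v, ‖v‖ ≤ S → |c v| ≤ X) : Mv a (fun v g => g + c v • hdir a e g) := by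
  refine ⟨fun v => flow_mp e _, fun S ρ => ?_⟩
  obtain ⟨X, hX⟩ := hc S
  have hcomp : IsCompact ((fun q : ℝ × Heis l k => Mw (q.2 + q.1 • hdir a e q.2)) '' (Set.Icc (-X) X ×ˢ Kc k ρ)) :=
    (isCompact_Icc.prod (Kc_compact ρ)).image (Mw_cont.comp (flow_cont e))
  obtain ⟨ρ', hρ'⟩ := hcomp.bddAbove
  have hmap : ∀ x ∈ Set.Icc (-X) X, ∀ g ∈ Kc k ρ, g + x • hdir a e g ∈ Kc k ρ' := fun x hx g hg =>
    hρ' ⟨(x, g), ⟨hx, hg⟩, rfl⟩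
  refine ⟨ρ', (2 * X).toNNReal, fun v hv => ⟨fun g hg => hmap _ (abs_le.1 (hX v hv)) g hg, fun f hf => ?_⟩⟩
  have hVc := VF_cont (a := a) e hf
  have hfl := flow_cont (a := a) e
  calc ∫⁻ g in Kc k ρ, ‖f (g + c v • hdir a e g) - f g‖ₑ ≤ ∫⁻ g in Kc k ρ, ∫⁻ s in Set.Icc (-X) X, ‖VF a e f (g + s • hdir a e g)‖ₑ :=
        lintegral_mono fun g => flow_diff_le e hf g (hX v hv)
    _ = ∫⁻ s in Set.Icc (-X) X, ∫⁻ g in Kc k ρ, ‖VF a e f (g + s • hdir a e g)‖ₑ := by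
        rw [lintegral_lintegral_swap]
        have := (hVc.comp hfl).measurable.enorm.comp (measurable_swap (α := Heis l k) (β := ℝ))
        exact this.aemeasurable
    _ ≤ ∫⁻ s in Set.Icc (-X) X, ∫⁻ g in Kc k ρ', ‖VF a e f g‖ₑ := by
        refine setLIntegral_mono' measurableSet_Icc fun s hs => ?_
        exact mp_le (flow_mp e s) (Kc_meas _) (fun g hg => hmap s hs g hg) (F := fun g => ‖VF a e f g‖ₑ) hVc.measurable.enorm
    _ = (∫⁻ g in Kc k ρ', ‖VF a e f g‖ₑ) * ENNReal.ofReal (2 * X) := by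
        rw [setLIntegral_const, Real.volume_Icc]; congr 2; ring
    _ ≤ ENNReal.ofReal (2 * X) * ∫⁻ g in Kc k ρ', ‖gradNorm l k a f g‖ₑ := by
        rw [mul_comm]
        gcongr with g
        rw [← ofReal_norm, ← ofReal_norm]
        apply ENNReal.ofReal_le_ofReal
        simp only [Real.norm_eq_abs]
        exact (VF_le e f g).trans (le_abs_self _)

lemma Mv_id : Mv a (fun (_ : Heis l k) g => g) := by
  refine ⟨fun v => MeasurePreserving.id _, fun S ρ => ⟨ρ, 0, fun v hv => ⟨fun g hg => hg, fun f hf => ?_⟩⟩⟩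
  simp

/-- consecutive coordinate moves -/
def mvL (a : Fin (l + 1) → ℝ) : List (Dix k) → Heis l k → Heis l k → Heis l k
  | [], _, g => g
  | e :: L, v, g => mvL a L v g + kap e v • hdir a e (mvL a L v g)

lemma kap_bd (e : Dix k) (v : Heis l k) : |kap e v| ≤ ‖v‖ := by
  have h1 : ‖v.1 e.1 e.2.1‖ ≤ ‖v‖ := ((norm_le_pi_norm _ _).trans (norm_le_pi_norm v.1 e.1)).trans (norm_fst_le v)
  unfold kap
  split_ifs
  · exact (Complex.abs_re_le_norm _).trans h1
  · exact (Complex.abs_im_le_norm _).trans h1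

lemma mvL_Mv (L : List (Dix k)) : Mv a (mvL a L) := by
  induction L with
  | nil => exact Mv_id
  | cons e L ih => exact ih.comp (Mv_flow e (fun v => kap e v) fun S => ⟨S, fun v hv => (kap_bd e v).trans hv⟩)

/-- coordinate vector -/
def Evec (e : Dix k) : (i : Fin (l + 1)) → (Fin (k i) → ℂ) := Pi.single e.1 (Pi.single e.2.1 (uni e))

lemma mvL_eq (L : List (Dix k)) : ∃ B : ((i : Fin (l + 1)) → (Fin (k i) → ℂ)) → ((i : Fin (l + 1)) → (Fin (k i) → ℂ)) → ℝ,
    Continuous (fun q : ((i : Fin (l + 1)) → (Fin (k i) → ℂ)) × ((i : Fin (l + 1)) → (Fin (k i) → ℂ)) => B q.1 q.2) ∧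
    ∀ v g : Heis l k, mvL a L v g = (g.1 + (L.map fun e => kap e v • Evec e).sum, g.2 + B g.1 v.1) := by
  induction L with
  | nil => exact ⟨fun _ _ => 0, continuous_const, fun v g => by simp [mvL]⟩
  | cons e L ih =>
    obtain ⟨B, hB, ih⟩ := ih
    refine ⟨fun z ζ => B z ζ + kap e (ζ, 0) * (2 * a e.1 * sig e (z + (L.map fun e => kap e (ζ, 0) • Evec e).sum, 0)), ?_, fun v g => ?_⟩
    · have h1 := kap_cont e
      have h2 := sig_cont e
      refine hB.add (Continuous.mul (by fun_prop) (Continuous.mul (by fun_prop) (h2.comp (Continuous.prodMk (Continuous.add (by fun_prop) ?_) continuous_const))))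
      refine continuous_list_sum (f := fun e (q : ((i : Fin (l + 1)) → (Fin (k i) → ℂ)) × ((i : Fin (l + 1)) → (Fin (k i) → ℂ))) => kap e (q.2, 0) • Evec e) L fun e _ => ?_
      have := kap_cont e
      fun_prop
    · rw [mvL, ih]
      ext1
      · simp [hdir, Evec]
        abel
      · simp only [hdir, Prod.snd_add, Prod.smul_snd, smul_eq_mul, add_assoc]
        rfl

lemma sum_Evec (v : Heis l k) : ((Finset.univ : Finset (Dix k)).toList.map fun e => kap e v • Evec e).sum = v.1 := by
  rw [Finset.sum_map_toList]
  ext i j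
  rw [Fintype.sum_sigma]
  simp only [Fintype.sum_prod_type, Fintype.sum_bool, kap, Evec, uni]
  simp [Finset.sum_apply]
  rw [Finset.sum_eq_single i]
  · rw [Finset.sum_eq_single j]
    · simp
    · intro b _ hb
      simp [Pi.single_eq_of_ne hb.symm]
    · simp
  · intro b _ hb
    simp [Pi.single_eq_of_ne hb.symm]
  · simp

end

section
variable {l : ℕ} {k : Fin (l + 1) → ℕ} {a : Fin (l + 1) → ℝ}

/-- flow map -/
def flw (a : Fin (l + 1) → ℝ) (e : Dix k) (s : ℝ) (g : Heis l k) : Heis l k := g + s • hdir a e g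

lemma flw_fst (e : Dix k) (s : ℝ) (g : Heis l k) : (flw a e s g).1 = g.1 + s • Evec e := rfl

lemma flw_snd (e : Dix k) (s : ℝ) (g : Heis l k) : (flw a e s g).2 = g.2 + s * (2 * a e.1 * sig e g) := rfl

lemma sig_true (i) (j : Fin (k i)) (e : Bool) (s : ℝ) (g : Heis l k) : sig ⟨i, j, true⟩ (flw a ⟨i, j, e⟩ s g) = sig ⟨i, j, true⟩ g + if e then 0 else s := by
  simp only [sig, flw_fst, Evec, uni]
  cases e <;> simp

lemma sig_false (i) (j : Fin (k i)) (e : Bool) (s : ℝ) (g : Heis l k) : sig ⟨i, j, false⟩ (flw a ⟨i, j, e⟩ s g) = sig ⟨i, j, false⟩ g - if e then s else 0 := by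
  simp only [sig, flw_fst, Evec, uni]
  cases e <;> simp
  ring

lemma comm_eq' {i : Fin (l + 1)} (ha : a i = 1) (j : Fin (k i)) (x y : ℝ) (g : Heis l k) :
    flw a ⟨i, j, false⟩ (-y) (flw a ⟨i, j, true⟩ (-x) (flw a ⟨i, j, false⟩ y (flw a ⟨i, j, true⟩ x g))) = (g.1, g.2 + (-4 * x * y)) := by
  ext1
  · simp only [flw_fst, neg_smul]
    abel
  · simp only [flw_snd, sig_true, sig_false, ha, if_true, if_false]
    simp
    ring

lemma comm_eq {i : Fin (l + 1)} (ha : a i = 1) (j : Fin (k i)) (x y : ℝ) (g : Heis l k) :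
    g + x • hdir a ⟨i, j, true⟩ g + y • hdir a ⟨i, j, false⟩ (g + x • hdir a ⟨i, j, true⟩ g) +
        -x • hdir a ⟨i, j, true⟩ (g + x • hdir a ⟨i, j, true⟩ g + y • hdir a ⟨i, j, false⟩ (g + x • hdir a ⟨i, j, true⟩ g)) +
      -y •
        hdir a ⟨i, j, false⟩
          (g + x • hdir a ⟨i, j, true⟩ g + y • hdir a ⟨i, j, false⟩ (g + x • hdir a ⟨i, j, true⟩ g) +
            -x • hdir a ⟨i, j, true⟩ (g + x • hdir a ⟨i, j, true⟩ g + y • hdir a ⟨i, j, false⟩ (g + x • hdir a ⟨i, j, true⟩ g))) = (g.1, g.2 + (-4 * x * y)) :=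
  comm_eq' ha j x y g

lemma Par.Mv_vert (h : Par k a) : Mv a (fun (v : Heis l k) g => (g.1, g.2 + v.2)) := by
  set j0 : Fin (k (Fin.last l)) := ⟨0, h.hk _⟩
  set e1 : Dix k := ⟨Fin.last l, j0, true⟩ with he1
  set e2 : Dix k := ⟨Fin.last l, j0, false⟩ with he2
  set x : Heis l k → ℝ := fun v => Real.sqrt |v.2| / 2 with hx
  set y : Heis l k → ℝ := fun v => -(SignType.sign v.2 * Real.sqrt |v.2|) / 2 with hy
  have hxb : ∀ v, |x v| ≤ Real.sqrt |v.2| := fun v => by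
    simp only [hx]; rw [abs_of_nonneg (by positivity)]; linarith [Real.sqrt_nonneg |v.2|]
  have hyb : ∀ v, |y v| ≤ Real.sqrt |v.2| := fun v => by
    simp only [hy]
    rw [abs_div, abs_neg, abs_mul, abs_of_nonneg (Real.sqrt_nonneg _)]
    have : |((SignType.sign v.2 : SignType) : ℝ)| ≤ 1 := by
      rcases lt_trichotomy v.2 0 with q | q | q <;> simp [q]
    have h2 := Real.sqrt_nonneg |v.2|
    rw [abs_of_pos (by norm_num : (0:ℝ) < 2)]
    nlinarith
  have hb : ∀ c : Heis l k → ℝ, (∀ v, |c v| ≤ Real.sqrt |v.2|) → ∀ S, ∃ X, ∀ v, ‖v‖ ≤ S → |c v| ≤ X := fun c hc S =>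
    ⟨Real.sqrt S, fun v hv => (hc v).trans (Real.sqrt_le_sqrt ((norm_snd_le v).trans hv))⟩
  have hxy : ∀ v, -4 * x v * y v = v.2 := fun v => by
    simp only [hx, hy]
    have : Real.sqrt |v.2| ^ 2 = |v.2| := Real.sq_sqrt (abs_nonneg _)
    calc _ = SignType.sign v.2 * Real.sqrt |v.2| ^ 2 := by ring
      _ = _ := by rw [this, sign_mul_abs]
  have m1 := Mv_flow (a := a) e1 x (hb x hxb)
  have m2 := Mv_flow (a := a) e2 y (hb y hyb)
  have m3 := Mv_flow (a := a) e1 (fun v => -x v) (hb _ fun v => by rw [abs_neg]; exact hxb v)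
  have m4 := Mv_flow (a := a) e2 (fun v => -y v) (hb _ fun v => by rw [abs_neg]; exact hyb v)
  have m := ((m1.comp m2).comp m3).comp m4
  convert m using 3 with v g
  rw [comm_eq h.hlast j0 (x v) (y v) g, hxy]

lemma Par.Mv_all (h : Par k a) : ∃ B : ((i : Fin (l + 1)) → (Fin (k i) → ℂ)) → ((i : Fin (l + 1)) → (Fin (k i) → ℂ)) → ℝ,
    Continuous (fun q : ((i : Fin (l + 1)) → (Fin (k i) → ℂ)) × ((i : Fin (l + 1)) → (Fin (k i) → ℂ)) => B q.1 q.2) ∧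
    Mv a (fun v g : Heis l k => (g.1 + v.1, g.2 + B g.1 v.1 + v.2)) := by
  obtain ⟨B, hB, hB2⟩ := mvL_eq (k := k) (a := a) (Finset.univ : Finset (Dix k)).toList
  refine ⟨B, hB, ?_⟩
  have := (mvL_Mv (a := a) (Finset.univ : Finset (Dix k)).toList).comp h.Mv_vert
  convert this using 3 with v g
  rw [hB2, sum_Evec]

lemma Par.poincare (h : Par k a) (ρ : ℝ) : ∃ ρ' : ℝ, ∃ C : NNReal, ∀ f : Heis l k → ℝ, ContDiff ℝ 1 f →
    ∫⁻ g in Kc k ρ, ∫⁻ g' in Kc k ρ, ‖f g' - f g‖ₑ ≤ C * ∫⁻ g in Kc k ρ', ‖gradNorm l k a f g‖ₑ := by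
  obtain ⟨B, hB, hM⟩ := h.Mv_all
  set T : Heis l k → Heis l k → Heis l k := fun v g => (g.1 + v.1, g.2 + B g.1 v.1 + v.2) with hT
  have hTc : Continuous (fun q : Heis l k × Heis l k => T q.1 q.2) := by
    have : Continuous (fun q : Heis l k × Heis l k => B q.2.1 q.1.1) := hB.comp (f := fun q : Heis l k × Heis l k => (q.2.1, q.1.1)) (by fun_prop)
    simp only [hT]
    fun_prop
  -- bound for the parameter
  have hvc : Continuous (fun q : Heis l k × Heis l k => ‖((q.2.1 - q.1.1, q.2.2 - q.1.2 - B q.1.1 (q.2.1 - q.1.1)) : Heis l k)‖) := by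
    have : Continuous (fun q : Heis l k × Heis l k => B q.1.1 (q.2.1 - q.1.1)) := hB.comp (f := fun q : Heis l k × Heis l k => (q.1.1, q.2.1 - q.1.1)) (by fun_prop)
    fun_prop
  obtain ⟨S, hS⟩ := (((Kc_compact (k := k) ρ).prod (Kc_compact (k := k) ρ)).image hvc).bddAbove
  have hS' : ∀ g ∈ Kc k ρ, ∀ v, T v g ∈ Kc k ρ → ‖v‖ ≤ S := fun g hg v hv => by
    have := hS ⟨(g, T v g), ⟨hg, hv⟩, rfl⟩
    simp only [hT] at this
    have e1 : g.2 + B g.1 v.1 + v.2 - g.2 - B g.1 v.1 = v.2 := by ring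
    simpa [e1, Prod.norm_def] using this
  obtain ⟨ρ', C, H⟩ := hM.est S ρ
  have hfin : volume (Metric.closedBall (0 : Heis l k) S) ≠ ⊤ := measure_closedBall_lt_top.ne
  refine ⟨ρ', (volume (Metric.closedBall (0 : Heis l k) S)).toNNReal * C, fun f hf => ?_⟩
  have hfc := hf.continuous
  have hmp : ∀ g, MeasurePreserving (fun v => T v g) := fun g => by
    have := shear_mp (l := l) (k := k) g.1 (fun ζ => g.2 + B g.1 ζ) (by
      have : Continuous (fun ζ => B g.1 ζ) := hB.comp (f := fun ζ => (g.1, ζ)) (by fun_prop)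
      exact Continuous.measurable (by fun_prop))
    convert this using 3 with v
    · exact add_comm _ _
    · ring
  calc ∫⁻ g in Kc k ρ, ∫⁻ g' in Kc k ρ, ‖f g' - f g‖ₑ ≤ ∫⁻ g in Kc k ρ, ∫⁻ v in Metric.closedBall (0 : Heis l k) S, ‖f (T v g) - f g‖ₑ := by
        refine setLIntegral_mono' (Kc_meas ρ) fun g hg => ?_
        rw [← (hmp g).setLIntegral_comp_preimage (Kc_meas ρ) (f := fun g' => ‖f g' - f g‖ₑ) (hfc.sub continuous_const).measurable.enorm]
        refine lintegral_mono_set fun v hv => ?_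
        rw [mem_closedBall_zero_iff]
        exact hS' g hg v hv
    _ = ∫⁻ v in Metric.closedBall (0 : Heis l k) S, ∫⁻ g in Kc k ρ, ‖f (T v g) - f g‖ₑ := by
        rw [lintegral_lintegral_swap]
        have : Continuous (fun q : Heis l k × Heis l k => f (T q.2 q.1) - f q.1) := by
          have := hfc.comp (hTc.comp continuous_swap)
          exact Continuous.sub this (by fun_prop)
        exact this.measurable.enorm.aemeasurable
    _ ≤ ∫⁻ v in Metric.closedBall (0 : Heis l k) S, C * ∫⁻ g in Kc k ρ', ‖gradNorm l k a f g‖ₑ := by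
        refine setLIntegral_mono' measurableSet_closedBall fun v hv => ?_
        rw [mem_closedBall_zero_iff] at hv
        exact (H v hv).2 f hf
    _ = _ := by
        rw [setLIntegral_const, ENNReal.coe_mul, ENNReal.coe_toNNReal hfin]
        ring
end

lemma sin_cube {x : ℝ} (hx : |x| ≤ 1) : |x - Real.sin x| ≤ |x| ^ 3 / 4 := by
  have h := Real.sin_bound hx
  have h0 := abs_nonneg x
  have e : x - Real.sin x = -(Real.sin x - (x - x ^ 3 / 6)) + x ^ 3 / 6 := by ring
  rw [e]
  refine (abs_add_le _ _).trans ?_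
  rw [abs_neg, abs_div, abs_pow, abs_of_pos (by norm_num : (0:ℝ) < 6)]
  have h3 : 0 ≤ |x| ^ 3 := by positivity
  have h4 : |x| ^ 5 ≤ |x| ^ 3 := by
    calc |x| ^ 5 = |x| ^ 3 * |x| ^ 2 := by ring
      _ ≤ |x| ^ 3 * 1 ^ 2 := by gcongr
      _ = _ := by ring
  linarith

lemma sin_quad (x : ℝ) : |x - Real.sin x| ≤ 2 * x ^ 2 := by
  have h0 := abs_nonneg x
  rw [← sq_abs x]
  by_cases hx : |x| ≤ 1
  · refine (sin_cube hx).trans ?_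
    have : |x| ^ 3 ≤ |x| ^ 2 := by
      calc |x| ^ 3 = |x| ^ 2 * |x| := by ring
        _ ≤ |x| ^ 2 * 1 := by gcongr
        _ = _ := by ring
    have : 0 ≤ |x| ^ 2 := by positivity
    linarith
  · push Not at hx
    refine (abs_sub _ _).trans ?_
    have := Real.abs_sin_le_abs (x := x)
    nlinarith

lemma sin_ne {x : ℝ} (h1 : |x| < π) (h0 : x ≠ 0) : Real.sin x ≠ 0 := by
  obtain ⟨h1, h2⟩ := abs_lt.1 h1
  rcases lt_or_gt_of_ne h0 with h | h
  · exact (Real.sin_neg_of_neg_of_neg_pi_lt h h1).ne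
  · exact (Real.sin_pos_of_pos_of_lt_pi h h2).ne'

lemma one_le_sdiv {x : ℝ} (h1 : |x| < π) : 1 ≤ sdiv x ^ 2 := by
  unfold sdiv
  split_ifs with h
  · norm_num
  · have h2 := sin_ne h1 h
    rw [div_pow, one_le_div (by positivity), ← sq_abs, ← sq_abs x]
    have := Real.abs_sin_le_abs (x := x)
    gcongr

lemma sdiv_le {x : ℝ} (h1 : |x| ≤ π / 2) : sdiv x ^ 2 ≤ (π / 2) ^ 2 := by
  have hp := Real.pi_gt_three
  unfold sdiv
  split_ifs with h
  · nlinarith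
  · have h2 := Real.mul_abs_le_abs_sin h1
    have h3 := sin_ne (by linarith) h
    rw [← sq_abs, abs_div]
    have h4 : |x| / |Real.sin x| ≤ π / 2 := by
      rw [div_le_iff₀ (by positivity)]
      calc |x| = π / 2 * (2 / π * |x|) := by field_simp
        _ ≤ _ := by gcongr
    gcongr

lemma muF_le {x : ℝ} (h1 : |x| < π) : |muF x| ≤ 4 * sdiv x ^ 2 := by
  unfold muF sdiv
  split_ifs with h
  · simp [h]
  · have h2 := sin_ne h1 h
    have h3 := sin_quad (2 * x)
    rw [abs_div, abs_of_nonneg (by positivity : 0 ≤ 2 * Real.sin x ^ 2), div_pow, div_le_iff₀ (by positivity)]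
    have : 4 * (x ^ 2 / Real.sin x ^ 2) * (2 * Real.sin x ^ 2) = 8 * x ^ 2 := by field_simp; norm_num
    rw [this]
    linarith

lemma muF_neg (x : ℝ) : muF (-x) = - muF x := by
  unfold muF
  have : (2 * -x) = -(2 * x) := by ring
  rw [this, Real.sin_neg, Real.sin_neg]
  ring

lemma muF_nonneg {x : ℝ} (h : 0 ≤ x) : 0 ≤ muF x := by
  unfold muF
  have := Real.sin_le (by linarith : 0 ≤ 2 * x)
  apply div_nonneg <;> [linarith; positivity]

lemma muF_small {x : ℝ} (h : |x| ≤ 1 / 2) : |muF x| ≤ 4 * |x| := by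
  by_cases hx : x = 0
  · simp [hx, muF]
  have h0 : 0 < |x| := abs_pos.2 hx
  have h1 := sin_cube (x := x) (by linarith)
  have h2 := sin_cube (x := 2 * x) (by rw [abs_mul]; norm_num; linarith)
  have h3 : |x| / 2 ≤ |Real.sin x| := by
    have := abs_sub_abs_le_abs_sub x (Real.sin x)
    have : |x| ^ 3 ≤ |x| := by
      calc |x| ^ 3 = |x| ^ 2 * |x| := by ring
        _ ≤ 1 ^ 2 * |x| := by gcongr; linarith
        _ = _ := by ring
    linarith
  unfold muF
  have h4 : (|x| / 2) ^ 2 ≤ Real.sin x ^ 2 := by rw [← sq_abs (Real.sin x)]; gcongr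
  have h5 : 0 < (|x| / 2) ^ 2 := by positivity
  rw [abs_div, abs_of_nonneg (by positivity : 0 ≤ 2 * Real.sin x ^ 2), div_le_iff₀ (by linarith)]
  rw [abs_mul, abs_of_pos (by norm_num : (0:ℝ) < 2)] at h2
  calc _ ≤ _ := h2
    _ = 4 * |x| * (2 * (|x| / 2) ^ 2) := by ring
    _ ≤ _ := by gcongr

lemma muF_cont : ContinuousOn muF (Set.Ioo (-π) π) := by
  intro x hx
  apply ContinuousAt.continuousWithinAt
  by_cases h : x = 0
  · subst h
    have h0 : muF 0 = 0 := by simp [muF]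
    unfold ContinuousAt
    rw [h0]
    have hp := Real.pi_gt_three
    refine squeeze_zero_norm' (a := fun x => 4 * |x|) ?_ ?_
    · have : Metric.closedBall (0:ℝ) (1 / 2) ∈ 𝓝 (0:ℝ) := Metric.closedBall_mem_nhds _ (by norm_num)
      filter_upwards [this] with y hy
      rw [mem_closedBall_zero_iff] at hy
      exact muF_small hy
    · have : Continuous (fun x : ℝ => 4 * |x|) := by fun_prop
      simpa using this.tendsto 0
  · have := sin_ne (abs_lt.2 hx) h
    unfold muF
    refine ContinuousAt.div (by fun_prop) (by fun_prop) (by positivity)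

section
variable {l : ℕ} {k : Fin (l + 1) → ℕ} {a : Fin (l + 1) → ℝ}

/-- the function whose root is the angle -/
def Phi (a : Fin (l + 1) → ℝ) (r : Fin (l + 1) → ℝ) (θ : ℝ) : ℝ := ∑ j, a j * muF (a j * θ) * r j

lemma Phi_neg (r : Fin (l + 1) → ℝ) (θ : ℝ) : Phi a r (-θ) = - Phi a r θ := by
  unfold Phi
  rw [← Finset.sum_neg_distrib]
  refine Finset.sum_congr rfl fun j _ => ?_
  rw [mul_neg, muF_neg]; ring

lemma Par.Phi_ge (h : Par k a) {r : Fin (l + 1) → ℝ} (hr : ∀ j, 0 ≤ r j) {θ : ℝ} (hθ : 0 ≤ θ) : muF θ * r (Fin.last l) ≤ Phi a r θ := by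
  have := Finset.single_le_sum (f := fun j => a j * muF (a j * θ) * r j) (fun j _ => mul_nonneg (mul_nonneg (h.ha j).le (muF_nonneg (mul_nonneg (h.ha j).le hθ))) (hr j)) (Finset.mem_univ (Fin.last l))
  unfold Phi
  simpa [h.hlast] using this

lemma Par.abs_lt_pi (h : Par k a) {θ x : ℝ} (hθ : |θ| < x) (j) : |a j * θ| < x := by
  rw [abs_mul, abs_of_pos (h.ha j)]
  have := h.le_one j
  nlinarith [abs_nonneg θ, h.ha j]

lemma Par.Phi_cont (h : Par k a) (r : Fin (l + 1) → ℝ) : ContinuousOn (Phi a r) (Set.Ioo (-π) π) := by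
  unfold Phi
  refine continuousOn_finsetSum _ fun j _ => ?_
  refine ContinuousOn.mul (ContinuousOn.mul continuousOn_const (muF_cont.comp (by fun_prop) ?_)) continuousOn_const
  intro θ hθ
  exact abs_lt.1 (h.abs_lt_pi (abs_lt.2 hθ) j)

lemma Par.exists_theta (h : Par k a) {r : Fin (l + 1) → ℝ} (hr : ∀ j, 0 ≤ r j) (hl : 0 < r (Fin.last l)) (t : ℝ) :
    ∃ θ ∈ Set.Ioo (-π) π, t = Phi a r θ := by
  have hp := Real.pi_gt_three
  set R := r (Fin.last l)
  set δ := min 1 (R / (|t| + 1)) with hδ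
  have ht := abs_nonneg t
  have hδ0 : 0 < δ := lt_min one_pos (by positivity)
  have hδ1 : δ ≤ 1 := min_le_left _ _
  have hδ2 : δ * (|t| + 1) ≤ R := by
    have := min_le_right 1 (R / (|t| + 1))
    rwa [← hδ, le_div_iff₀ (by positivity)] at this
  have hs1 : Real.sin (π - δ) = Real.sin δ := Real.sin_pi_sub δ
  have hs2 : 0 < Real.sin δ := Real.sin_pos_of_pos_of_lt_pi hδ0 (by linarith)
  have hs3 : Real.sin δ ≤ δ := Real.sin_le hδ0.le
  have hmu : |t| ≤ muF (π - δ) * R := by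
    unfold muF
    rw [hs1, div_mul_eq_mul_div, le_div_iff₀ (by positivity)]
    have h1 := Real.sin_le_one (2 * (π - δ))
    have h2 : (2:ℝ) ≤ 2 * (π - δ) - Real.sin (2 * (π - δ)) := by linarith
    have h3 : Real.sin δ ^ 2 ≤ δ := by nlinarith
    calc |t| * (2 * Real.sin δ ^ 2) ≤ |t| * (2 * δ) := by gcongr
      _ ≤ 2 * R := by nlinarith
      _ ≤ _ := by gcongr
  have hP : |t| ≤ Phi a r (π - δ) := hmu.trans (h.Phi_ge hr (by linarith))
  have hP2 : Phi a r (-(π - δ)) ≤ -|t| := by rw [Phi_neg]; linarith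
  have hsub : Set.Icc (-(π - δ)) (π - δ) ⊆ Set.Ioo (-π) π := fun x hx => ⟨by linarith [hx.1], by linarith [hx.2]⟩
  have := intermediate_value_Icc (by linarith : -(π - δ) ≤ π - δ) ((h.Phi_cont r).mono hsub)
  obtain ⟨θ, hθ, e⟩ := this ⟨hP2.trans (neg_abs_le t), (le_abs_self t).trans hP⟩
  exact ⟨θ, hsub hθ, e.symm⟩

lemma Par.theta_spec (h : Par k a) {g : Heis l k} (hl : 0 < zNormSq l k g.1 (Fin.last l)) :
    |thetaOf l k a g| < π ∧ g.2 = Phi a (zNormSq l k g.1) (thetaOf l k a g) := by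
  have := Classical.epsilon_spec (p := fun θ : ℝ => θ ∈ Set.Ioo (-Real.pi) Real.pi ∧
    g.2 = ∑ j, a j * muF (a j * θ) * zNormSq l k g.1 j) (h.exists_theta (zNormSq_nonneg _) hl g.2)
  exact ⟨abs_lt.2 this.1, this.2⟩

lemma zNormSq_pos {z : (i : Fin (l + 1)) → Fin (k i) → ℂ} {i} (hz : z i ≠ 0) : 0 < zNormSq l k z i := by
  obtain ⟨j, hj⟩ := Function.ne_iff.1 hz
  exact lt_of_lt_of_le (Complex.normSq_pos.2 hj) (Finset.single_le_sum (f := fun j => Complex.normSq (z i j)) (fun _ _ => Complex.normSq_nonneg _) (Finset.mem_univ j))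

lemma Par.ball_sub (h : Par k a) : ballCC l k a ⊆ Kc k 7 ∪ {g | g.1 (Fin.last l) = 0} := by
  intro g hg
  by_cases hz : g.1 (Fin.last l) = 0
  · exact Or.inr hz
  left
  obtain ⟨h1, h2⟩ := h.theta_spec (zNormSq_pos hz)
  set θ := thetaOf l k a g with hθ
  set r := zNormSq l k g.1 with hr
  have hr0 : ∀ j, 0 ≤ r j := zNormSq_nonneg _
  have hd : ∑ j, (sdiv (a j * θ)) ^ 2 * r j < 1 := by
    have : ccDist l k a g < 1 := hg
    unfold ccDist ccDistSq at this
    rw [if_pos (Or.inl hz), Real.sqrt_lt' one_pos] at this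
    simpa using this
  have hR : ∑ j, r j ≤ ∑ j, (sdiv (a j * θ)) ^ 2 * r j := Finset.sum_le_sum fun j _ => by
    have := one_le_sdiv (h.abs_lt_pi h1 j)
    nlinarith [hr0 j]
  have ht : |g.2| ≤ 4 * ∑ j, (sdiv (a j * θ)) ^ 2 * r j := by
    rw [h2, Phi, Finset.mul_sum]
    refine (Finset.abs_sum_le_sum_abs _ _).trans (Finset.sum_le_sum fun j _ => ?_)
    rw [abs_mul, abs_mul, abs_of_nonneg (hr0 j), abs_of_pos (h.ha j)]
    have q := muF_le (h.abs_lt_pi h1 j)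
    have q1 := h.le_one j
    have q2 := h.ha j
    have q3 := hr0 j
    calc a j * |muF (a j * θ)| * r j ≤ 1 * (4 * sdiv (a j * θ) ^ 2) * r j := by gcongr
      _ = _ := by ring
  show Mw g ≤ 7
  unfold Mw
  rw [← hr]
  have := sqrt_one_le g.2
  linarith

lemma Par.ball_null (h : Par k a) : volume {g : Heis l k | g.1 (Fin.last l) = 0} = 0 := by
  let S : Submodule ℝ (Heis l k) := LinearMap.ker ((LinearMap.proj (Fin.last l) : ((i : Fin (l + 1)) → (Fin (k i) → ℂ)) →ₗ[ℝ] _) ∘ₗ LinearMap.fst ℝ _ _)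
  have hS : (S : Set (Heis l k)) = {g : Heis l k | g.1 (Fin.last l) = 0} := by
    ext g; simp [S]
  rw [← hS]
  haveI i1 : ∀ i, (volume : Measure (Fin (k i) → ℂ)).IsAddHaarMeasure := fun i => inferInstance
  haveI i2 : (volume : Measure ((i : Fin (l + 1)) → (Fin (k i) → ℂ))).IsAddHaarMeasure :=
    inferInstanceAs (Measure.pi fun i => (volume : Measure (Fin (k i) → ℂ))).IsAddHaarMeasure
  haveI i3 : (volume : Measure (Heis l k)).IsAddHaarMeasure :=
    inferInstanceAs ((volume : Measure ((i : Fin (l + 1)) → (Fin (k i) → ℂ))).prod (volume : Measure ℝ)).IsAddHaarMeasure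
  refine Measure.addHaar_submodule _ S ?_
  intro ht
  have : ((Pi.single (Fin.last l) (fun _ => 1), 0) : Heis l k) ∈ S := by rw [ht]; trivial
  have h2 : ((Pi.single (Fin.last l) (fun _ => 1), 0) : Heis l k) ∈ (S : Set (Heis l k)) := this
  rw [hS] at h2
  simp at h2
  have := congrFun h2 ⟨0, h.hk _⟩
  simp at this

lemma Par.ball_ae (h : Par k a) : ∀ᵐ g ∂(volume : Measure (Heis l k)), g ∈ ballCC l k a → g ∈ Kc k 7 := by
  have : ∀ᵐ g ∂(volume : Measure (Heis l k)), g ∉ {g : Heis l k | g.1 (Fin.last l) = 0} := measure_eq_zero_iff_ae_notMem.1 h.ball_null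
  filter_upwards [this] with g hg hb
  exact (h.ball_sub hb).resolve_right hg

lemma Par.ball_pos (h : Par k a) : 0 < volume (ballCC l k a) := by
  have hc := zNormSq_cont (l := l) (k := k)
  set U : Set (Heis l k) := {g | |g.2| < zNormSq l k g.1 (Fin.last l)} ∩ {g | ∑ j, zNormSq l k g.1 j < 1 / 4} with hU
  have hUo : IsOpen U := (isOpen_lt (by fun_prop) (by fun_prop)).inter (isOpen_lt (by fun_prop) (by fun_prop))
  have hUn : U.Nonempty := by
    refine ⟨(Pi.single (Fin.last l) (Pi.single ⟨0, h.hk _⟩ (1 / 4)), 0), ?_, ?_⟩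
    · simp only [Set.mem_setOf_eq, abs_zero]
      apply zNormSq_pos
      simp
    · simp only [Set.mem_setOf_eq]
      rw [Finset.sum_eq_single (Fin.last l)]
      · simp only [zNormSq, Pi.single_eq_same]
        rw [Finset.sum_eq_single ⟨0, h.hk _⟩]
        · simp [Complex.normSq_apply]; norm_num
        · intro b _ hb
          simp [Pi.single_eq_of_ne hb]
        · simp
      · intro b _ hb
        simp [zNormSq, Pi.single_eq_of_ne hb]
      · simp
  refine (hUo.measure_pos volume hUn).trans_le (measure_mono fun g hg => ?_)
  obtain ⟨hg1, hg2⟩ := hg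
  simp only [Set.mem_setOf_eq] at hg1 hg2
  have hl : 0 < zNormSq l k g.1 (Fin.last l) := (abs_nonneg _).trans_lt hg1
  have hz : g.1 (Fin.last l) ≠ 0 := fun hz => by
    simp [zNormSq, hz] at hl
  obtain ⟨h1, h2⟩ := h.theta_spec hl
  show ccDist l k a g < 1
  unfold ccDist ccDistSq
  rw [if_pos (Or.inl hz), Real.sqrt_lt' one_pos]
  set θ := thetaOf l k a g with hθ
  set r := zNormSq l k g.1 with hr
  have hr0 : ∀ j, 0 ≤ r j := zNormSq_nonneg _
  have key : ∀ x : ℝ, π / 2 ≤ x → x < π → r (Fin.last l) ≤ Phi a r x := fun x hx hx2 => by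
    refine le_trans ?_ (h.Phi_ge hr0 (by linarith [Real.pi_pos]))
    have hs : 0 < Real.sin x := Real.sin_pos_of_pos_of_lt_pi (by linarith [Real.pi_pos]) hx2
    have hs1 := Real.sin_le_one x
    have hc : Real.sin (2 * x) ≤ 0 := by
      rw [Real.sin_two_mul]
      have := Real.cos_nonpos_of_pi_div_two_le_of_le hx (by linarith [Real.pi_pos])
      nlinarith
    have : 1 ≤ muF x := by
      unfold muF
      rw [le_div_iff₀ (by positivity)]
      nlinarith [Real.pi_gt_three]
    nlinarith
  have hθ2 : |θ| < π / 2 := by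
    by_contra hcon
    push Not at hcon
    have q := key |θ| hcon h1
    have : |g.2| = Phi a r |θ| := by
      rcases le_total 0 θ with h0 | h0
      · rw [abs_of_nonneg h0] at q ⊢
        rw [h2] at hg1 ⊢
        exact abs_of_nonneg (hl.le.trans q)
      · rw [abs_of_nonpos h0] at q ⊢
        rw [Phi_neg] at q ⊢
        rw [h2]
        exact abs_of_nonpos (by linarith)
    linarith
  calc ∑ j, sdiv (a j * θ) ^ 2 * r j ≤ ∑ j, (π / 2) ^ 2 * r j := Finset.sum_le_sum fun j _ => by
        have := sdiv_le (h.abs_lt_pi hθ2 j).le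
        have := hr0 j
        gcongr
    _ = (π / 2) ^ 2 * ∑ j, r j := by rw [Finset.mul_sum]
    _ ≤ (π / 2) ^ 2 * (1 / 4) := by gcongr
    _ < 1 ^ 2 := by nlinarith [Real.pi_lt_d2, Real.pi_pos]

lemma Par.ball_fin (h : Par k a) : volume (ballCC l k a) ≠ ⊤ := by
  have := measure_mono (μ := volume) h.ball_sub
  have h2 := measure_union_le (μ := volume) (Kc k 7) {g : Heis l k | g.1 (Fin.last l) = 0}
  rw [h.ball_null, add_zero] at h2
  exact ((this.trans h2).trans_lt (Kc_compact 7).measure_lt_top).ne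
end

section
variable {l : ℕ} {k : Fin (l + 1) → ℕ} {a : Fin (l + 1) → ℝ}

lemma gradNorm_sub_const (f : Heis l k → ℝ) (m : ℝ) :
    gradNorm l k a (fun g => f g - m) = gradNorm l k a f := by
  funext g
  simp only [gradNorm, Xvf, Yvf, lineDeriv, deriv_sub_const]

lemma Par.ball_restrict (h : Par k a) {ρ : ℝ} (hρ : 7 ≤ ρ) :
    (volume : Measure (Heis l k)).restrict (ballCC l k a) ≤ volume.restrict (Kc k ρ) := by
  refine Measure.restrict_mono' ?_ le_rfl
  filter_upwards [h.ball_ae] with g hg hb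
  exact Kc_mono hρ (hg hb)

lemma Par.cont_ball (h : Par k a) {f : Heis l k → ℝ} (hf : Continuous f) :
    IntegrableOn f (ballCC l k a) :=
  Integrable.mono_measure (hf.continuousOn.integrableOn_compact (Kc_compact 7) : IntegrableOn f (Kc k 7) volume)
    (h.ball_restrict le_rfl)

lemma Par.pt_mean (h : Par k a) {ρ : ℝ} (hρ : 7 ≤ ρ) {f : Heis l k → ℝ} (hf : Continuous f)
    (g : Heis l k) : ‖f g - meanB l k a f‖ₑ ≤
      (volume (ballCC l k a))⁻¹ * ∫⁻ g' in Kc k ρ, ‖f g' - f g‖ₑ := by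
  have hV : 0 < (volume (ballCC l k a)).toReal := ENNReal.toReal_pos h.ball_pos.ne' h.ball_fin
  have e : f g - meanB l k a f =
      (volume (ballCC l k a)).toReal⁻¹ * -∫ g' in ballCC l k a, (f g' - f g) := by
    haveI : IsFiniteMeasure ((volume : Measure (Heis l k)).restrict (ballCC l k a)) :=
      ⟨by rw [Measure.restrict_apply_univ]; exact h.ball_fin.lt_top⟩
    rw [integral_sub (h.cont_ball hf) (integrable_const _), setIntegral_const]
    simp only [meanB, Measure.real, smul_eq_mul]
    field_simp
    ring
  rw [e, enorm_mul, enorm_neg]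
  have e2 : ‖(volume (ballCC l k a)).toReal⁻¹‖ₑ = (volume (ballCC l k a))⁻¹ := by
    rw [Real.enorm_eq_ofReal (by positivity), ENNReal.ofReal_inv_of_pos hV,
      ENNReal.ofReal_toReal h.ball_fin]
  rw [e2]
  gcongr
  exact (enorm_integral_le_lintegral_enorm _).trans (lintegral_mono' (h.ball_restrict hρ) le_rfl)

lemma Par.poinc_mean (h : Par k a) (M : ℝ) : ∃ C > 0, ∀ f : Heis l k → ℝ, ContDiff ℝ 1 f →
    HasCompactSupport f →
    ∫ g in {g | Mw g ≤ M}, |f g - meanB l k a f| * pk a g ≤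
      C * ∫ g, gradNorm l k a f g * pk a g := by
  set ρ := max M 7 with hρ
  obtain ⟨ρ', C0, hC0⟩ := h.poincare ρ
  obtain ⟨P, hP⟩ := (Kc_compact (l := l) (k := k) ρ).exists_bound_of_continuousOn h.pk_cont.continuousOn
  have hP1 : ∀ g ∈ Kc k ρ, pk a g ≤ max P 1 := fun g hg =>
    (le_abs_self _).trans ((hP g hg).trans (le_max_left _ _))
  have hPp : 0 < max P 1 := lt_max_of_lt_right one_pos
  obtain ⟨q, hq, hq1⟩ : ∃ q > 0, ∀ g ∈ Kc k ρ', q ≤ pk a g := by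
    rcases (Kc k ρ').eq_empty_or_nonempty with he | hne
    · exact ⟨1, one_pos, fun g hg => by simp [he] at hg⟩
    · obtain ⟨x, hx, hx2⟩ := (Kc_compact (l := l) (k := k) ρ').exists_isMinOn hne h.pk_cont.continuousOn
      exact ⟨pk a x, h.pk_pos x, fun g hg => hx2 hg⟩
  set V := (volume (ballCC l k a)).toReal with hVd
  have hV : 0 < V := ENNReal.toReal_pos h.ball_pos.ne' h.ball_fin
  refine ⟨max P 1 * (V⁻¹ * ((C0 + 1) * q⁻¹)), by positivity, fun f hf hs => ?_⟩
  set m := meanB l k a f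
  have hfc : Continuous f := hf.continuous
  have hgi := h.gradp_int hf (gradNorm_supp hs)
  have hgc : Continuous (gradNorm l k a f) := gradNorm_cont hf
  have hpn : ∀ g : Heis l k, 0 ≤ pk a g := fun g => (h.pk_pos g).le
  have hwc : Continuous fun g => |f g - m| := by fun_prop
  have hI0 : 0 ≤ ∫ g, gradNorm l k a f g * pk a g :=
    integral_nonneg fun g => mul_nonneg (gradNorm_nonneg _ _) (hpn g)
  have s1 : ∫ g in {g | Mw g ≤ M}, |f g - m| * pk a g ≤ max P 1 * ∫ g in Kc k ρ, |f g - m| := by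
    calc ∫ g in {g | Mw g ≤ M}, |f g - m| * pk a g ≤ ∫ g in Kc k ρ, |f g - m| * pk a g := by
          refine setIntegral_mono_set ((hwc.mul h.pk_cont).continuousOn.integrableOn_compact (Kc_compact ρ)) (ae_of_all _ fun g => mul_nonneg (abs_nonneg _) (hpn g)) ?_
          exact (Kc_mono (le_max_left M 7) : Kc k M ⊆ Kc k ρ).eventuallyLE
      _ ≤ ∫ g in Kc k ρ, max P 1 * |f g - m| := by
          refine setIntegral_mono_on ((hwc.mul h.pk_cont).continuousOn.integrableOn_compact (Kc_compact ρ)) ((continuous_const.mul hwc).continuousOn.integrableOn_compact (Kc_compact ρ)) (Kc_meas ρ) fun g hg => ?_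
          rw [mul_comm]
          exact mul_le_mul_of_nonneg_right (hP1 g hg) (abs_nonneg _)
      _ = _ := integral_const_mul _ _
  have s2 : ∫ g in Kc k ρ, |f g - m| ≤ V⁻¹ * ((C0 + 1) * ∫ g in Kc k ρ', gradNorm l k a f g) := by
    have hi2 : IntegrableOn (gradNorm l k a f) (Kc k ρ') := hgc.continuousOn.integrableOn_compact (Kc_compact ρ')
    have hn : 0 ≤ ∫ g in Kc k ρ', gradNorm l k a f g := integral_nonneg fun g => gradNorm_nonneg _ _
    rw [integral_eq_lintegral_of_nonneg_ae (ae_of_all _ fun g => abs_nonneg _) hwc.aestronglyMeasurable]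
    refine ENNReal.toReal_le_of_le_ofReal (by positivity) ?_
    have e3 : ∀ g, ENNReal.ofReal |f g - m| = ‖f g - m‖ₑ := fun g => (Real.enorm_eq_ofReal_abs _).symm
    simp only [e3]
    have e4 : ∫⁻ g in Kc k ρ', ‖gradNorm l k a f g‖ₑ = ENNReal.ofReal (∫ g in Kc k ρ', gradNorm l k a f g) := by
      rw [ofReal_integral_eq_lintegral_ofReal hi2 (ae_of_all _ fun g => gradNorm_nonneg _ _)]
      simp only [Real.enorm_eq_ofReal (gradNorm_nonneg _ _)]
    have e5 : ENNReal.ofReal V⁻¹ = (volume (ballCC l k a))⁻¹ := by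
      rw [ENNReal.ofReal_inv_of_pos hV, ENNReal.ofReal_toReal h.ball_fin]
    calc ∫⁻ g in Kc k ρ, ‖f g - m‖ₑ
        ≤ ∫⁻ g in Kc k ρ, (volume (ballCC l k a))⁻¹ * ∫⁻ g' in Kc k ρ, ‖f g' - f g‖ₑ :=
          lintegral_mono fun g => h.pt_mean (le_max_right M 7) hfc g
      _ = (volume (ballCC l k a))⁻¹ * ∫⁻ g in Kc k ρ, ∫⁻ g' in Kc k ρ, ‖f g' - f g‖ₑ :=
          lintegral_const_mul' _ _ (ENNReal.inv_ne_top.2 h.ball_pos.ne')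
      _ ≤ (volume (ballCC l k a))⁻¹ * (C0 * ∫⁻ g in Kc k ρ', ‖gradNorm l k a f g‖ₑ) := by
          gcongr
          exact hC0 f hf
      _ ≤ _ := by
          rw [e4, ENNReal.ofReal_mul (by positivity), e5, ENNReal.ofReal_mul (by positivity)]
          gcongr
          rw [← ENNReal.ofReal_coe_nnreal]
          exact ENNReal.ofReal_le_ofReal (by linarith)
  have s3 : ∫ g in Kc k ρ', gradNorm l k a f g ≤ q⁻¹ * ∫ g, gradNorm l k a f g * pk a g := by
    calc ∫ g in Kc k ρ', gradNorm l k a f g ≤ ∫ g in Kc k ρ', q⁻¹ * (gradNorm l k a f g * pk a g) := by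
          refine setIntegral_mono_on (hgc.continuousOn.integrableOn_compact (Kc_compact ρ')) (hgi.const_mul _).integrableOn (Kc_meas ρ') fun g hg => ?_
          have := hq1 g hg
          have h0 := gradNorm_nonneg (a := a) f g
          rw [inv_mul_eq_div, le_div_iff₀ hq]
          gcongr
      _ = q⁻¹ * ∫ g in Kc k ρ', gradNorm l k a f g * pk a g := integral_const_mul _ _
      _ ≤ _ := by
          refine mul_le_mul_of_nonneg_left ?_ (by positivity)
          exact setIntegral_le_integral hgi (ae_of_all _ fun g => mul_nonneg (gradNorm_nonneg _ _) (hpn g))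
  calc _ ≤ _ := s1
    _ ≤ max P 1 * (V⁻¹ * ((C0 + 1) * (q⁻¹ * ∫ g, gradNorm l k a f g * pk a g))) := by
        gcongr
        exact s2.trans (by gcongr)
    _ = _ := by ring

lemma Par.final (h : Par k a) : ∃ C : ℝ, 0 < C ∧ ∀ f : Heis l k → ℝ, ContDiff ℝ 1 f →
    HasCompactSupport f →
    ∫ g in (ballCC l k a)ᶜ, |f g - meanB l k a f| * pk a g ≤
      C * ∫ g, gradNorm l k a f g * pk a g := by
  obtain ⟨M0, hM0, K, hK, hL⟩ := h.lyap
  obtain ⟨C1, hC1, hP⟩ := h.poinc_mean M0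
  refine ⟨K * (C1 + 1), by positivity, fun f hf hs => ?_⟩
  have hpn : ∀ g : Heis l k, 0 ≤ pk a g := fun g => (h.pk_pos g).le
  have hI0 : 0 ≤ ∫ g, gradNorm l k a f g * pk a g :=
    integral_nonneg fun g => mul_nonneg (gradNorm_nonneg _ _) (hpn g)
  by_cases hi : IntegrableOn (fun g => |f g - meanB l k a f| * pk a g) (ballCC l k a)ᶜ
  swap
  · rw [integral_undef hi]; positivity
  have hfc : Continuous f := hf.continuous
  have hpc := h.pk_cont
  have hiB := h.cont_ball (f := fun g => |f g - meanB l k a f| * pk a g) (by fun_prop)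
  have hiA : Integrable (fun g => |f g - meanB l k a f| * pk a g) := by
    have := hiB.union hi
    rwa [Set.union_compl_self, integrableOn_univ] at this
  have hw : ContDiff ℝ 1 (fun g => f g - meanB l k a f) := hf.sub contDiff_const
  have hg := gradNorm_sub_const (a := a) f (meanB l k a f)
  have q := hL (fun g => f g - meanB l k a f) hw (by rw [hg]; exact gradNorm_supp hs) hiA
  rw [hg] at q
  calc _ ≤ ∫ g, |f g - meanB l k a f| * pk a g :=
        setIntegral_le_integral hiA (ae_of_all _ fun g => mul_nonneg (abs_nonneg _) (hpn g))
    _ ≤ _ := q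
    _ ≤ K * (C1 * (∫ g, gradNorm l k a f g * pk a g) + ∫ g, gradNorm l k a f g * pk a g) := by
        gcongr
        exact hP f hf hs
    _ = _ := by ring
end

/-- For all `f ∈ C_c^∞(ℍ)` one has
`∫_{Bᶜ} |f − m_f| p dm ≲ ∫_ℍ |∇f| p dm`, where `B` is the Carnot–Carathéodory unit ball,
`p = p₁` is the heat kernel at time `1`, `m_f` is the mean of `f` over `B`, and the implied
constant depends only on `(𝒦,𝒜)`. -/
theorem statement5 (l : ℕ) (k : Fin (l + 1) → ℕ) (hk : ∀ i, 0 < k i)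
    (a : Fin (l + 1) → ℝ) (ha0 : 0 < a 0) (haMono : StrictMono a)
    (haLast : a (Fin.last l) = 1) :
    ∃ C > (0 : ℝ), ∀ f : Heis l k → ℝ, ContDiff ℝ (⊤ : ℕ∞) f → HasCompactSupport f →
      ∫ g in (ballCC l k a)ᶜ, |f g - meanB l k a f| * heatKernel l k a 1 g ≤
        C * ∫ g : Heis l k, gradNorm l k a f g * heatKernel l k a 1 g := by
  have h : Par k a := ⟨hk, fun j => ha0.trans_le (haMono.monotone (Fin.zero_le j)),
    fun j hj => haLast ▸ haMono (Fin.lt_last_iff_ne_last.2 hj), haLast⟩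
  obtain ⟨C, hC, H⟩ := h.final
  refine ⟨C, hC, fun f hf hs => ?_⟩
  have e : heatKernel l k a 1 = pk a := funext fun g => h.heatKernel_eq g
  rw [e]
  exact H f (hf.of_le (by exact_mod_cast le_top)) hs

end
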